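/- Let H be a fixed finite simple graph and let P_n be a graph sampled uniformly at random from 𝒫_n. Write H ⊑ᵢ P_n if P_n has an induced subgraph isomorphic to H. Then there exist c > 0 and n₀ (depending on H) such that for all n ≥ n₀: (i) if H is not a generalised split graph then P(H ⊑ᵢ P_n) ≤ e^{−cn}; (ii) if H is a generalised split graph but H is not both unipolar and co-unipolar, then |P(H ⊑ᵢ P_n) − 1/2| ≤ e^{−cn}; (iii) if H is both unipolar and co-unipolar then P(H ⊑ᵢ P_n) ≥ 1 − e^{−cn}. -/

import Mathlib

open scoped Classical
open Filter

noncomputable section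

/-- A finite simple graph is perfect if every induced subgraph has chromatic number
equal to clique number. -/
def IsPerfect {V : Type*} (G : SimpleGraph V) : Prop :=
  ∀ s : Set V, (G.induce s).chromaticNumber = ((G.induce s).cliqueNum : ℕ∞)

/-- `(G, C)` is a unipolar arrangement: `C` is a clique (the central clique) and every
connected component of the subgraph induced on the complement of `C` is a clique. -/
def IsUnipolarArrangement {V : Type*} (G : SimpleGraph V) (C : Set V) : Prop :=
  G.IsClique C ∧
    ∀ u v : (Cᶜ : Set V), (G.induce Cᶜ).Reachable u v → u ≠ v → (G.induce Cᶜ).Adj u v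

def IsUnipolar {V : Type*} (G : SimpleGraph V) : Prop :=
  ∃ C : Set V, IsUnipolarArrangement G C

def IsCoUnipolar {V : Type*} (G : SimpleGraph V) : Prop := IsUnipolar Gᶜ

def IsGenSplit {V : Type*} (G : SimpleGraph V) : Prop := IsUnipolar G ∨ IsCoUnipolar G

/-- the `m`-th Bell number: the number of partitions of an `m`-element set. -/
def bell (m : ℕ) : ℕ := Nat.card (Finpartition (Finset.univ : Finset (Fin m)))

/-- `ℓ_{n,k} = C(n,k) · 2^{k(n-k)} · B_{n-k}` -/
def ell (n k : ℕ) : ℕ := Nat.choose n k * 2 ^ (k * (n - k)) * bell (n - k)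

/-- `𝓛_n = Σ_{k=0}^n ℓ_{n,k}` -/
def scrL (n : ℕ) : ℕ := ∑ k ∈ Finset.range (n + 1), ell n k

/-- the number of perfect graphs on `{1,…,n}` -/
def perfectCount (n : ℕ) : ℕ := Nat.card {G : SimpleGraph (Fin n) // IsPerfect G}

/-- independence number -/
def indepNum {V : Type*} (G : SimpleGraph V) : ℕ := Gᶜ.cliqueNum

/-- the probability that a uniformly random perfect graph on `{1,…,n}` contains an induced
copy of `H` -/
def inducedProb {W : Type*} (H : SimpleGraph W) (n : ℕ) : ℝ :=
  (Nat.card {G : SimpleGraph (Fin n) // IsPerfect G ∧ Nonempty (H ↪g G)} : ℝ) /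
    (perfectCount n : ℝ)

set_option linter.unusedSectionVars false

/-- Elementary form of a unipolar arrangement. -/
def UniArr {V : Type*} (G : SimpleGraph V) (C : Set V) : Prop :=
  (∀ x ∈ C, ∀ y ∈ C, x ≠ y → G.Adj x y) ∧
    ∀ x ∉ C, ∀ y ∉ C, ∀ z ∉ C, G.Adj x y → G.Adj y z → x ≠ z → G.Adj x z

theorem isUnipolarArrangement_iff {V : Type*} {G : SimpleGraph V} {C : Set V} :
    IsUnipolarArrangement G C ↔ UniArr G C := by
  constructor
  · rintro ⟨h1, h2⟩
    refine ⟨fun x hx y hy hxy => h1 hx hy hxy, ?_⟩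
    intro x hx y hy z hz hxy hyz hxz
    have a1 : (G.induce Cᶜ).Adj ⟨x, hx⟩ ⟨y, hy⟩ := hxy
    have a2 : (G.induce Cᶜ).Adj ⟨y, hy⟩ ⟨z, hz⟩ := hyz
    exact h2 ⟨x, hx⟩ ⟨z, hz⟩ (a1.reachable.trans a2.reachable) (by simpa using hxz)
  · rintro ⟨h1, h2⟩
    refine ⟨fun x hx y hy hxy => h1 x hx y hy hxy, ?_⟩
    rintro u v ⟨p⟩ huv
    induction p with
    | nil => exact absurd rfl huv
    | @cons u w v h p ih =>
      by_cases hwv : w = v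
      · exact hwv ▸ h
      · exact h2 _ u.2 _ w.2 _ v.2 h (ih hwv) (fun h => huv (Subtype.ext h))

theorem isUnipolar_iff {V : Type*} {G : SimpleGraph V} :
    IsUnipolar G ↔ ∃ C, UniArr G C :=
  exists_congr fun _ => isUnipolarArrangement_iff

theorem UniArr.comap {V W : Type*} {G : SimpleGraph V} {H : SimpleGraph W} {C : Set V}
    (h : UniArr G C) (φ : H ↪g G) : UniArr H (φ ⁻¹' C) := by
  constructor
  · intro x hx y hy hxy
    exact φ.map_adj_iff.1 (h.1 _ hx _ hy (fun e => hxy (φ.injective e)))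
  · intro x hx y hy z hz hxy hyz hxz
    exact φ.map_adj_iff.1 (h.2 _ hx _ hy _ hz (φ.map_adj_iff.2 hxy) (φ.map_adj_iff.2 hyz)
      (fun e => hxz (φ.injective e)))

/-- An induced embedding is also an induced embedding of the complements. -/
def complEmb {V W : Type*} {G : SimpleGraph V} {H : SimpleGraph W} (φ : H ↪g G) :
    Hᶜ ↪g Gᶜ where
  toFun := φ
  inj' := φ.injective
  map_rel_iff' := by
    intro a b
    simp [SimpleGraph.compl_adj, φ.injective.ne_iff]

theorem IsUnipolar.comap {V W : Type*} {G : SimpleGraph V} {H : SimpleGraph W}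
    (h : IsUnipolar G) (φ : H ↪g G) : IsUnipolar H := by
  obtain ⟨C, hC⟩ := isUnipolar_iff.1 h
  exact isUnipolar_iff.2 ⟨_, hC.comap φ⟩

theorem IsCoUnipolar.comap {V W : Type*} {G : SimpleGraph V} {H : SimpleGraph W}
    (h : IsCoUnipolar G) (φ : H ↪g G) : IsCoUnipolar H :=
  IsUnipolar.comap (H := Hᶜ) h (complEmb φ)

theorem IsGenSplit.comap {V W : Type*} {G : SimpleGraph V} {H : SimpleGraph W}
    (h : IsGenSplit G) (φ : H ↪g G) : IsGenSplit H :=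
  h.imp (fun h => h.comap φ) (fun h => h.comap φ)

theorem isCoUnipolar_compl {V : Type*} {G : SimpleGraph V} : IsCoUnipolar Gᶜ ↔ IsUnipolar G := by
  unfold IsCoUnipolar
  rw [compl_compl]

/-- The cliques of the side graph of a unipolar arrangement. -/
def blockSetoid {V : Type*} {G : SimpleGraph V} {C : Set V} (h : UniArr G C) :
    Setoid {x // x ∉ C} where
  r x y := x = y ∨ G.Adj x y
  iseqv := by
    refine ⟨fun _ => Or.inl rfl, ?_, ?_⟩
    · rintro x y (rfl | h)
      · exact Or.inl rfl
      · exact Or.inr h.symm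
    · rintro x y z (rfl | h1) (rfl | h2)
      · exact Or.inl rfl
      · exact Or.inr h2
      · exact Or.inr h1
      · by_cases hxz : x = z
        · exact Or.inl hxz
        · exact Or.inr (h.2 _ x.2 _ y.2 _ z.2 h1 h2 (fun e => hxz (Subtype.ext e)))

theorem UniArr.colorable {V : Type*} [Fintype V] {G : SimpleGraph V} {C : Set V}
    (h : UniArr G C) : G.Colorable G.cliqueNum := by
  set ω := G.cliqueNum with hω
  have hle : ∀ T : Finset V, (∀ x ∈ T, ∀ y ∈ T, x ≠ y → G.Adj x y) → T.card ≤ ω := by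
    intro T hT
    exact SimpleGraph.IsClique.card_le_cliqueNum (t := T) (tc := fun x hx y hy hxy => hT x hx y hy hxy)
  obtain ⟨ι, hι⟩ : ∃ ι : V → Fin ω, Set.InjOn ι C ∨ C = ∅ := by
    by_cases hC : C = ∅
    · by_cases hV : Nonempty V
      · obtain ⟨x⟩ := hV
        have : 1 ≤ ω := by
          have := hle {x} (by simp)
          simpa using this
        exact ⟨fun _ => ⟨0, this⟩, Or.inr hC⟩
      · exact ⟨fun x => (hV ⟨x⟩).elim, Or.inr hC⟩
    · have hc : Fintype.card C ≤ Fintype.card (Fin ω) := by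
        have := hle C.toFinset (by simpa using h.1)
        simpa using this
      obtain ⟨e⟩ := Function.Embedding.nonempty_of_card_le hc
      obtain ⟨c0, hc0⟩ := Set.nonempty_iff_ne_empty.2 hC
      refine ⟨fun x => if hx : x ∈ C then e ⟨x, hx⟩ else e ⟨c0, hc0⟩, Or.inl ?_⟩
      intro x hx y hy hxy
      simp only [hx, hy, dif_pos] at hxy
      simpa using e.injective hxy
  have hιinj : Set.InjOn ι C := by
    rcases hι with h | h
    · exact h
    · rw [h]; simp
  let S := blockSetoid h
  have key : ∀ q : Quotient S, ∃ f : {x : {x // x ∉ C} // (⟦x⟧ : Quotient S) = q} → Fin ω,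
      Function.Injective f ∧ ∀ x, ∀ c ∈ C, G.Adj c x.1.1 → f x ≠ ι c := by
    intro q
    let t : {x : {x // x ∉ C} // (⟦x⟧ : Quotient S) = q} → Finset (Fin ω) := fun x =>
      Finset.univ \ (C.toFinset.filter (fun c => G.Adj c x.1.1)).image ι
    obtain ⟨f, hf, hf2⟩ := (Finset.all_card_le_biUnion_card_iff_exists_injective t).1 (by
      intro T
      rcases T.eq_empty_or_nonempty with rfl | ⟨x0, hx0⟩
      · simp
      set K := C.toFinset.filter (fun c => ∀ x ∈ T, G.Adj c x.1.1) with hK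
      have hsub : Finset.univ \ K.image ι ⊆ T.biUnion t := by
        intro i hi
        by_contra hcon
        apply (Finset.mem_sdiff.1 hi).2
        replace hcon : ∀ x ∈ T, ∃ c, (c ∈ C ∧ G.Adj c x.1.1) ∧ ι c = i := by
          intro x hx
          by_contra hcx
          refine hcon (Finset.mem_biUnion.2 ⟨x, hx, Finset.mem_sdiff.2 ⟨Finset.mem_univ _, ?_⟩⟩)
          intro hm
          obtain ⟨c, hc, hci⟩ := Finset.mem_image.1 hm
          exact hcx ⟨c, by simpa using hc, hci⟩
        obtain ⟨c, hc, hci⟩ := hcon x0 hx0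
        refine Finset.mem_image.2 ⟨c, ?_, hci⟩
        simp only [hK, Finset.mem_filter, Set.mem_toFinset]
        refine ⟨hc.1, fun x hx => ?_⟩
        obtain ⟨c', hc', hci'⟩ := hcon x hx
        have := hιinj hc'.1 hc.1 (hci'.trans hci.symm)
        exact this ▸ hc'.2
      have hcl : (T.image (fun x => x.1.1) ∪ K).card ≤ ω := by
        apply hle
        have hTT : ∀ x ∈ T, ∀ y ∈ T, x.1.1 ≠ y.1.1 → G.Adj x.1.1 y.1.1 := by
          intro x _ y _ hxy
          have : S.r x.1 y.1 := Quotient.exact (x.2.trans y.2.symm)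
          rcases this with e | e
          · exact absurd (congrArg Subtype.val e) hxy
          · exact e
        intro x hx y hy hxy
        simp only [Finset.mem_union, Finset.mem_image, hK, Finset.mem_filter,
          Set.mem_toFinset] at hx hy
        rcases hx with ⟨x', hx', rfl⟩ | hx <;> rcases hy with ⟨y', hy', rfl⟩ | hy
        · exact hTT _ hx' _ hy' hxy
        · exact (hy.2 _ hx').symm
        · exact hx.2 _ hy'
        · exact h.1 _ hx.1 _ hy.1 hxy
      rw [Finset.card_union_of_disjoint, Finset.card_image_of_injective] at hcl
      · have h1 := Finset.card_le_card hsub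
        have h2 := Finset.le_card_sdiff (K.image ι) Finset.univ
        have h3 : (K.image ι).card ≤ K.card := Finset.card_image_le
        simp only [Finset.card_univ, Fintype.card_fin] at h2
        omega
      · intro x y hxy
        exact Subtype.ext (Subtype.ext hxy)
      · rw [Finset.disjoint_left]
        intro x hx hx'
        obtain ⟨y, _, rfl⟩ := Finset.mem_image.1 hx
        simp only [hK, Finset.mem_filter, Set.mem_toFinset] at hx'
        exact y.1.2 hx'.1)
    refine ⟨f, hf, ?_⟩
    intro x c hc hcx hfc
    have := hf2 x
    simp only [t, Finset.mem_sdiff, Finset.mem_univ, true_and] at this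
    exact this (Finset.mem_image.2 ⟨c, by simp [hc, hcx], hfc.symm⟩)
  choose f hf1 hf2 using key
  refine ⟨SimpleGraph.Coloring.mk
    (fun x => if hx : x ∈ C then ι x else f ⟦⟨x, hx⟩⟧ ⟨⟨x, hx⟩, rfl⟩) ?_⟩
  intro x y hxy
  by_cases hx : x ∈ C <;> by_cases hy : y ∈ C <;> simp only [hx, hy, dif_pos, dif_neg,
    not_false_eq_true]
  · exact fun e => hxy.ne (hιinj hx hy e)
  · exact (hf2 _ ⟨⟨y, hy⟩, rfl⟩ x hx hxy).symm
  · exact (hf2 _ ⟨⟨x, hx⟩, rfl⟩ y hy hxy.symm)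
  · have hq : (⟦⟨x, hx⟩⟧ : Quotient S) = ⟦⟨y, hy⟩⟧ := Quotient.sound (Or.inr hxy)
    intro e
    have gen : ∀ p q : Quotient S, p = q → ∀ (h1 : ⟦⟨x, hx⟩⟧ = p) (h2 : ⟦⟨x, hx⟩⟧ = q),
        f p ⟨⟨x, hx⟩, h1⟩ = f q ⟨⟨x, hx⟩, h2⟩ := by
      rintro p _ rfl _ _
      rfl
    rw [gen _ _ hq rfl hq] at e
    exact hxy.ne (by simpa using hf1 _ e)

theorem UniArr.colorable_compl {V : Type*} [Fintype V] {U : SimpleGraph V} {C : Set V}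
    (h : UniArr U C) : Uᶜ.Colorable Uᶜ.cliqueNum := by
  let S := blockSetoid h
  have hle : ∀ T : Finset V, (∀ x ∈ T, ∀ y ∈ T, x ≠ y → ¬ U.Adj x y) →
      T.card ≤ Uᶜ.cliqueNum := by
    intro T hT
    exact SimpleGraph.IsClique.card_le_cliqueNum (t := T) (tc := fun x hx y hy hxy => by
      rw [SimpleGraph.compl_adj]; exact ⟨hxy, hT x hx y hy hxy⟩)
  have hind : ∀ r : Quotient S → {x // x ∉ C}, (∀ q, ⟦r q⟧ = q) → ∀ p q, p ≠ q →
      ¬ U.Adj (r p).1 (r q).1 := by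
    intro r hr p q hpq hadj
    apply hpq
    rw [← hr p, ← hr q]
    exact Quotient.sound (Or.inr hadj)
  by_cases hcase : ∀ c ∈ C, ∃ q : Quotient S, ∀ x : {x // x ∉ C}, (⟦x⟧ : Quotient S) = q →
      U.Adj c x.1
  · choose g hg using hcase
    · have hcol : Uᶜ.Coloring (Quotient S) := SimpleGraph.Coloring.mk
        (fun x => if hx : x ∈ C then g x hx else ⟦⟨x, hx⟩⟧) (by
        intro x y hxy e
        rw [SimpleGraph.compl_adj] at hxy
        by_cases hx : x ∈ C <;> by_cases hy : y ∈ C <;> simp only [hx, hy, dif_pos, dif_neg,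
          not_false_eq_true] at e
        · exact hxy.2 (h.1 _ hx _ hy hxy.1)
        · exact hxy.2 (hg x hx ⟨y, hy⟩ e.symm)
        · exact hxy.2 (hg y hy ⟨x, hx⟩ e).symm
        · rcases (Quotient.exact e : S.r _ _) with e | e
          · exact hxy.1 (congrArg Subtype.val e)
          · exact hxy.2 e)
      refine hcol.colorable.mono ?_
      have hr : ∀ q : Quotient S, (⟦Quotient.out q⟧ : Quotient S) = q := fun q => Quotient.out_eq q
      have := hle (Finset.univ.image (fun q : Quotient S => (Quotient.out q).1)) (by
        intro x hx y hy hxy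
        obtain ⟨p, _, rfl⟩ := Finset.mem_image.1 hx
        obtain ⟨q, _, rfl⟩ := Finset.mem_image.1 hy
        exact hind _ hr p q (fun e => hxy (by rw [e])))
      rw [Finset.card_image_of_injective] at this
      · simpa using this
      · intro p q hpq
        rw [← hr p, ← hr q, Subtype.ext hpq]
  · push Not at hcase
    obtain ⟨c, hc, hcq⟩ := hcase
    choose r hr hrc using hcq
    have hcol : Uᶜ.Coloring (Option (Quotient S)) := SimpleGraph.Coloring.mk
        (fun x => if hx : x ∈ C then none else some ⟦⟨x, hx⟩⟧) (by
        intro x y hxy e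
        rw [SimpleGraph.compl_adj] at hxy
        by_cases hx : x ∈ C <;> by_cases hy : y ∈ C <;> simp only [hx, hy, dif_pos, dif_neg,
          not_false_eq_true, reduceCtorEq, Option.some.injEq] at e
        · exact hxy.2 (h.1 _ hx _ hy hxy.1)
        · rcases (Quotient.exact e : S.r _ _) with e | e
          · exact hxy.1 (congrArg Subtype.val e)
          · exact hxy.2 e)
    refine hcol.colorable.mono ?_
    have := hle (insert c (Finset.univ.image (fun q : Quotient S => (r q).1))) (by
        intro x hx y hy hxy
        rw [Finset.mem_insert] at hx hy
        rcases hx with rfl | hx <;> rcases hy with rfl | hy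
        · exact absurd rfl hxy
        · obtain ⟨q, _, rfl⟩ := Finset.mem_image.1 hy
          exact hrc q
        · obtain ⟨q, _, rfl⟩ := Finset.mem_image.1 hx
          exact fun e => hrc q e.symm
        · obtain ⟨p, _, rfl⟩ := Finset.mem_image.1 hx
          obtain ⟨q, _, rfl⟩ := Finset.mem_image.1 hy
          exact hind _ hr p q (fun e => hxy (by rw [e])))
    rw [Finset.card_insert_of_notMem, Finset.card_image_of_injective] at this
    · simpa using this
    · intro p q hpq
      rw [← hr p, ← hr q, Subtype.ext hpq]
    · intro hmem
      obtain ⟨q, _, e⟩ := Finset.mem_image.1 hmem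
      exact (r q).2 (e ▸ hc)

theorem IsGenSplit.isPerfect {V : Type*} [Fintype V] {G : SimpleGraph V} (h : IsGenSplit G) :
    IsPerfect G := by
  intro s
  have h' : IsGenSplit (G.induce s) := h.comap (SimpleGraph.Embedding.induce s)
  refine le_antisymm ?_ SimpleGraph.cliqueNum_le_chromaticNumber
  apply SimpleGraph.Colorable.chromaticNumber_le
  rcases h' with h' | h'
  · obtain ⟨C, hC⟩ := isUnipolar_iff.1 h'
    exact hC.colorable
  · obtain ⟨C, hC⟩ := isUnipolar_iff.1 h'
    have := hC.colorable_compl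
    rwa [compl_compl] at this

/-- No induced cycle of length five. -/
def C5Free {V : Type*} (G : SimpleGraph V) : Prop :=
  ∀ v a b c d, ¬ (G.Adj v a ∧ G.Adj a b ∧ G.Adj b c ∧ G.Adj c d ∧ G.Adj d v ∧
    ¬ G.Adj v b ∧ ¬ G.Adj v c ∧ ¬ G.Adj a c ∧ ¬ G.Adj a d ∧ ¬ G.Adj b d)

theorem IsPerfect.c5Free {V : Type*} {G : SimpleGraph V} (h : IsPerfect G) : C5Free G := by
  rintro v a b c d ⟨h1, h2, h3, h4, h5, g1, g2, g3, g4, g5⟩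
  have hs := h {v, a, b, c, d}
  set s : Set V := {v, a, b, c, d} with hsdef
  have hcl : (G.induce s).cliqueNum ≤ 2 := by
    by_contra hcon
    push Not at hcon
    obtain ⟨T, hT⟩ := SimpleGraph.exists_isNClique_cliqueNum (G := G.induce s)
    obtain ⟨T', hT', hc⟩ := Finset.exists_subset_card_eq (hT.card_eq.symm ▸ hcon : 3 ≤ T.card)
    obtain ⟨x, y, z, hxy, hxz, hyz, rfl⟩ := Finset.card_eq_three.1 hc
    have c1 : G.Adj x y := hT.1 (hT' (by simp)) (hT' (by simp)) hxy
    have c2 : G.Adj x z := hT.1 (hT' (by simp)) (hT' (by simp)) hxz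
    have c3 : G.Adj y z := hT.1 (hT' (by simp)) (hT' (by simp)) hyz
    obtain ⟨x, hx⟩ := x
    obtain ⟨y, hy⟩ := y
    obtain ⟨z, hz⟩ := z
    simp only [hsdef, Set.mem_insert_iff, Set.mem_singleton_iff] at hx hy hz
    simp only at c1 c2 c3
    have k1 := h1.symm
    have k2 := h2.symm
    have k3 := h3.symm
    have k4 := h4.symm
    have k5 := h5.symm
    rw [SimpleGraph.adj_comm] at g1 g2 g3 g4 g5
    clear hxy hxz hyz hc hT' hT hs hcon
    rcases hx with rfl | rfl | rfl | rfl | rfl <;> rcases hy with rfl | rfl | rfl | rfl | rfl <;>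
      first
      | exact absurd c1 (G.loopless.irrefl _)
      | exact absurd c1 ‹_›
      | exact absurd c1.symm ‹_›
      | (rcases hz with rfl | rfl | rfl | rfl | rfl <;>
          first
          | exact absurd c2 (G.loopless.irrefl _)
          | exact absurd c2 ‹_›
          | exact absurd c2.symm ‹_›
          | exact absurd c3 (G.loopless.irrefl _)
          | exact absurd c3 ‹_›
          | exact absurd c3.symm ‹_›)
  have hcol : (G.induce s).Colorable 2 := by
    rw [← SimpleGraph.chromaticNumber_le_iff_colorable, hs]
    exact_mod_cast hcl
  obtain ⟨f⟩ := hcol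
  have e1 := f.valid (v := ⟨v, by simp [hsdef]⟩) (w := ⟨a, by simp [hsdef]⟩) h1
  have e2 := f.valid (v := ⟨a, by simp [hsdef]⟩) (w := ⟨b, by simp [hsdef]⟩) h2
  have e3 := f.valid (v := ⟨b, by simp [hsdef]⟩) (w := ⟨c, by simp [hsdef]⟩) h3
  have e4 := f.valid (v := ⟨c, by simp [hsdef]⟩) (w := ⟨d, by simp [hsdef]⟩) h4
  have e5 := f.valid (v := ⟨d, by simp [hsdef]⟩) (w := ⟨v, by simp [hsdef]⟩) h5
  omega

theorem C5Free.compl {V : Type*} {G : SimpleGraph V} (h : C5Free G) : C5Free Gᶜ := by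
  rintro v a b c d ⟨h1, h2, h3, h4, h5, g1, g2, g3, g4, g5⟩
  have s1 := h1.symm
  have s2 := h2.symm
  have s3 := h3.symm
  have s4 := h4.symm
  have s5 := h5.symm
  have n1 : v ≠ b := by rintro rfl; exact g2 h3
  have n2 : v ≠ c := by rintro rfl; exact g3 s1
  have n3 : a ≠ c := by rintro rfl; exact g2 h1
  have n4 : a ≠ d := by rintro rfl; exact g3 s4
  have n5 : b ≠ d := by rintro rfl; exact g1 s5
  simp only [SimpleGraph.compl_adj, not_and, not_not] at *
  refine h v b d a c ⟨g1 n1, g5 n5, (g4 n4).symm, g3 n3, (g2 n2).symm, ?_, h1.2, ?_, h3.2, ?_⟩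
  · exact s5.2
  · exact s2.2
  · exact s4.2

theorem C5Free.comap {V W : Type*} {G : SimpleGraph V} {H : SimpleGraph W} (h : C5Free G)
    (φ : H ↪g G) : C5Free H := by
  intro v a b c d hh
  exact h (φ v) (φ a) (φ b) (φ c) (φ d) (by simpa using hh)

/-! ### Block graphs and packings -/

/-- `r` disjoint cliques of size `r`. -/
def cliqueUnion (r : ℕ) : SimpleGraph (Fin r × Fin r) where
  Adj x y := x.1 = y.1 ∧ x ≠ y
  symm := ⟨fun _ _ h => ⟨h.1.symm, h.2.symm⟩⟩
  loopless := ⟨fun _ h => h.2 rfl⟩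

theorem isUnipolar_cliqueUnion (r : ℕ) : IsUnipolar (cliqueUnion r) := by
  refine isUnipolar_iff.2 ⟨∅, by simp, ?_⟩
  rintro x - y - z - hxy hyz hxz
  exact ⟨hxy.1.trans hyz.1, hxz⟩

theorem not_isCoUnipolar_cliqueUnion : ¬ IsCoUnipolar (cliqueUnion 3) := by
  intro h
  obtain ⟨C, hC1, hC2⟩ := isUnipolar_iff.1 h
  have hone : ∀ i j k : Fin 3, j ≠ k → (i, j) ∉ C ∨ (i, k) ∉ C := by
    intro i j k hjk
    by_contra hcon
    push Not at hcon
    have := hC1 _ hcon.1 _ hcon.2 (by simpa using hjk)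
    simp [SimpleGraph.compl_adj, cliqueUnion, hjk] at this
  have htwo : ∀ i : Fin 3, ∃ j k : Fin 3, j ≠ k ∧ (i, j) ∉ C ∧ (i, k) ∉ C := by
    intro i
    by_cases h0 : (i, (0 : Fin 3)) ∈ C
    · exact ⟨1, 2, by decide, (hone i 0 1 (by decide)).resolve_left (by simpa using h0),
        (hone i 0 2 (by decide)).resolve_left (by simpa using h0)⟩
    · rcases hone i 1 2 (by decide) with h | h
      · exact ⟨0, 1, by decide, h0, h⟩
      · exact ⟨0, 2, by decide, h0, h⟩
  obtain ⟨j, k, hjk, hj, hk⟩ := htwo 0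
  obtain ⟨l, -, -, hl, -⟩ := htwo 1
  have := hC2 _ hj _ hl _ hk (by simp [SimpleGraph.compl_adj, cliqueUnion])
    (by simp [SimpleGraph.compl_adj, cliqueUnion]) (by simpa using hjk)
  simp [SimpleGraph.compl_adj, cliqueUnion, hjk] at this

/-- `X` contains `t` pairwise disjoint induced copies of `H`. -/
def Pack {V W : Type*} (G : SimpleGraph V) (H : SimpleGraph W) (X : Finset V) (t : ℕ) : Prop :=
  ∃ φ : Fin t → (H ↪g G), (∀ i w, φ i w ∈ X) ∧ ∀ i j w w', φ i w = φ j w' → i = j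

theorem Pack.mono {V W : Type*} {G : SimpleGraph V} {H : SimpleGraph W} {X Y : Finset V}
    {s t : ℕ} (h : Pack G H X t) (hst : s ≤ t) (hXY : X ⊆ Y) : Pack G H Y s := by
  obtain ⟨φ, h1, h2⟩ := h
  refine ⟨fun i => φ (Fin.castLE hst i), fun i w => hXY (h1 _ _), fun i j w w' h => ?_⟩
  exact Fin.castLE_injective hst (h2 _ _ _ _ h)

theorem Pack.sdiff {V W : Type*} {G : SimpleGraph V} {H : SimpleGraph W} {X Z : Finset V}
    {t s : ℕ} (h : Pack G H X t) (hZ : Z.card + s ≤ t) : Pack G H (X \ Z) s := by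
  obtain ⟨φ, h1, h2⟩ := h
  let bad : Finset (Fin t) := Finset.univ.filter (fun i => ∃ w, φ i w ∈ Z)
  have hbad : bad.card ≤ Z.card := by
    have hc : ∀ i : bad, ∃ w, φ i w ∈ Z := fun i => (Finset.mem_filter.1 i.2).2
    choose w hw using hc
    have := Finset.card_le_card_of_injOn (s := bad.attach) (t := Z) (fun i => φ i (w i))
      (fun i _ => hw i) (fun i _ j _ hij => Subtype.ext (h2 _ _ _ _ hij))
    simpa using this
  have hgood : s ≤ (badᶜ).card := by
    rw [Finset.card_compl, Fintype.card_fin]; omega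
  obtain ⟨S, hS, hSc⟩ := Finset.exists_subset_card_eq hgood
  let e : Fin s ≃ S := (Fin.castOrderIso hSc.symm).toEquiv.trans S.equivFin.symm
  refine ⟨fun i => φ (e i), fun i w => ?_, fun i j w w' h => ?_⟩
  · refine Finset.mem_sdiff.2 ⟨h1 _ _, fun hz => ?_⟩
    have := hS (e i).2
    simp only [bad, Finset.mem_compl, Finset.mem_filter, Finset.mem_univ, true_and] at this
    exact this ⟨w, hz⟩
  · exact e.injective (Subtype.ext (h2 _ _ _ _ h))

theorem pack_or_cover {V W : Type*} [Fintype W] (G : SimpleGraph V) (H : SimpleGraph W)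
    (X : Finset V) (t : ℕ) : Pack G H X t ∨ ∃ Z : Finset V, Z ⊆ X ∧ Z.card ≤ t * Fintype.card W ∧
      ∀ φ : H ↪g G, ¬ ∀ w, φ w ∈ X \ Z := by
  induction t with
  | zero => exact Or.inl ⟨fun i => i.elim0, fun i => i.elim0, fun i => i.elim0⟩
  | succ t ih =>
    rcases ih with ⟨φ, h1, h2⟩ | ⟨Z, hZX, hZ, h⟩
    · let Z : Finset V := Finset.univ.image (fun p : Fin t × W => φ p.1 p.2)
      by_cases hZ : ∀ ψ : H ↪g G, ¬ ∀ w, ψ w ∈ X \ Z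
      · refine Or.inr ⟨Z, ?_, ?_, hZ⟩
        · intro x hx
          obtain ⟨p, _, rfl⟩ := Finset.mem_image.1 hx
          exact h1 _ _
        · have : Z.card ≤ (Finset.univ : Finset (Fin t × W)).card := Finset.card_image_le
          simp only [Finset.card_univ, Fintype.card_prod, Fintype.card_fin] at this
          exact this.trans (Nat.mul_le_mul_right _ (Nat.le_succ t))
      · push Not at hZ
        obtain ⟨ψ, hψ⟩ := hZ
        have hn : ∀ i w w', φ i w ≠ ψ w' := by
          intro i w w' e
          apply (Finset.mem_sdiff.1 (hψ w')).2
          rw [← e]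
          exact Finset.mem_image.2 ⟨(i, w), Finset.mem_univ _, rfl⟩
        refine Or.inl ⟨Fin.snoc (α := fun _ => H ↪g G) φ ψ, ?_, ?_⟩
        · intro i w
          refine Fin.lastCases ?_ (fun i => ?_) i
          · simpa using (Finset.mem_sdiff.1 (hψ w)).1
          · simpa using h1 i w
        · intro i j w w'
          refine Fin.lastCases ?_ (fun i => ?_) i
          · refine Fin.lastCases (fun _ => rfl) (fun j => ?_) j
            simp only [Fin.snoc_last, Fin.snoc_castSucc]
            intro e
            exact absurd e.symm (hn _ _ _)
          · refine Fin.lastCases ?_ (fun j => ?_) j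
            · simp only [Fin.snoc_last, Fin.snoc_castSucc]
              intro e
              exact absurd e (hn _ _ _)
            · simp only [Fin.snoc_castSucc]
              intro e
              rw [h2 _ _ _ _ e]
    · exact Or.inr ⟨Z, hZX, hZ.trans (Nat.mul_le_mul_right _ (Nat.le_succ t)), h⟩

/-! ### Counting tools -/

/-- The finite set of elements with property `P`. -/
def csep {α : Type} [Finite α] (P : α → Prop) : Finset α := (Set.toFinite {x | P x}).toFinset

@[simp] theorem mem_csep {α : Type} [Finite α] {P : α → Prop} {x : α} : x ∈ csep P ↔ P x := by
  simp [csep]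

/-- The number of graphs on `V` with property `P`. -/
def gcount {V : Type} [Finite V] (P : SimpleGraph V → Prop) : ℕ := (csep P).card

theorem gcount_mono {V : Type} [Fintype V] {P Q : SimpleGraph V → Prop} (h : ∀ G, P G → Q G) :
    gcount P ≤ gcount Q :=
  Finset.card_le_card (fun G hG => by simpa using h G (by simpa using hG))

theorem gcount_or_le {V : Type} [Fintype V] (P Q : SimpleGraph V → Prop) :
    gcount (fun G => P G ∨ Q G) ≤ gcount P + gcount Q := by
  unfold gcount
  refine (Finset.card_le_card ?_).trans (Finset.card_union_le _ _)
  intro G hG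
  simpa using hG

theorem card_exists_le {α ι : Type} [Fintype α] [Fintype ι] (P : ι → α → Prop)
    (m : ℝ) (h : ∀ i, ((csep (P i)).card : ℝ) ≤ m) :
    ((csep (fun x => ∃ i, P i x)).card : ℝ) ≤ Fintype.card ι * m := by
  have h1 : (csep (fun x => ∃ i, P i x)).card ≤ ∑ i, (csep (P i)).card := by
    refine le_trans (Finset.card_le_card ?_)
      (Finset.card_biUnion_le (s := Finset.univ) (t := fun i => csep (P i)))
    intro G hG
    simpa using hG
  calc ((csep (fun x => ∃ i, P i x)).card : ℝ)
      ≤ ((∑ i, (csep (P i)).card : ℕ) : ℝ) := by exact_mod_cast h1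
    _ = ∑ i, ((csep (P i)).card : ℝ) := by push_cast; rfl
    _ ≤ ∑ _i : ι, m := Finset.sum_le_sum (fun i _ => h i)
    _ = _ := by simp

theorem gcount_exists_le {V ι : Type} [Fintype V] [Fintype ι] (P : ι → SimpleGraph V → Prop)
    (m : ℝ) (h : ∀ i, (gcount (P i) : ℝ) ≤ m) :
    (gcount (fun G => ∃ i, P i G) : ℝ) ≤ Fintype.card ι * m :=
  card_exists_le P m h

theorem gcount_exists_mem_le {V ι : Type} [Fintype V] (I : Finset ι)
    (P : ι → SimpleGraph V → Prop) (m : ℝ) (h : ∀ i ∈ I, (gcount (P i) : ℝ) ≤ m) :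
    (gcount (fun G => ∃ i ∈ I, P i G) : ℝ) ≤ I.card * m := by
  have := gcount_exists_le (fun i : I => P i) m (fun i => h i i.2)
  simpa using this

theorem gcount_congr {V W : Type} [Fintype V] [Fintype W] (e : V ≃ W) {P : SimpleGraph V → Prop}
    {Q : SimpleGraph W → Prop} (h : ∀ G : SimpleGraph W, P (G.comap e) ↔ Q G) :
    gcount P = gcount Q := by
  unfold gcount
  refine (Finset.card_bij (fun (G : SimpleGraph W) _ => G.comap e) ?_ ?_ ?_).symm
  · intro G hG
    simpa [h] using hG
  · intro G _ G' _ hGG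
    ext x y
    have := congrArg (fun K : SimpleGraph V => K.Adj (e.symm x) (e.symm y)) hGG
    simpa using this
  · intro K hK
    have hK' : (K.comap e.symm).comap e = K := by ext; simp
    refine ⟨K.comap e.symm, ?_, hK'⟩
    simp only [mem_csep] at *
    rw [← h, hK']
    exact hK

theorem gcount_compl {V : Type} [Fintype V] (P : SimpleGraph V → Prop) :
    gcount (fun G => P Gᶜ) = gcount P := by
  unfold gcount
  refine Finset.card_bij (fun G _ => Gᶜ) ?_ ?_ ?_
  · intro G hG; simpa using hG
  · intro G _ G' _ h; exact compl_injective h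
  · intro G hG; exact ⟨Gᶜ, by simpa using hG, compl_compl G⟩

theorem avoid_count {X ι W : Type} [Fintype X] [Fintype ι] [Fintype W] (φ : ι × W → X)
    (hφ : Function.Injective φ) (F : ι → W → Prop) :
    ((csep (fun g : X → Prop => ∀ i, ¬ ∀ w, (g (φ (i, w)) ↔ F i w))).card : ℝ) ≤
      2 ^ Fintype.card X * (1 - 1 / 2 ^ Fintype.card W) ^ Fintype.card ι := by
  let S := csep (fun g : X → Prop => ∀ i, ¬ ∀ w, (g (φ (i, w)) ↔ F i w))
  let T := (∀ i, {h : W → Prop // h ≠ F i}) × ({x // x ∉ Set.range φ} → Prop)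
  have h1 : S.card ≤ Fintype.card T := by
    rw [← Fintype.card_coe]
    refine Fintype.card_le_of_injective (fun g : S =>
      ((fun i => ⟨fun w => g.1 (φ (i, w)), ?_⟩, fun x => g.1 x.1) : T)) ?_
    · intro h
      refine (mem_csep.1 g.2) i (fun w => ?_)
      rw [← h]
    · intro g g' h
      have e1 := congrArg Prod.fst h
      have e2 := congrArg Prod.snd h
      apply Subtype.ext
      funext x
      by_cases hx : x ∈ Set.range φ
      · obtain ⟨⟨i, w⟩, rfl⟩ := hx
        have := congrArg (fun k => (k i).1 w) e1
        simpa using this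
      · have := congrFun e2 ⟨x, hx⟩
        simpa using this
  have h2 : Fintype.card T = (2 ^ Fintype.card W - 1) ^ Fintype.card ι *
      2 ^ (Fintype.card X - Fintype.card ι * Fintype.card W) := by
    have e1 : ∀ i, Fintype.card {h : W → Prop // h ≠ F i} = 2 ^ Fintype.card W - 1 := by
      intro i
      rw [Fintype.card_subtype_compl]
      simp
    have e2 : Fintype.card {x // x ∉ Set.range φ} =
        Fintype.card X - Fintype.card ι * Fintype.card W := by
      rw [Fintype.card_subtype_compl]
      congr 1
      rw [← Fintype.card_prod]
      exact (Fintype.card_congr (Equiv.ofInjective φ hφ)).symm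
    simp only [T, Fintype.card_prod, Fintype.card_pi, e1, Finset.prod_const, Finset.card_univ,
      e2, Fintype.card_prop]
  have h3 : Fintype.card ι * Fintype.card W ≤ Fintype.card X := by
    rw [← Fintype.card_prod]
    exact Fintype.card_le_of_injective φ hφ
  calc (S.card : ℝ) ≤ (Fintype.card T : ℝ) := by exact_mod_cast h1
    _ = (2 ^ Fintype.card W - 1 : ℝ) ^ Fintype.card ι *
      2 ^ (Fintype.card X - Fintype.card ι * Fintype.card W) := by
        rw [h2, Nat.cast_mul, Nat.cast_pow, Nat.cast_pow, Nat.cast_sub Nat.one_le_two_pow]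
        push_cast; rfl
    _ = _ := by
        have : (1 - 1 / 2 ^ Fintype.card W : ℝ) = (2 ^ Fintype.card W - 1) / 2 ^ Fintype.card W := by
          field_simp
        rw [this, div_pow, ← pow_mul, mul_comm (Fintype.card W)]
        rw [← Nat.sub_add_cancel h3, pow_add, Nat.sub_add_cancel h3]
        field_simp

theorem small_subsets {β : ℝ} (hβ : 0 < β) : ∃ θ : ℝ, 0 < θ ∧ ∀ (V : Type) [Fintype V] (N : ℝ),
    (Fintype.card V : ℝ) ≤ N →
    ((csep (fun S : Finset V => (S.card : ℝ) ≤ θ * N)).card : ℝ) ≤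
      (2 : ℝ) ^ (β * N) := by
  obtain ⟨t, ht0, ht1, htβ⟩ : ∃ t : ℝ, 0 < t ∧ t < 1 ∧ 1 + t ≤ 2 ^ (β / 2) := by
    have h1 : (1 : ℝ) < 2 ^ (β / 2) := Real.one_lt_rpow (by norm_num) (by positivity)
    refine ⟨min (1 / 2) (2 ^ (β / 2) - 1), ?_, ?_, ?_⟩
    · exact lt_min (by norm_num) (by linarith)
    · exact lt_of_le_of_lt (min_le_left _ _) (by norm_num)
    · have := min_le_right (1 / 2 : ℝ) (2 ^ (β / 2) - 1)
      linarith
  have hlog : Real.log t < 0 := Real.log_neg ht0 ht1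
  have hl2 : 0 < Real.log 2 := Real.log_pos (by norm_num)
  let θ := (β / 2) * Real.log 2 / (-Real.log t)
  have hθ : 0 < θ := by
    apply div_pos <;> [positivity; linarith]
  have htθ : t ^ (-θ) = (2 : ℝ) ^ (β / 2) := by
    rw [Real.rpow_def_of_pos ht0, Real.rpow_def_of_pos (by norm_num : (0 : ℝ) < 2)]
    congr 1
    simp only [θ]
    have : Real.log t ≠ 0 := hlog.ne
    field_simp
  refine ⟨θ, hθ, ?_⟩
  intro V _ N hN
  have hN0 : 0 ≤ N := le_trans (by positivity) hN
  set S := csep (fun S : Finset V => (S.card : ℝ) ≤ θ * N)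
  have h1 : ∑ A : Finset V, t ^ A.card = (1 + t) ^ Fintype.card V := by
    have := Fintype.sum_pow_mul_eq_add_pow V t 1
    simpa [add_comm] using this
  have h2 : (S.card : ℝ) * t ^ (θ * N) ≤ (1 + t) ^ Fintype.card V := by
    rw [← h1, ← nsmul_eq_mul]
    refine le_trans (Finset.card_nsmul_le_sum S (fun A => t ^ A.card) _ ?_)
      (Finset.sum_le_univ_sum_of_nonneg (fun A => by positivity))
    intro A hA
    rw [← Real.rpow_natCast]
    exact Real.rpow_le_rpow_of_exponent_ge ht0 ht1.le ((mem_csep (P := fun S : Finset V => (S.card : ℝ) ≤ θ * N)).1 hA)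
  have h3 : (1 + t) ^ Fintype.card V ≤ (2 : ℝ) ^ (β / 2 * N) := by
    rw [← Real.rpow_natCast, Real.rpow_mul (by norm_num)]
    refine (Real.rpow_le_rpow_of_exponent_le (by linarith) hN).trans ?_
    exact Real.rpow_le_rpow (by linarith) htβ hN0
  have h4 : t ^ (θ * N) = ((2 : ℝ) ^ (β / 2 * N))⁻¹ := by
    rw [Real.rpow_mul (by norm_num : (0 : ℝ) ≤ 2), ← htθ, ← Real.rpow_mul ht0.le,
      ← Real.rpow_neg ht0.le]
    congr 1
    ring
  rw [h4] at h2
  have hpos : 0 < (2 : ℝ) ^ (β / 2 * N) := by positivity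
  calc (S.card : ℝ) = S.card * ((2 : ℝ) ^ (β / 2 * N))⁻¹ * (2 : ℝ) ^ (β / 2 * N) := by
        field_simp
    _ ≤ (2 : ℝ) ^ (β / 2 * N) * (2 : ℝ) ^ (β / 2 * N) :=
        mul_le_mul_of_nonneg_right (h2.trans h3) hpos.le
    _ = _ := by
        rw [← Real.rpow_add (by norm_num)]
        congr 1
        ring

/-! ### The number of unipolar graphs -/

/-- The number of unipolar graphs on `n` vertices. -/
def uN (n : ℕ) : ℕ := gcount (V := Fin n) IsUnipolar

/-- The number of graphs on `n` vertices without induced five-cycles. -/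
def fN (n : ℕ) : ℕ := gcount (V := Fin n) C5Free

/-- Restriction along an equivalence, as an induced embedding. -/
def comapEquivEmb {V W : Type*} (e : V ≃ W) (G : SimpleGraph W) : G ↪g G.comap e where
  toFun := e.symm
  inj' := e.symm.injective
  map_rel_iff' := by simp

theorem isUnipolar_comap_equiv {V W : Type*} (e : V ≃ W) (G : SimpleGraph W) :
    IsUnipolar (G.comap e) ↔ IsUnipolar G :=
  ⟨fun h => h.comap (comapEquivEmb e G), fun h => h.comap (SimpleGraph.Embedding.comap e.toEmbedding G)⟩

theorem c5Free_comap_equiv {V W : Type*} (e : V ≃ W) (G : SimpleGraph W) :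
    C5Free (G.comap e) ↔ C5Free G :=
  ⟨fun h => h.comap (comapEquivEmb e G), fun h => h.comap (SimpleGraph.Embedding.comap e.toEmbedding G)⟩

theorem gcount_isUnipolar {V : Type} [Fintype V] {n : ℕ} (h : Fintype.card V = n) :
    gcount (V := V) IsUnipolar = uN n :=
  gcount_congr (Fintype.equivFinOfCardEq h) (isUnipolar_comap_equiv _)

theorem gcount_c5Free {V : Type} [Fintype V] {n : ℕ} (h : Fintype.card V = n) :
    gcount (V := V) C5Free = fN n :=
  gcount_congr (Fintype.equivFinOfCardEq h) (c5Free_comap_equiv _)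

/-- Add a new vertex with neighbourhood `S`. -/
def addVertex {V : Type*} (G : SimpleGraph V) (S : Set V) : SimpleGraph (Option V) where
  Adj
    | none, none => False
    | none, some x => x ∈ S
    | some x, none => x ∈ S
    | some x, some y => G.Adj x y
  symm := ⟨by rintro (_ | x) (_ | y) h <;> first | exact h | exact h.symm⟩
  loopless := ⟨by rintro (_ | x) h <;> [exact h; exact G.loopless.irrefl _ h]⟩

theorem addVertex_inj {V : Type*} {G G' : SimpleGraph V} {S S' : Set V}
    (h : addVertex G S = addVertex G' S') : G = G' ∧ S = S' := by
  constructor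
  · ext x y
    have := congrArg (fun K : SimpleGraph (Option V) => K.Adj (some x) (some y)) h
    simpa [addVertex] using this
  · ext x
    have := congrArg (fun K : SimpleGraph (Option V) => K.Adj none (some x)) h
    simpa [addVertex] using this

theorem UniArr.addVertex_side {V : Type*} {G : SimpleGraph V} {C T : Set V} (h : UniArr G C)
    (hT : T ⊆ C) : IsUnipolar (addVertex G T) := by
  refine isUnipolar_iff.2 ⟨some '' C, ?_, ?_⟩
  · rintro _ ⟨x, hx, rfl⟩ _ ⟨y, hy, rfl⟩ hxy
    exact h.1 x hx y hy (by simpa using hxy)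
  · rintro (_ | x) hx (_ | y) hy (_ | z) hz hxy hyz hxz <;> simp [addVertex] at *
    · exact absurd (hT hxy) hy
    · exact absurd (hT hxy) hx
    · exact absurd (hT hyz) hy
    · exact h.2 x hx y hy z hz hxy hyz hxz

theorem UniArr.addVertex_center {V : Type*} {G : SimpleGraph V} {C T : Set V} (h : UniArr G C)
    : IsUnipolar (addVertex G (C ∪ T)) := by
  refine isUnipolar_iff.2 ⟨insert none (some '' C), ?_, ?_⟩
  · rintro (_ | x) hx (_ | y) hy hxy <;> simp [addVertex] at *
    · exact Or.inl hy
    · exact Or.inl hx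
    · exact h.1 x hx y hy hxy
  · rintro (_ | x) hx (_ | y) hy (_ | z) hz hxy hyz hxz <;> simp [addVertex] at *
    exact h.2 x hx y hy z hz hxy hyz hxz

theorem exists_free_part {n : ℕ} (G : SimpleGraph (Fin n)) (hG : IsUnipolar G) :
    ∃ (P : Finset (Fin n)) (Q : Set (Fin n)), n ≤ 2 * P.card ∧ Disjoint (P : Set (Fin n)) Q ∧
      ∀ T ⊆ P, IsUnipolar (addVertex G (Q ∪ T)) := by
  obtain ⟨C, hC⟩ := isUnipolar_iff.1 hG
  have hcard : C.toFinset.card + (C.toFinsetᶜ).card = n := by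
    rw [Finset.card_compl, Fintype.card_fin]
    have := Finset.card_le_univ C.toFinset
    rw [Fintype.card_fin] at this
    omega
  by_cases hc : n ≤ 2 * C.toFinset.card
  · refine ⟨C.toFinset, ∅, hc, by simp, fun T hT => ?_⟩
    rw [Set.empty_union]
    exact hC.addVertex_side (fun x hx => by simpa using hT hx)
  · refine ⟨C.toFinsetᶜ, C, by omega, ?_, fun T _ => hC.addVertex_center⟩
    rw [Set.disjoint_left]
    intro x hx
    simpa using hx

theorem sigma_card_le {n : ℕ} (U : Finset (SimpleGraph (Fin n)))
    (P : SimpleGraph (Fin n) → Finset (Fin n)) (Q : SimpleGraph (Fin n) → Set (Fin n))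
    (hd : ∀ G ∈ U, Disjoint (P G : Set (Fin n)) (Q G))
    (hu : ∀ G ∈ U, ∀ T ⊆ P G, IsUnipolar (addVertex G (Q G ∪ T))) :
    ∑ G ∈ U, (P G).powerset.card ≤ uN (n + 1) := by
  rw [← gcount_isUnipolar (V := Option (Fin n)) (n := n + 1) (by simp), ← Finset.card_sigma]
  refine Finset.card_le_card_of_injOn (fun p => addVertex p.1 (Q p.1 ∪ p.2)) ?_ ?_
  · intro p h
    have h := Finset.mem_sigma.1 (Finset.mem_coe.1 h)
    simpa using hu p.1 h.1 p.2 (Finset.mem_powerset.1 h.2)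
  · rintro ⟨G, T⟩ h ⟨G', T'⟩ h' e
    have h := Finset.mem_sigma.1 (Finset.mem_coe.1 h)
    have h' := Finset.mem_sigma.1 (Finset.mem_coe.1 h')
    obtain ⟨rfl, e2⟩ := addVertex_inj e
    have hT := Finset.mem_powerset.1 h.2
    have hT' := Finset.mem_powerset.1 h'.2
    have hd := hd G h.1
    rw [Set.disjoint_left] at hd
    have : T = T' := by
      ext x
      have hx := Set.ext_iff.1 e2 x
      simp only [Set.mem_union, Finset.mem_coe] at hx
      constructor
      · intro h1
        exact (hx.1 (Or.inr h1)).resolve_left (hd (hT h1))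
      · intro h1
        exact (hx.2 (Or.inr h1)).resolve_left (hd (hT' h1))
    rw [this]

theorem uN_succ (n : ℕ) : (2 : ℝ) ^ ((n : ℝ) / 2) * uN n ≤ uN (n + 1) := by
  choose! P Q h1 h2 h3 using @exists_free_part n
  obtain ⟨U, hU, hUmem⟩ : ∃ U : Finset (SimpleGraph (Fin n)), U.card = uN n ∧
      ∀ G, G ∈ U ↔ IsUnipolar G := ⟨_, rfl, fun G => by simp⟩
  have hinj := sigma_card_le U P Q (fun G hG => h2 G ((hUmem G).1 hG))
    (fun G hG => h3 G ((hUmem G).1 hG))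
  have hterm : ∀ G ∈ U, (2 : ℝ) ^ ((n : ℝ) / 2) ≤ (((P G).powerset.card : ℕ) : ℝ) := by
    intro G hG
    have h1 : (n : ℝ) ≤ 2 * (P G).card := by exact_mod_cast h1 G ((hUmem G).1 hG)
    rw [Finset.card_powerset, Nat.cast_pow, Nat.cast_ofNat, ← Real.rpow_natCast]
    exact Real.rpow_le_rpow_of_exponent_le (by norm_num) (by linarith)
  have hsum := Finset.card_nsmul_le_sum U (fun G => (((P G).powerset.card : ℕ) : ℝ)) _ hterm
  rw [nsmul_eq_mul, ← Nat.cast_sum, hU, mul_comm] at hsum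
  exact hsum.trans (Nat.cast_le.2 hinj)

theorem uN_pos (n : ℕ) : 0 < uN n := by
  unfold uN gcount
  rw [Finset.card_pos]
  exact ⟨⊤, by simpa using isUnipolar_iff.2 ⟨Set.univ, by simp, by simp⟩⟩

/-- The unipolar graph with centre `A`, cross edges `T` and blocks the fibres of `g`. -/
def mkUnipolar {A B K : Type*} (T : A → B → Prop) (g : B → K) : SimpleGraph (A ⊕ B) where
  Adj
    | .inl x, .inl y => x ≠ y
    | .inl x, .inr y => T x y
    | .inr x, .inl y => T y x
    | .inr x, .inr y => x ≠ y ∧ g x = g y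
  symm := ⟨by
    rintro (x | x) (y | y) h
    · exact h.symm
    · exact h
    · exact h
    · exact ⟨h.1.symm, h.2.symm⟩⟩
  loopless := ⟨by rintro (x | x) h <;> [exact h rfl; exact h.1 rfl]⟩

theorem isUnipolar_mkUnipolar {A B K : Type*} (T : A → B → Prop) (g : B → K) :
    IsUnipolar (mkUnipolar T g) := by
  refine isUnipolar_iff.2 ⟨Set.range Sum.inl, ?_, ?_⟩
  · rintro _ ⟨x, rfl⟩ _ ⟨y, rfl⟩ h
    simpa [mkUnipolar] using h
  · rintro (x | x) hx (y | y) hy (z | z) hz hxy hyz hxz <;> simp at hx hy hz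
    exact ⟨by simpa using hxz, hxy.2.trans hyz.2⟩

theorem uN_lower (a k l : ℕ) : 2 ^ (a * (k + l)) * k ^ l ≤ uN (a + (k + l)) := by
  rw [← gcount_isUnipolar (V := Fin a ⊕ (Fin k ⊕ Fin l)) (by simp)]
  have : Fintype.card ((Fin a → (Fin k ⊕ Fin l) → Prop) × (Fin l → Fin k)) =
      2 ^ (a * (k + l)) * k ^ l := by
    simp [← pow_mul, mul_comm]
  rw [← this, ← Finset.card_univ]
  refine Finset.card_le_card_of_injOn (fun p => mkUnipolar p.1 (Sum.elim id p.2)) ?_ ?_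
  · rintro p -
    simpa using isUnipolar_mkUnipolar _ _
  · rintro ⟨T, f⟩ - ⟨T', f'⟩ - h
    have h1 : T = T' := by
      funext x y
      have := congrArg (fun G : SimpleGraph _ => G.Adj (.inl x) (.inr y)) h
      simpa [mkUnipolar] using this
    have h2 : f = f' := by
      funext j
      have := congrArg (fun G : SimpleGraph _ => G.Adj (.inr (.inl (f j))) (.inr (.inr j))) h
      simpa [mkUnipolar] using this
    rw [h1, h2]

theorem exp_linear_absorb (C : ℝ) (p : ℕ) {c : ℝ} (hc : 0 < c) :
    ∀ᶠ n : ℕ in atTop, C * ((n : ℝ) + 1) ^ p ≤ (2 : ℝ) ^ (c * n) := by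
  have hb : (1 : ℝ) < 2 ^ c := Real.one_lt_rpow (by norm_num) hc
  have h1 := tendsto_pow_const_div_const_pow_of_one_lt p hb
  have h2 : ∀ᶠ n : ℕ in atTop, (n : ℝ) ^ p / (2 ^ c) ^ n < 1 / ((|C| + 1) * 2 ^ p) :=
    h1.eventually_lt_const (by positivity)
  filter_upwards [h2, eventually_ge_atTop 1] with n hn hn1
  have hpos : 0 < ((2 : ℝ) ^ c) ^ n := by positivity
  rw [div_lt_div_iff₀ hpos (by positivity)] at hn
  rw [Real.rpow_mul (by norm_num), Real.rpow_natCast]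
  have h3 : ((n : ℝ) + 1) ^ p ≤ 2 ^ p * (n : ℝ) ^ p := by
    rw [← mul_pow]
    have : (1 : ℝ) ≤ n := by exact_mod_cast hn1
    exact pow_le_pow_left₀ (by positivity) (by linarith) p
  calc C * ((n : ℝ) + 1) ^ p ≤ (|C| + 1) * (2 ^ p * (n : ℝ) ^ p) := by
        apply mul_le_mul (by linarith [le_abs_self C]) h3 (by positivity) (by positivity)
    _ ≤ _ := by linarith

theorem uN_asymp {κ : ℝ} (hκ0 : 0 ≤ κ) (hκ : κ < 1 / 2) {C : ℝ} (hC : 1 ≤ C) :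
    ∀ᶠ n : ℕ in atTop, (2 : ℝ) ^ ((n : ℝ) ^ 2 / 4) * C ^ n * (n : ℝ) ^ (κ * n) ≤ uN n := by
  obtain ⟨κ', h1, h2⟩ := exists_between hκ
  obtain ⟨K, hK⟩ := exists_nat_gt (max 2 (1 / (1 / 2 - κ')))
  have hK2 : (2 : ℝ) < K := lt_of_le_of_lt (le_max_left _ _) hK
  have hK3 : 1 / (1 / 2 - κ') < K := lt_of_le_of_lt (le_max_right _ _) hK
  have hKpos : (0 : ℝ) < K := by linarith
  have hKinv : 1 / (K : ℝ) < 1 / 2 - κ' := by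
    rw [div_lt_iff₀ (by linarith)] at hK3
    rw [div_lt_iff₀ hKpos]
    linarith
  have hκ'0 : 0 < κ' := by linarith
  have e1 : ∀ᶠ n : ℕ in atTop, 2 * C * (8 * (K : ℝ)) ^ κ' ≤ (n : ℝ) ^ (κ' - κ) :=
    ((tendsto_rpow_atTop (by linarith : 0 < κ' - κ)).comp
      tendsto_natCast_atTop_atTop).eventually_ge_atTop _
  have e2 : ∀ᶠ n : ℕ in atTop, 1 / (1 / 2 - 1 / (2 * K) - κ') ≤ (n : ℝ) :=
    tendsto_natCast_atTop_atTop.eventually_ge_atTop _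
  filter_upwards [e1, e2, eventually_ge_atTop (8 * K + 1)] with n hn1 hn2 hn3
  have hn3' : 8 * (K : ℝ) + 1 ≤ n := by exact_mod_cast hn3
  have hnpos : (0 : ℝ) < n := by linarith
  set m := n / 2
  set k := m / K
  set l := m - k
  set a := n - m
  have hKn : 0 < K := by exact_mod_cast hKpos
  have hkm : k ≤ m := Nat.div_le_self _ _
  have hkl : k + l = m := by omega
  have hsum : a + (k + l) = n := by omega
  have hlow := uN_lower a k l
  rw [hsum, hkl] at hlow
  have hmlow : ((n : ℝ) - 1) / 2 ≤ m := by
    have : n ≤ 2 * m + 1 := by omega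
    have : (n : ℝ) ≤ 2 * m + 1 := by exact_mod_cast this
    linarith
  have ham : ((n : ℝ) ^ 2 - 1) / 4 ≤ (a * m : ℕ) := by
    have h1 : a = m ∨ a = m + 1 := by omega
    have h2 : (n : ℝ) = a + m := by
      have : n = a + m := by omega
      exact_mod_cast this
    rcases h1 with h | h
    · have : (a : ℝ) = m := by exact_mod_cast h
      push_cast
      rw [h2, this]; nlinarith
    · have : (a : ℝ) = m + 1 := by exact_mod_cast h
      push_cast
      rw [h2, this]; nlinarith
  have hklow : (n : ℝ) / (8 * K) ≤ k := by
    have h1 : m < K * (k + 1) := by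
      have := Nat.lt_mul_div_succ m hKn
      simpa [k] using this
    have h1' : (m : ℝ) < K * (k + 1) := by exact_mod_cast h1
    rw [div_le_iff₀ (by positivity)]
    nlinarith
  have hllow : κ' * n ≤ l := by
    have h1 : (k : ℝ) ≤ m / K := Nat.cast_div_le
    have h2 : (l : ℝ) = m - k := by
      have : (m : ℝ) = k + l := by exact_mod_cast hkl.symm
      linarith
    have h3 : (m : ℝ) / K = m * (1 / K) := by ring
    have h4 : (1 : ℝ) / (2 * K) = (1 / K) / 2 := by field_simp
    rw [h4] at hn2
    have h5 : 0 < 1 / 2 - 1 / (K : ℝ) / 2 - κ' := by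
      have : 0 < 1 / (K : ℝ) := by positivity
      linarith
    rw [div_le_iff₀ h5] at hn2
    have h6 : (1 : ℝ) / K < 1 / 2 := by
      rw [div_lt_div_iff₀ hKpos (by norm_num)]; linarith
    rw [h2]
    have h7 : ((n : ℝ) - 1) / 2 * (1 - 1 / K) ≤ m * (1 - 1 / K) :=
      mul_le_mul_of_nonneg_right hmlow (by linarith)
    have h8 : 0 < 1 / (K : ℝ) := by positivity
    rw [h3] at h1
    nlinarith
  have hk1 : 1 ≤ (n : ℝ) / (8 * K) := by
    rw [le_div_iff₀ (by positivity)]; linarith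
  have hkl2 : ((n : ℝ) / (8 * K)) ^ (κ' * n) ≤ (k : ℝ) ^ l := by
    rw [← Real.rpow_natCast]
    refine (Real.rpow_le_rpow_of_exponent_le hk1 hllow).trans ?_
    exact Real.rpow_le_rpow (by linarith) hklow (by positivity)
  have hmain : 2 * C ^ n * (n : ℝ) ^ (κ * n) ≤ ((n : ℝ) / (8 * K)) ^ (κ' * n) := by
    have h1 : (2 * C * (8 * (K : ℝ)) ^ κ') ^ n ≤ ((n : ℝ) ^ (κ' - κ)) ^ n :=
      pow_le_pow_left₀ (by positivity) hn1 n
    rw [Real.div_rpow hnpos.le (by positivity), le_div_iff₀ (by positivity)]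
    have h2 : ((n : ℝ) ^ (κ' - κ)) ^ n * (n : ℝ) ^ (κ * n) = (n : ℝ) ^ (κ' * n) := by
      rw [← Real.rpow_natCast, ← Real.rpow_mul hnpos.le, ← Real.rpow_add hnpos]
      congr 1; ring
    rw [← h2]
    have h3 : 2 * C ^ n * (n : ℝ) ^ (κ * n) * (8 * (K : ℝ)) ^ (κ' * n) ≤
        (2 * C * (8 * (K : ℝ)) ^ κ') ^ n * (n : ℝ) ^ (κ * n) := by
      rw [mul_pow, mul_pow, Real.rpow_mul (by positivity) κ', Real.rpow_natCast]
      have h4 : (2 : ℝ) ≤ 2 ^ n := by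
        have : (2 : ℝ) ^ 1 ≤ 2 ^ n := pow_le_pow_right₀ (by norm_num) (by omega)
        simpa using this
      have h5 : 0 ≤ C ^ n * (n : ℝ) ^ (κ * n) * ((8 * (K : ℝ)) ^ κ') ^ n := by positivity
      nlinarith
    exact h3.trans (mul_le_mul_of_nonneg_right h1 (by positivity))
  have h2pow : (2 : ℝ) ^ ((n : ℝ) ^ 2 / 4) ≤ 2 * 2 ^ (a * m) := by
    have : (2 : ℝ) * 2 ^ (a * m) = 2 ^ (1 + (a * m : ℕ) : ℝ) := by
      rw [Real.rpow_add (by norm_num), Real.rpow_one, Real.rpow_natCast]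
    rw [this]
    exact Real.rpow_le_rpow_of_exponent_le (by norm_num) (by linarith)
  calc (2 : ℝ) ^ ((n : ℝ) ^ 2 / 4) * C ^ n * (n : ℝ) ^ (κ * n)
      ≤ 2 * 2 ^ (a * m) * C ^ n * (n : ℝ) ^ (κ * n) := by gcongr
    _ = 2 ^ (a * m) * (2 * C ^ n * (n : ℝ) ^ (κ * n)) := by ring
    _ ≤ 2 ^ (a * m) * (k : ℝ) ^ l := by gcongr; exact hmain.trans hkl2
    _ ≤ uN n := by exact_mod_cast hlow

attribute [irreducible] uN fN

/-! ### Counting graphs with a badly extending small set -/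

/-- `P` only depends on the adjacencies to `R`. -/
def Meas {V : Type*} (G : SimpleGraph V) (R : Finset V) (P : V → Prop) : Prop :=
  ∀ x y, (∀ r ∈ R, (G.Adj r x ↔ G.Adj r y)) → (P x ↔ P y)

/-- On `A`, the neighbourhood of `v` is determined by the adjacencies to `R` up to `s` errors. -/
def Tame {V : Type*} (G : SimpleGraph V) (R : Finset V) (v : V) (A : Finset V) (s : ℝ) : Prop :=
  ∃ Y : V → Prop, Meas G R Y ∧ ((A.filter (fun x => ¬ (G.Adj v x ↔ Y x))).card : ℝ) ≤ s

/-- The bound of `small_subsets` for given parameters. -/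
def SmallSub (β θ : ℝ) : Prop := ∀ (V : Type) [Fintype V] (N : ℝ),
    (Fintype.card V : ℝ) ≤ N →
    ((csep (fun S : Finset V => (S.card : ℝ) ≤ θ * N)).card : ℝ) ≤
      (2 : ℝ) ^ (β * N)

/-- Traces `T` which badly extend `G`. -/
def BadTrace {V W : Type} [Fintype V] (G : SimpleGraph V) (H : SimpleGraph W) {k : ℕ}
    (F : Fin k → W → Prop) (J t : ℕ) (a s : ℝ) (T : Fin k → V → Prop) : Prop :=
  ∃ R A : Finset V, R.card ≤ J ∧ Meas G R (· ∈ A) ∧ ((Aᶜ).card : ℝ) ≤ a ∧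
    (∀ i, ∃ Y : V → Prop, Meas G R Y ∧ ((A.filter (fun x => ¬ (T i x ↔ Y x))).card : ℝ) ≤ s) ∧
    Pack G H Aᶜ t ∧ ∀ q : H ↪g G, ¬ ∀ i w, (T i (q w) ↔ F i w)

/-- The trace of `x` on a list of optional vertices. -/
def otrace {V : Type} (G : SimpleGraph V) {J : ℕ} (ρ : Fin J → Option V) (x : V) : Fin J → Prop :=
  fun j => ∃ r, ρ j = some r ∧ G.Adj r x

theorem exists_enum {V : Type} {R : Finset V} {J : ℕ} (h : R.card ≤ J) :
    ∃ ρ : Fin J → Option V, ∀ r, r ∈ R ↔ ∃ j, ρ j = some r := by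
  let e := R.equivFin
  refine ⟨fun j => if hj : j.1 < R.card then some (e.symm ⟨j.1, hj⟩).1 else none, fun r => ?_⟩
  constructor
  · intro hr
    refine ⟨⟨(e ⟨r, hr⟩).1, (e ⟨r, hr⟩).2.trans_le h⟩, ?_⟩
    simp
  · rintro ⟨j, hj⟩
    by_cases hjl : j.1 < R.card
    · simp only [hjl, dif_pos, Option.some.injEq] at hj
      rw [← hj]
      exact (e.symm ⟨j.1, hjl⟩).2
    · simp [hjl] at hj

theorem Meas.exists_otrace {V : Type} {G : SimpleGraph V} {R : Finset V} {P : V → Prop}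
    (h : Meas G R P) {J : ℕ} {ρ : Fin J → Option V} (hρ : ∀ r, r ∈ R ↔ ∃ j, ρ j = some r) :
    ∃ D : (Fin J → Prop) → Prop, ∀ x, P x ↔ D (otrace G ρ x) := by
  refine ⟨fun s => ∃ x, P x ∧ otrace G ρ x = s, fun x => ⟨fun hx => ⟨x, hx, rfl⟩, ?_⟩⟩
  rintro ⟨y, hy, hyx⟩
  refine (h y x ?_).1 hy
  intro r hr
  obtain ⟨j, hj⟩ := (hρ r).1 hr
  have := congrFun hyx j
  simpa [otrace, hj] using this

theorem fixedTrace_count {V W : Type} [Fintype V] [Fintype W] {G : SimpleGraph V}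
    {H : SimpleGraph W} {k : ℕ} (F : Fin k → W → Prop) {t : ℕ} {a β θ N : ℝ}
    (hS : SmallSub β θ) (hN : (Fintype.card V : ℝ) ≤ N) (A : Finset V) (Y : Fin k → V → Prop)
    (hA : ((Aᶜ).card : ℝ) ≤ a) (hP : Pack G H Aᶜ t) :
    ((csep (fun T : Fin k → V → Prop =>
      (∀ i, ((A.filter (fun x => ¬ (T i x ↔ Y i x))).card : ℝ) ≤ θ * N) ∧
      ∀ q : H ↪g G, ¬ ∀ i w, (T i (q w) ↔ F i w))).card : ℝ) ≤
      (((2 : ℝ) ^ (β * N)) ^ k * ((2 : ℝ) ^ (k * a) *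
          (1 - 1 / 2 ^ (k * Fintype.card W)) ^ t)) := by
  obtain ⟨φ, hφ1, hφ2⟩ := hP
  let small := csep (fun S : Finset V => (S.card : ℝ) ≤ θ * N)
  let ψ : Fin t × (Fin k × W) → Fin k × {x // x ∈ Aᶜ} :=
    fun p => (p.2.1, ⟨φ p.1 p.2.2, hφ1 _ _⟩)
  have hψ : Function.Injective ψ := by
    rintro ⟨i, j, w⟩ ⟨i', j', w'⟩ h
    simp only [ψ, Prod.mk.injEq, Subtype.mk.injEq] at h
    obtain ⟨rfl, h⟩ := h
    obtain rfl := hφ2 _ _ _ _ h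
    rw [(φ i).injective h]
  have havoid := avoid_count ψ hψ (fun _ (p : Fin k × W) => F p.1 p.2)
  set avoid := csep (fun g : Fin k × {x // x ∈ Aᶜ} → Prop =>
      ∀ i, ¬ ∀ w : Fin k × W, (g (ψ (i, w)) ↔ F w.1 w.2))
  have hcard : ((csep (fun T : Fin k → V → Prop =>
      (∀ i, ((A.filter (fun x => ¬ (T i x ↔ Y i x))).card : ℝ) ≤ θ * N) ∧
      ∀ q : H ↪g G, ¬ ∀ i w, (T i (q w) ↔ F i w))).card) ≤
      (Fintype.piFinset (fun _ : Fin k => small) ×ˢ avoid).card := by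
    refine Finset.card_le_card_of_injOn (fun T =>
      ((fun i => A.filter (fun x => ¬ (T i x ↔ Y i x))), fun p => T p.1 p.2.1)) ?_ ?_
    · intro T hT
      have hT := mem_csep.1 (Finset.mem_coe.1 hT)
      refine Finset.mem_coe.2 (Finset.mem_product.2 ⟨?_, ?_⟩)
      · refine Fintype.mem_piFinset.2 (fun i => ?_)
        simpa [small] using hT.1 i
      · refine mem_csep.2 (fun i hcon => hT.2 (φ i) ?_)
        intro j w
        exact hcon (j, w)
    · intro T _ T' _ h
      funext i x
      by_cases hx : x ∈ A
      · have h1 := congrFun (congrArg Prod.fst h) i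
        have h2 := Finset.ext_iff.1 h1 x
        simp only [Finset.mem_filter, hx, true_and] at h2
        apply propext
        tauto
      · exact congrFun (congrArg Prod.snd h) (i, ⟨x, Finset.mem_compl.2 hx⟩)
  rw [Finset.card_product, Fintype.card_piFinset_const] at hcard
  have h1 : (small.card : ℝ) ≤ (2 : ℝ) ^ (β * N) := hS V N hN
  have h2 : (avoid.card : ℝ) ≤ (2 : ℝ) ^ (k * a) * (1 - 1 / 2 ^ (k * Fintype.card W)) ^ t := by
    refine havoid.trans ?_
    simp only [Fintype.card_prod, Fintype.card_fin, Fintype.card_coe]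
    refine mul_le_mul_of_nonneg_right ?_ (pow_nonneg ?_ _)
    · rw [← Real.rpow_natCast]
      refine Real.rpow_le_rpow_of_exponent_le (by norm_num) ?_
      push_cast
      gcongr
    · rw [sub_nonneg, div_le_one (by positivity)]
      exact one_le_pow₀ (by norm_num)
  calc _ ≤ ((small.card ^ k * avoid.card : ℕ) : ℝ) := by exact_mod_cast hcard
    _ = (small.card : ℝ) ^ k * avoid.card := by push_cast; rfl
    _ ≤ _ := by gcongr

theorem badTrace_count {V W : Type} [Fintype V] [Fintype W] (G : SimpleGraph V)
    (H : SimpleGraph W) {k : ℕ} (F : Fin k → W → Prop) (J t : ℕ) {a β θ N : ℝ}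
    (hS : SmallSub β θ) (hN : (Fintype.card V : ℝ) ≤ N) :
    ((csep (BadTrace G H F J t a (θ * N))).card : ℝ) ≤
      (N + 1) ^ J * 2 ^ (2 ^ J * (k + 1)) *
        (((2 : ℝ) ^ (β * N)) ^ k * ((2 : ℝ) ^ (k * a) *
          (1 - 1 / 2 ^ (k * Fintype.card W)) ^ t)) := by
  have hN0 : 0 ≤ N := le_trans (by positivity) hN
  have hM0 : 0 ≤ (((2 : ℝ) ^ (β * N)) ^ k * ((2 : ℝ) ^ (k * a) *
          (1 - 1 / 2 ^ (k * Fintype.card W)) ^ t)) := by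
    have : (0 : ℝ) ≤ 1 - 1 / 2 ^ (k * Fintype.card W) := by
      rw [sub_nonneg, div_le_one (by positivity)]
      exact one_le_pow₀ (by norm_num)
    positivity
  let I := (Fin J → Option V) × ((Fin J → Prop) → Prop) × (Fin k → (Fin J → Prop) → Prop)
  let P : I → (Fin k → V → Prop) → Prop := fun p T =>
    ((((Finset.univ.filter (fun x => p.2.1 (otrace G p.1 x)))ᶜ).card : ℝ) ≤ a ∧
      Pack G H (Finset.univ.filter (fun x => p.2.1 (otrace G p.1 x)))ᶜ t) ∧
    ((∀ i, (((Finset.univ.filter (fun x => p.2.1 (otrace G p.1 x))).filter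
        (fun x => ¬ (T i x ↔ p.2.2 i (otrace G p.1 x)))).card : ℝ) ≤ θ * N) ∧
      ∀ q : H ↪g G, ¬ ∀ i w, (T i (q w) ↔ F i w))
  have hI : (Fintype.card I : ℝ) ≤ (N + 1) ^ J * 2 ^ (2 ^ J * (k + 1)) := by
    have : Fintype.card I = (Fintype.card V + 1) ^ J * 2 ^ (2 ^ J * (k + 1)) := by
      simp only [I, Fintype.card_prod, Fintype.card_pi, Fintype.card_prop, Fintype.card_option,
        Finset.prod_const, Finset.card_univ, Fintype.card_fin, ← pow_mul]
      rw [← pow_add]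
      congr 2
      ring
    rw [this]
    push_cast
    gcongr
  refine le_trans ?_ ((card_exists_le P _ (fun p => ?_)).trans
    (mul_le_mul_of_nonneg_right hI hM0))
  · refine Nat.cast_le.2 (Finset.card_le_card ?_)
    intro T hT
    obtain ⟨R, A, hR, hA, hAc, hY, hP, hq⟩ := mem_csep.1 hT
    obtain ⟨ρ, hρ⟩ := exists_enum hR
    obtain ⟨D, hD⟩ := hA.exists_otrace hρ
    choose Y hY1 hY2 using hY
    choose E hE using fun i => (hY1 i).exists_otrace hρ
    have hAe : A = Finset.univ.filter (fun x => D (otrace G ρ x)) := by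
      ext x; simpa using hD x
    refine mem_csep.2 ⟨(ρ, D, E), ⟨?_, ?_⟩, ?_, hq⟩
    · rw [← hAe]; exact hAc
    · rw [← hAe]; exact hP
    · intro i
      rw [← hAe]
      have : ∀ x, (T i x ↔ E i (otrace G ρ x)) ↔ (T i x ↔ Y i x) := fun x => by rw [hE i x]
      simpa only [this] using hY2 i
  · by_cases hp : ((((Finset.univ.filter (fun x => p.2.1 (otrace G p.1 x)))ᶜ).card : ℝ) ≤ a ∧
      Pack G H (Finset.univ.filter (fun x => p.2.1 (otrace G p.1 x)))ᶜ t)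
    · refine le_trans (Nat.cast_le.2 (Finset.card_le_card ?_))
        (fixedTrace_count F hS hN _ (fun i x => p.2.2 i (otrace G p.1 x)) hp.1 hp.2)
      intro T hT
      have hT := mem_csep.1 hT
      exact mem_csep.2 hT.2
    · rw [Finset.eq_empty_of_forall_notMem (s := csep (P p))]
      · simpa using hM0
      · intro T hT
        exact hp (mem_csep.1 hT).1

/-- `G` has a `k`-set, tame on `A`, such that no copy of `H` attaches to it with pattern `F`, although
the complement of `A` contains many copies of `H`. -/
def ExtBad {V W : Type} [Fintype V] (G : SimpleGraph V) (H : SimpleGraph W) {k : ℕ}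
    (F : Fin k → W → Prop) (J t : ℕ) (a s : ℝ) (e : Fin k ↪ V) : Prop :=
  ∃ R A : Finset V, (∀ i, e i ∉ R) ∧ R.card ≤ J ∧ Meas G R (· ∈ A) ∧ ((Aᶜ).card : ℝ) ≤ a ∧
    (∀ i, Tame G R (e i) A s) ∧ Pack G H (Aᶜ \ Finset.univ.map e) t ∧
    ∀ q : H ↪g G, ¬ ∀ i w, (G.Adj (e i) (q w) ↔ F i w)

theorem ExtBad.badTrace {V W : Type} [Fintype V] {G : SimpleGraph V} {H : SimpleGraph W} {k : ℕ}
    {F : Fin k → W → Prop} {J t : ℕ} {a s : ℝ} {e : Fin k ↪ V} (h : ExtBad G H F J t a s e) :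
    BadTrace (G.comap (Subtype.val : {x // ∀ i, e i ≠ x} → V)) H F J t a s
      (fun i x => G.Adj (e i) x.1) := by
  obtain ⟨R, A, hR, hRJ, hA, hAc, hT, ⟨φ, hφ1, hφ2⟩, hq⟩ := h
  have hmeas : ∀ P : V → Prop, Meas G R P →
      Meas (G.comap (Subtype.val : {x // ∀ i, e i ≠ x} → V)) (R.subtype _) (fun x => P x.1) := by
    intro P hP x y hxy
    refine hP _ _ (fun r hr => ?_)
    have hr' : ∀ i, e i ≠ r := fun i hi => hR i (hi ▸ hr)
    exact hxy ⟨r, hr'⟩ (by simpa using hr)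
  refine ⟨R.subtype _, A.subtype _, ?_, ?_, ?_, ?_, ?_, ?_⟩
  · rw [Finset.card_subtype]
    exact (Finset.card_filter_le _ _).trans hRJ
  · simpa using hmeas _ hA
  · refine le_trans (Nat.cast_le.2 ?_) hAc
    refine Finset.card_le_card_of_injOn Subtype.val ?_ Subtype.val_injective.injOn
    intro x hx
    simpa using hx
  · intro i
    obtain ⟨Y, hY1, hY2⟩ := hT i
    refine ⟨_, hmeas Y hY1, le_trans (Nat.cast_le.2 ?_) hY2⟩
    refine Finset.card_le_card_of_injOn Subtype.val ?_ Subtype.val_injective.injOn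
    intro x hx
    simpa using hx
  · have hv : ∀ i w, ∀ j, e j ≠ φ i w := by
      intro i w j hj
      have := (Finset.mem_sdiff.1 (hφ1 i w)).2
      exact this (Finset.mem_map.2 ⟨j, Finset.mem_univ _, hj⟩)
    refine ⟨fun i => ⟨⟨fun w => ⟨φ i w, hv i w⟩, fun w w' h => (φ i).injective (congrArg Subtype.val h)⟩,
      ?_⟩, ?_, ?_⟩
    · intro w w'
      exact (φ i).map_adj_iff
    · intro i w
      have := (Finset.mem_sdiff.1 (hφ1 i w)).1
      simp only [Finset.mem_compl] at this
      simp only [Finset.mem_compl, Finset.mem_subtype]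
      exact this
    · intro i j w w' h
      exact hφ2 _ _ _ _ (congrArg Subtype.val h)
  · intro q hcon
    exact hq ((SimpleGraph.Embedding.comap ⟨Subtype.val, Subtype.val_injective⟩ G).comp q) hcon

theorem extBad_count {V W : Type} [Fintype V] [Fintype W] (H : SimpleGraph W) {k : ℕ}
    (F : Fin k → W → Prop) (J t : ℕ) {a β θ : ℝ} {n : ℕ} (hS : SmallSub β θ)
    (hV : Fintype.card V = n) :
    (gcount (fun G : SimpleGraph V => C5Free G ∧ ∃ e, ExtBad G H F J t a (θ * n) e) : ℝ) ≤
      (n : ℝ) ^ k * (fN (n - k) * 2 ^ (k * k) *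
      (((n : ℝ) + 1) ^ J * 2 ^ (2 ^ J * (k + 1)) *
        (((2 : ℝ) ^ (β * n)) ^ k * ((2 : ℝ) ^ (k * a) *
          (1 - 1 / 2 ^ (k * Fintype.card W)) ^ t)))) := by
  set M := (((n : ℝ) + 1) ^ J * 2 ^ (2 ^ J * (k + 1)) *
        (((2 : ℝ) ^ (β * n)) ^ k * ((2 : ℝ) ^ (k * a) *
          (1 - 1 / 2 ^ (k * Fintype.card W)) ^ t))) with hM
  have hM0 : 0 ≤ M := by
    have : (0 : ℝ) ≤ 1 - 1 / 2 ^ (k * Fintype.card W) := by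
      rw [sub_nonneg, div_le_one (by positivity)]
      exact one_le_pow₀ (by norm_num)
    positivity
  have hfix : ∀ e : Fin k ↪ V,
      (gcount (fun G : SimpleGraph V => C5Free G ∧ ExtBad G H F J t a (θ * n) e) : ℝ) ≤
        fN (n - k) * 2 ^ (k * k) * M := by
    intro e
    have hcardV : Fintype.card {x // ∀ i, e i ≠ x} = n - k := by
      have h1 : Fintype.card {x // ∀ i, e i ≠ x} = Fintype.card {x // ¬ x ∈ Set.range e} :=
        Fintype.card_congr (Equiv.subtypeEquivRight (fun x => by simp))
      rw [h1, Fintype.card_subtype_compl, hV]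
      congr 1
      rw [← Fintype.card_congr (Equiv.ofInjective e e.injective), Fintype.card_fin]
    have hmaps := Finset.card_le_mul_card_image_of_maps_to
      (s := csep (fun G : SimpleGraph V => C5Free G ∧ ExtBad G H F J t a (θ * n) e))
      (t := csep (C5Free : SimpleGraph {x // ∀ i, e i ≠ x} → Prop) ×ˢ
        (Finset.univ : Finset (Fin k → Fin k → Prop)))
      (f := fun G => (G.comap Subtype.val, fun i j => G.Adj (e i) (e j)))
      (by
        intro G hG
        rw [mem_csep] at hG
        refine Finset.mem_product.2 ⟨mem_csep.2 ?_, Finset.mem_univ _⟩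
        exact hG.1.comap (SimpleGraph.Embedding.comap ⟨Subtype.val, Subtype.val_injective⟩ G))
      ⌊M⌋₊ (by
        rintro ⟨G', I⟩ -
        refine Nat.le_floor (le_trans (Nat.cast_le.2 ?_)
          (badTrace_count G' H F J t (a := a) (N := n) hS
            (by rw [hcardV]; exact_mod_cast Nat.sub_le _ _)))
        refine Finset.card_le_card_of_injOn (fun G i x => G.Adj (e i) x.1) ?_ ?_
        · intro G hG
          have hG := Finset.mem_filter.1 (Finset.mem_coe.1 hG)
          have h1 := (mem_csep.1 hG.1).2.badTrace
          have e1 : G.comap Subtype.val = G' := congrArg Prod.fst hG.2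
          rw [e1] at h1
          exact Finset.mem_coe.2 (mem_csep.2 h1)
        · intro G hG K hK hGK
          have hG := (Finset.mem_filter.1 (Finset.mem_coe.1 hG)).2
          have hK := (Finset.mem_filter.1 (Finset.mem_coe.1 hK)).2
          have h1 := hG.trans hK.symm
          have h2 : ∀ x y : {x // ∀ i, e i ≠ x}, G.Adj x.1 y.1 ↔ K.Adj x.1 y.1 := by
            intro x y
            have := congrArg (fun p : SimpleGraph _ × (Fin k → Fin k → Prop) => p.1.Adj x y) h1
            simpa using this
          have h3 : ∀ i j, G.Adj (e i) (e j) ↔ K.Adj (e i) (e j) := by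
            intro i j
            have := congrArg (fun p : SimpleGraph _ × (Fin k → Fin k → Prop) => p.2 i j) h1
            simpa using this
          have h4 : ∀ i (x : {x // ∀ i, e i ≠ x}), G.Adj (e i) x.1 ↔ K.Adj (e i) x.1 := by
            intro i x
            have := congrFun (congrFun hGK i) x
            simpa using this
          ext x y
          by_cases hx : ∀ i, e i ≠ x <;> by_cases hy : ∀ i, e i ≠ y
          · exact h2 ⟨x, hx⟩ ⟨y, hy⟩
          · push Not at hy
            obtain ⟨i, rfl⟩ := hy
            rw [G.adj_comm, K.adj_comm]
            exact h4 i ⟨x, hx⟩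
          · push Not at hx
            obtain ⟨i, rfl⟩ := hx
            exact h4 i ⟨y, hy⟩
          · push Not at hx hy
            obtain ⟨i, rfl⟩ := hx
            obtain ⟨j, rfl⟩ := hy
            exact h3 i j)
    have hc5 : (csep (C5Free : SimpleGraph {x // ∀ i, e i ≠ x} → Prop)).card = fN (n - k) :=
      gcount_c5Free hcardV
    rw [Finset.card_product, hc5] at hmaps
    have hI : (Finset.univ : Finset (Fin k → Fin k → Prop)).card = 2 ^ (k * k) := by
      simp [← pow_mul]
    rw [hI] at hmaps
    calc (gcount (fun G : SimpleGraph V => C5Free G ∧ ExtBad G H F J t a (θ * n) e) : ℝ)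
        ≤ ((⌊M⌋₊ * (fN (n - k) * 2 ^ (k * k)) : ℕ) : ℝ) := Nat.cast_le.2 hmaps
      _ = ⌊M⌋₊ * ((fN (n - k) : ℝ) * 2 ^ (k * k)) := by push_cast; rfl
      _ ≤ M * ((fN (n - k) : ℝ) * 2 ^ (k * k)) :=
          mul_le_mul_of_nonneg_right (Nat.floor_le hM0) (by positivity)
      _ = _ := by ring
  have h1 := gcount_exists_le
    (fun (e : Fin k ↪ V) (G : SimpleGraph V) => C5Free G ∧ ExtBad G H F J t a (θ * n) e) _ hfix
  refine le_trans (Nat.cast_le.2 (gcount_mono ?_)) (h1.trans ?_)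
  · rintro G ⟨h, e, he⟩
    exact ⟨e, h, he⟩
  · refine mul_le_mul_of_nonneg_right ?_ (by positivity)
    have h2 : Fintype.card (Fin k ↪ V) ≤ Fintype.card (Fin k → V) :=
      Fintype.card_le_of_injective _ DFunLike.coe_injective
    rw [Fintype.card_fun, hV, Fintype.card_fin] at h2
    exact_mod_cast h2

/-! ### Conditional expectations with respect to a labelling -/

/-- The averaging kernel of the partition of `V` into the fibres of `π`. -/
def ck {V ι : Type*} [Fintype V] (π : V → ι) (u x : V) : ℝ :=
  if π x = π u then 1 / ((Finset.univ.filter (fun y => π y = π u)).card : ℝ) else 0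

/-- The average of `f` over the fibre of `π` containing `u`. -/
def ce {V ι : Type*} [Fintype V] (π : V → ι) (f : V → ℝ) (u : V) : ℝ := ∑ x, ck π u x * f x

section CondExp

variable {V ι : Type*} [Fintype V] (π : V → ι)

theorem ck_symm (u x : V) : ck π u x = ck π x u := by
  unfold ck
  by_cases h : π x = π u
  · simp [h]
  · have h' : ¬ π u = π x := fun h' => h h'.symm
    simp [h, h']

theorem ck_nonneg (u x : V) : 0 ≤ ck π u x := by
  unfold ck
  split_ifs <;> positivity

theorem ck_sum (u : V) : ∑ x, ck π u x = 1 := by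
  unfold ck
  rw [← Finset.sum_filter, Finset.sum_const, nsmul_eq_mul]
  refine mul_one_div_cancel ?_
  have : u ∈ Finset.univ.filter (fun y => π y = π u) := by simp
  exact_mod_cast (Finset.card_pos.2 ⟨u, this⟩).ne'

theorem sum_ce_mul_comm (f g : V → ℝ) : ∑ u, ce π f u * g u = ∑ u, f u * ce π g u := by
  unfold ce
  simp only [Finset.sum_mul, Finset.mul_sum]
  rw [Finset.sum_comm]
  refine Finset.sum_congr rfl (fun x _ => Finset.sum_congr rfl (fun u _ => ?_))
  rw [ck_symm π u x]
  ring

variable {π}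

theorem ce_of_const {f : V → ℝ} (hf : ∀ x y, π x = π y → f x = f y) : ce π f = f := by
  funext u
  unfold ce
  have : ∀ x, ck π u x * f x = ck π u x * f u := by
    intro x
    by_cases h : π x = π u
    · rw [hf x u h]
    · simp [ck, h]
  simp only [this]
  rw [← Finset.sum_mul, ck_sum, one_mul]

theorem ce_const (f : V → ℝ) {x y : V} (h : π x = π y) : ce π f x = ce π f y := by
  unfold ce ck
  simp [h]

theorem sum_ce_mul (f : V → ℝ) {g : V → ℝ} (hg : ∀ x y, π x = π y → g x = g y) :
    ∑ u, ce π f u * g u = ∑ u, f u * g u := by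
  rw [sum_ce_mul_comm, ce_of_const hg]

theorem ce_sub (f g : V → ℝ) (u : V) : ce π (fun x => f x - g x) u = ce π f u - ce π g u := by
  unfold ce
  rw [← Finset.sum_sub_distrib]
  exact Finset.sum_congr rfl (fun x _ => by ring)

theorem ce_one (u : V) : ce π (fun _ => 1) u = 1 := by
  unfold ce
  simp [ck_sum]

theorem ce_nonneg {f : V → ℝ} (hf : ∀ x, 0 ≤ f x) (u : V) : 0 ≤ ce π f u :=
  Finset.sum_nonneg (fun x _ => mul_nonneg (ck_nonneg π u x) (hf x))

theorem ce_mono {f g : V → ℝ} (hf : ∀ x, f x ≤ g x) (u : V) : ce π f u ≤ ce π g u :=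
  Finset.sum_le_sum (fun x _ => mul_le_mul_of_nonneg_left (hf x) (ck_nonneg π u x))

theorem ce_le_one {f : V → ℝ} (hf : ∀ x, f x ≤ 1) (u : V) : ce π f u ≤ 1 :=
  (ce_mono hf u).trans (ce_one u).le

theorem abs_ce_le_one {f : V → ℝ} (hf : ∀ x, |f x| ≤ 1) (u : V) : |ce π f u| ≤ 1 := by
  rw [abs_le]
  refine ⟨?_, ce_le_one (fun x => (abs_le.1 (hf x)).2) u⟩
  have := ce_le_one (π := π) (f := fun x => 0 - f x)
    (fun x => by have := (abs_le.1 (hf x)).1; linarith) u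
  rw [ce_sub] at this
  have h0 : ce π (fun _ => 0) u = 0 := by simp [ce]
  linarith

end CondExp

/-! ### Four-fold sums -/

section FourFold

variable {V : Type*} [Fintype V]

/-- The sum of `f` over all quadruples. -/
def S4 (f : V → V → V → V → ℝ) : ℝ := ∑ a, ∑ b, ∑ c, ∑ d, f a b c d

theorem S4_swap12 (f : V → V → V → V → ℝ) : S4 f = S4 (fun a b c d => f b a c d) := by
  unfold S4
  rw [Finset.sum_comm]

theorem S4_swap23 (f : V → V → V → V → ℝ) : S4 f = S4 (fun a b c d => f a c b d) := by
  unfold S4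
  refine Finset.sum_congr rfl (fun a _ => ?_)
  rw [Finset.sum_comm]

theorem S4_swap34 (f : V → V → V → V → ℝ) : S4 f = S4 (fun a b c d => f a b d c) := by
  unfold S4
  refine Finset.sum_congr rfl (fun a _ => Finset.sum_congr rfl (fun b _ => ?_))
  rw [Finset.sum_comm]

theorem S4_sub (f g : V → V → V → V → ℝ) :
    S4 f - S4 g = S4 (fun a b c d => f a b c d - g a b c d) := by
  simp only [S4, Finset.sum_sub_distrib]

theorem S4_add (f g : V → V → V → V → ℝ) :
    S4 f + S4 g = S4 (fun a b c d => f a b c d + g a b c d) := by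
  simp only [S4, Finset.sum_add_distrib]

theorem S4_mono {f g : V → V → V → V → ℝ} (h : ∀ a b c d, f a b c d ≤ g a b c d) :
    S4 f ≤ S4 g :=
  Finset.sum_le_sum fun a _ => Finset.sum_le_sum fun b _ => Finset.sum_le_sum fun c _ =>
    Finset.sum_le_sum fun d _ => h a b c d

/-- The kernel `K` has cut norm at most `γ`. -/
def CutLe (K : V → V → ℝ) (γ : ℝ) : Prop :=
  ∀ s f : V → ℝ, (∀ x, |s x| ≤ 1) → (∀ x, |f x| ≤ 1) → |∑ v, ∑ u, s v * f u * K v u| ≤ γ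

theorem CutLe.S4_le {K : V → V → ℝ} {γ : ℝ} (hK : CutLe K γ) {X Y : V → V → V → ℝ}
    (hX : ∀ a c d, |X a c d| ≤ 1) (hY : ∀ b c d, |Y b c d| ≤ 1) :
    |S4 (fun a b c d => K a b * X a c d * Y b c d)| ≤ γ * (Fintype.card V : ℝ) ^ 2 := by
  rw [S4_swap23, S4_swap12, S4_swap34, S4_swap23]
  unfold S4
  have h : ∀ c d, |∑ a, ∑ b, K a b * X a c d * Y b c d| ≤ γ := by
    intro c d
    refine le_trans (le_of_eq ?_) (hK (fun a => X a c d) (fun b => Y b c d)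
      (fun a => hX a c d) (fun b => hY b c d))
    congr 1
    exact Finset.sum_congr rfl (fun a _ => Finset.sum_congr rfl (fun b _ => by ring))
  refine (Finset.abs_sum_le_sum_abs _ _).trans ?_
  refine (Finset.sum_le_sum (fun c _ => (Finset.abs_sum_le_sum_abs _ _).trans
    (Finset.sum_le_sum (fun d _ => h c d)))).trans (le_of_eq ?_)
  simp only [Finset.sum_const, Finset.card_univ, nsmul_eq_mul]
  ring

theorem S4_ce {ι : Type*} {π : V → ι} {M : V → V → V → V → ℝ}
    (h1 : ∀ b c d x y, π x = π y → M x b c d = M y b c d)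
    (h2 : ∀ a c d x y, π x = π y → M a x c d = M a y c d)
    (h3 : ∀ a b d x y, π x = π y → M a b x d = M a b y d)
    (h4 : ∀ a b c x y, π x = π y → M a b c x = M a b c y) (p q r s : V → ℝ) :
    S4 (fun a b c d => ce π p a * ce π q b * ce π r c * ce π s d * M a b c d) =
      S4 (fun a b c d => p a * q b * r c * s d * M a b c d) := by
  have e4 : ∀ p q r s : V → ℝ, S4 (fun a b c d => p a * q b * r c * ce π s d * M a b c d) =
      S4 (fun a b c d => p a * q b * r c * s d * M a b c d) := by
    intro p q r s
    unfold S4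
    refine Finset.sum_congr rfl fun a _ => Finset.sum_congr rfl fun b _ =>
      Finset.sum_congr rfl fun c _ => ?_
    have := sum_ce_mul (π := π) s (g := fun d => p a * q b * r c * M a b c d)
      (fun x y h => by simp only [h4 a b c x y h])
    calc _ = ∑ d, ce π s d * (p a * q b * r c * M a b c d) :=
          Finset.sum_congr rfl fun d _ => by ring
      _ = _ := this
      _ = _ := Finset.sum_congr rfl fun d _ => by ring
  have e3 : ∀ p q r s : V → ℝ, S4 (fun a b c d => p a * q b * ce π r c * s d * M a b c d) =
      S4 (fun a b c d => p a * q b * r c * s d * M a b c d) := by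
    intro p q r s
    rw [S4_swap34, S4_swap34 (fun a b c d => p a * q b * r c * s d * M a b c d)]
    unfold S4
    refine Finset.sum_congr rfl fun a _ => Finset.sum_congr rfl fun b _ =>
      Finset.sum_congr rfl fun d _ => ?_
    have := sum_ce_mul (π := π) r (g := fun c => p a * q b * s d * M a b c d)
      (fun x y h => by simp only [h3 a b d x y h])
    calc _ = ∑ c, ce π r c * (p a * q b * s d * M a b c d) :=
          Finset.sum_congr rfl fun d _ => by ring
      _ = _ := this
      _ = _ := Finset.sum_congr rfl fun d _ => by ring
  have e2 : ∀ p q r s : V → ℝ, S4 (fun a b c d => p a * ce π q b * r c * s d * M a b c d) =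
      S4 (fun a b c d => p a * q b * r c * s d * M a b c d) := by
    intro p q r s
    rw [S4_swap23, S4_swap34, S4_swap23 (fun a b c d => p a * q b * r c * s d * M a b c d),
      S4_swap34 (fun a c b d => p a * q b * r c * s d * M a b c d)]
    unfold S4
    refine Finset.sum_congr rfl fun a _ => Finset.sum_congr rfl fun c _ =>
      Finset.sum_congr rfl fun d _ => ?_
    have := sum_ce_mul (π := π) q (g := fun b => p a * r c * s d * M a b c d)
      (fun x y h => by simp only [h2 a c d x y h])
    calc _ = ∑ b, ce π q b * (p a * r c * s d * M a b c d) :=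
          Finset.sum_congr rfl fun d _ => by ring
      _ = _ := this
      _ = _ := Finset.sum_congr rfl fun d _ => by ring
  have e1 : ∀ p q r s : V → ℝ, S4 (fun a b c d => ce π p a * q b * r c * s d * M a b c d) =
      S4 (fun a b c d => p a * q b * r c * s d * M a b c d) := by
    intro p q r s
    rw [S4_swap12, S4_swap23, S4_swap34,
      S4_swap12 (fun a b c d => p a * q b * r c * s d * M a b c d),
      S4_swap23 (fun b a c d => p a * q b * r c * s d * M a b c d),
      S4_swap34 (fun b c a d => p a * q b * r c * s d * M a b c d)]
    unfold S4
    refine Finset.sum_congr rfl fun b _ => Finset.sum_congr rfl fun c _ =>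
      Finset.sum_congr rfl fun d _ => ?_
    have := sum_ce_mul (π := π) p (g := fun a => q b * r c * s d * M a b c d)
      (fun x y h => by simp only [h1 b c d x y h])
    calc _ = ∑ a, ce π p a * (q b * r c * s d * M a b c d) :=
          Finset.sum_congr rfl fun d _ => by ring
      _ = _ := this
      _ = _ := Finset.sum_congr rfl fun d _ => by ring
  rw [e1, e2, e3, e4]

end FourFold

section Pattern

variable {V : Type*} [Fintype V]

theorem abs_mul_le_one' {x y : ℝ} (hx : |x| ≤ 1) (hy : |y| ≤ 1) : |x * y| ≤ 1 := by
  rw [abs_mul]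
  exact mul_le_one₀ hx (abs_nonneg _) hy

/-- The weight of the induced path `a b c d`. -/
def pathWeight (K : V → V → ℝ) (a b c d : V) : ℝ :=
  K a b * K b c * K c d * (1 - K a c) * (1 - K a d) * (1 - K b d)

theorem CutLe.pathWeight_sub {K L : V → V → ℝ} {γ : ℝ} (h : CutLe (fun x y => K x y - L x y) γ)
    (hK0 : ∀ x y, 0 ≤ K x y) (hK1 : ∀ x y, K x y ≤ 1)
    (hL0 : ∀ x y, 0 ≤ L x y) (hL1 : ∀ x y, L x y ≤ 1) {p q r s : V → ℝ}
    (hp : ∀ x, |p x| ≤ 1) (hq : ∀ x, |q x| ≤ 1) (hr : ∀ x, |r x| ≤ 1) (hs : ∀ x, |s x| ≤ 1) :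
    |S4 (fun a b c d => p a * q b * r c * s d * pathWeight K a b c d) -
      S4 (fun a b c d => p a * q b * r c * s d * pathWeight L a b c d)| ≤
      6 * (γ * (Fintype.card V : ℝ) ^ 2) := by
  have aK : ∀ x y, |K x y| ≤ 1 := fun x y => abs_le.2 ⟨by linarith [hK0 x y], hK1 x y⟩
  have aL : ∀ x y, |L x y| ≤ 1 := fun x y => abs_le.2 ⟨by linarith [hL0 x y], hL1 x y⟩
  have bK : ∀ x y, |1 - K x y| ≤ 1 := fun x y => abs_le.2 ⟨by linarith [hK1 x y], by linarith [hK0 x y]⟩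
  have bL : ∀ x y, |1 - L x y| ≤ 1 := fun x y => abs_le.2 ⟨by linarith [hL1 x y], by linarith [hL0 x y]⟩
  have m1 := @abs_mul_le_one'
  have tab := h.S4_le (X := fun a c d => p a * r c * s d * K c d * (1 - K a c) * (1 - K a d))
    (Y := fun b c d => q b * K b c * (1 - K b d))
    (fun a c d => m1 (m1 (m1 (m1 (m1 (hp _) (hr _)) (hs _)) (aK _ _)) (bK _ _)) (bK _ _))
    (fun b c d => m1 (m1 (hq _) (aK _ _)) (bK _ _))
  have tbc := h.S4_le (X := fun b a d => p a * q b * s d * L a b * (1 - K a d) * (1 - K b d))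
    (Y := fun c a d => r c * K c d * (1 - K a c))
    (fun a c d => m1 (m1 (m1 (m1 (m1 (hp _) (hq _)) (hs _)) (aL _ _)) (bK _ _)) (bK _ _))
    (fun b c d => m1 (m1 (hr _) (aK _ _)) (bK _ _))
  have tcd := h.S4_le (X := fun c a b => p a * q b * r c * L a b * L b c * (1 - K a c))
    (Y := fun d a b => s d * (1 - K a d) * (1 - K b d))
    (fun a c d => m1 (m1 (m1 (m1 (m1 (hp _) (hq _)) (hr _)) (aL _ _)) (aL _ _)) (bK _ _))
    (fun b c d => m1 (m1 (hs _) (bK _ _)) (bK _ _))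
  have tac := h.S4_le (X := fun a b d => - (p a * q b * s d * L a b * (1 - K a d) * (1 - K b d)))
    (Y := fun c b d => r c * L b c * L c d)
    (fun a c d => by
      rw [abs_neg]
      exact m1 (m1 (m1 (m1 (m1 (hp _) (hq _)) (hs _)) (aL _ _)) (bK _ _)) (bK _ _))
    (fun b c d => m1 (m1 (hr _) (aL _ _)) (aL _ _))
  have tad := h.S4_le (X := fun a b c => - (p a * q b * r c * L a b * L b c * (1 - L a c)))
    (Y := fun d b c => s d * L c d * (1 - K b d))
    (fun a c d => by
      rw [abs_neg]
      exact m1 (m1 (m1 (m1 (m1 (hp _) (hq _)) (hr _)) (aL _ _)) (aL _ _)) (bL _ _))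
    (fun b c d => m1 (m1 (hs _) (aL _ _)) (bK _ _))
  have tbd := h.S4_le (X := fun b a c => - (p a * q b * r c * L a b * L b c * (1 - L a c)))
    (Y := fun d a c => s d * L c d * (1 - L a d))
    (fun a c d => by
      rw [abs_neg]
      exact m1 (m1 (m1 (m1 (m1 (hp _) (hq _)) (hr _)) (aL _ _)) (aL _ _)) (bL _ _))
    (fun b c d => m1 (m1 (hs _) (aL _ _)) (bL _ _))
  rw [S4_swap23, S4_swap12] at tbc
  rw [S4_swap23, S4_swap34, S4_swap12, S4_swap23] at tcd
  rw [S4_swap23] at tac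
  rw [S4_swap23, S4_swap34] at tad
  rw [S4_swap23, S4_swap34, S4_swap12] at tbd
  have key : S4 (fun a b c d => p a * q b * r c * s d * pathWeight K a b c d) -
      S4 (fun a b c d => p a * q b * r c * s d * pathWeight L a b c d) =
    S4 (fun a b c d => (K a b - L a b) * (p a * r c * s d * K c d * (1 - K a c) * (1 - K a d)) *
        (q b * K b c * (1 - K b d))) +
    S4 (fun a b c d => (K b c - L b c) * (p a * q b * s d * L a b * (1 - K a d) * (1 - K b d)) *
        (r c * K c d * (1 - K a c))) +
    S4 (fun a b c d => (K c d - L c d) * (p a * q b * r c * L a b * L b c * (1 - K a c)) *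
        (s d * (1 - K a d) * (1 - K b d))) +
    S4 (fun a b c d => (K a c - L a c) * (- (p a * q b * s d * L a b * (1 - K a d) * (1 - K b d))) *
        (r c * L b c * L c d)) +
    S4 (fun a b c d => (K a d - L a d) * (- (p a * q b * r c * L a b * L b c * (1 - L a c))) *
        (s d * L c d * (1 - K b d))) +
    S4 (fun a b c d => (K b d - L b d) * (- (p a * q b * r c * L a b * L b c * (1 - L a c))) *
        (s d * L c d * (1 - L a d))) := by
    rw [S4_sub, S4_add, S4_add, S4_add, S4_add, S4_add]
    congr 1
    funext a b c d
    unfold pathWeight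
    ring
  rw [key]
  rw [abs_le] at *
  constructor <;> linarith [tab.1, tab.2, tbc.1, tbc.2, tcd.1, tcd.2, tac.1, tac.2, tad.1, tad.2,
    tbd.1, tbd.2]

/-- The number of four-cycles in a dense bipartite relation. -/
theorem S4_cycle_ge (M : V → V → ℝ) :
    (∑ x, ∑ y, M x y) ^ 4 ≤ (Fintype.card V : ℝ) ^ 4 *
      S4 (fun x x' y y' => M x y * M x' y * (M x y' * M x' y')) := by
  set n : ℝ := (Fintype.card V : ℝ) with hn
  have hn0 : 0 ≤ n := by positivity
  have cs : ∀ f : V → ℝ, (∑ x, f x) ^ 2 ≤ n * ∑ x, f x ^ 2 := by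
    intro f
    have := sq_sum_le_card_mul_sum_sq (s := Finset.univ) (f := f)
    simpa [hn] using this
  have h1 : (∑ x, ∑ y, M x y) ^ 2 ≤ n * ∑ y, (∑ x, M x y) ^ 2 := by
    rw [Finset.sum_comm]
    exact cs _
  have h2 : ∑ y, (∑ x, M x y) ^ 2 = ∑ x, ∑ x', ∑ y, M x y * M x' y := by
    simp only [sq, Finset.sum_mul_sum]
    rw [Finset.sum_comm]
    refine Finset.sum_congr rfl (fun x _ => ?_)
    rw [Finset.sum_comm]
  have h3 : (∑ x, ∑ x', ∑ y, M x y * M x' y) ^ 2 ≤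
      n ^ 2 * S4 (fun x x' y y' => M x y * M x' y * (M x y' * M x' y')) := by
    refine (cs _).trans ?_
    rw [sq n, mul_assoc]
    refine mul_le_mul_of_nonneg_left ?_ hn0
    unfold S4
    rw [Finset.mul_sum]
    refine Finset.sum_le_sum (fun x _ => (cs _).trans (le_of_eq ?_))
    congr 1
    refine Finset.sum_congr rfl (fun x' _ => ?_)
    rw [sq, Finset.sum_mul_sum]
  rw [← h2] at h3
  calc (∑ x, ∑ y, M x y) ^ 4 = ((∑ x, ∑ y, M x y) ^ 2) ^ 2 := by ring
    _ ≤ (n * ∑ y, (∑ x, M x y) ^ 2) ^ 2 := by gcongr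
    _ = n ^ 2 * (∑ y, (∑ x, M x y) ^ 2) ^ 2 := by ring
    _ ≤ n ^ 2 * (n ^ 2 * S4 (fun x x' y y' => M x y * M x' y * (M x y' * M x' y'))) := by gcongr
    _ = _ := by ring

theorem pow_four_le_mul {δ a b c d : ℝ} (hδ : 0 ≤ δ) (ha : δ ≤ a) (hb : δ ≤ b) (hc : δ ≤ c)
    (hd : δ ≤ d) : δ ^ 4 ≤ a * b * (c * d) := by
  have h1 : δ * δ ≤ a * b := mul_le_mul ha hb hδ (hδ.trans ha)
  have h2 : δ * δ ≤ c * d := mul_le_mul hc hd hδ (hδ.trans hc)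
  calc δ ^ 4 = δ * δ * (δ * δ) := by ring
    _ ≤ _ := mul_le_mul h1 h2 (by positivity) (le_trans (by positivity) h1)

/-- The value `x` is bounded away from `0` and `1`. -/
def Grey (δ x : ℝ) : Prop := δ ≤ x ∧ x ≤ 1 - δ

theorem grey_cycle_le {L : V → V → ℝ} (hL0 : ∀ x y, 0 ≤ L x y) (hL1 : ∀ x y, L x y ≤ 1)
    (hLs : ∀ x y, L x y = L y x) {d : V → ℝ} (hd0 : ∀ x, 0 ≤ d x) (hd1 : ∀ x, d x ≤ 1)
    {δ δ' : ℝ} (hδ : 0 ≤ δ) (hδ' : 0 ≤ δ') {M : V → V → ℝ}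
    (hM : ∀ x y, M x y = if Grey δ (d x) ∧ Grey δ (d y) ∧ Grey δ' (L x y) then 1 else 0)
    {Φ : V → V → V → V → ℝ}
    (hΦ : Φ = fun a b c e => d a * (1 - d b) * (1 - d c) * d e * pathWeight L a b c e)
    (x x' y y' : V) :
    δ ^ 4 * δ' ^ 4 * (M x y * M x' y * (M x y' * M x' y')) ≤
      Φ x x' y y' + Φ y x x' y' + Φ x y y' x' + Φ x y x' y' := by
  have hΦ0 : ∀ a b c e, 0 ≤ Φ a b c e := by
    intro a b c e
    rw [hΦ]
    unfold pathWeight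
    have n1 : ∀ x, 0 ≤ 1 - d x := fun x => sub_nonneg.2 (hd1 x)
    have n2 : ∀ x y, 0 ≤ 1 - L x y := fun x y => sub_nonneg.2 (hL1 x y)
    have := hd0 a; have := hd0 e; have := n1 b; have := n1 c
    have := hL0 a b; have := hL0 b c; have := hL0 c e
    have := n2 a c; have := n2 a e; have := n2 b e
    positivity
  by_cases h : (Grey δ (d x) ∧ Grey δ (d y) ∧ Grey δ' (L x y)) ∧
      (Grey δ (d x') ∧ Grey δ (d y) ∧ Grey δ' (L x' y)) ∧
      (Grey δ (d x) ∧ Grey δ (d y') ∧ Grey δ' (L x y')) ∧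
      (Grey δ (d x') ∧ Grey δ (d y') ∧ Grey δ' (L x' y'))
  · obtain ⟨⟨gx, gy, g1⟩, ⟨gx', -, g2⟩, ⟨-, gy', g3⟩, ⟨-, -, g4⟩⟩ := h
    have hMM : M x y * M x' y * (M x y' * M x' y') = 1 := by
      simp only [hM, gx, gy, gx', gy', g1, g2, g3, g4, and_self, if_true, mul_one]
    rw [hMM, mul_one, hΦ]
    unfold pathWeight
    simp only
    rw [hLs y x, hLs y x', hLs y' x']
    unfold Grey at *
    have lo : ∀ {a : ℝ}, a ≤ 1 - δ → δ ≤ 1 - a := fun h => by linarith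
    have lo' : ∀ {a : ℝ}, a ≤ 1 - δ' → δ' ≤ 1 - a := fun h => by linarith
    have key : ∀ {a b c e f g h k w : ℝ}, δ ≤ a → δ ≤ b → δ ≤ c → δ ≤ e → δ' ≤ f → δ' ≤ g →
        δ' ≤ h → δ' ≤ k → 0 ≤ w →
        δ ^ 4 * δ' ^ 4 * w ≤ (a * b * (c * e)) * (f * g * (h * k)) * w := by
      intro a b c e f g h k w ha hb hc he hf hg hh hk hw
      have h1 := pow_four_le_mul hδ ha hb hc he
      have h2 := pow_four_le_mul hδ' hf hg hh hk
      exact mul_le_mul_of_nonneg_right (mul_le_mul h1 h2 (by positivity)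
        (le_trans (by positivity) h1)) hw
    have p0 := hL0 x x'
    have q0 := hL0 y y'
    have p1 := sub_nonneg.2 (hL1 x x')
    have q1 := sub_nonneg.2 (hL1 y y')
    have k1 := key gx.1 (lo gx'.2) (lo gy.2) gy'.1 g2.1 (lo' g1.2) (lo' g3.2) (lo' g4.2)
      (mul_nonneg p0 q0)
    have k2 := key gy.1 (lo gx.2) (lo gx'.2) gy'.1 g1.1 g4.1 (lo' g2.2) (lo' g3.2)
      (mul_nonneg p0 q1)
    have k3 := key gx.1 (lo gy.2) (lo gy'.2) gx'.1 g1.1 g4.1 (lo' g3.2) (lo' g2.2)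
      (mul_nonneg p1 q0)
    have k4 := key gx.1 (lo gy.2) (lo gx'.2) gy'.1 g1.1 g2.1 g4.1 (lo' g3.2)
      (mul_nonneg p1 q1)
    nlinarith [k1, k2, k3, k4]
  · have hMM : M x y * M x' y * (M x y' * M x' y') = 0 := by
      by_contra hne
      apply h
      have hne1 := left_ne_zero_of_mul hne
      have hne2 := right_ne_zero_of_mul hne
      have key : ∀ a b, M a b ≠ 0 → Grey δ (d a) ∧ Grey δ (d b) ∧ Grey δ' (L a b) := by
        intro a b hab
        by_contra hcon
        rw [hM, if_neg hcon] at hab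
        exact hab rfl
      exact ⟨key _ _ (left_ne_zero_of_mul hne1), key _ _ (right_ne_zero_of_mul hne1),
        key _ _ (left_ne_zero_of_mul hne2), key _ _ (right_ne_zero_of_mul hne2)⟩
    rw [hMM, mul_zero]
    linarith [hΦ0 x x' y y', hΦ0 y x x' y', hΦ0 x y y' x', hΦ0 x y x' y']

theorem grey_sparse {ι : Type*} {π : V → ι} {W L : V → V → ℝ} {γ : ℝ}
    (hcut : CutLe (fun x y => W x y - L x y) γ)
    (hW0 : ∀ x y, 0 ≤ W x y) (hW1 : ∀ x y, W x y ≤ 1)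
    (hL0 : ∀ x y, 0 ≤ L x y) (hL1 : ∀ x y, L x y ≤ 1) (hLs : ∀ x y, L x y = L y x)
    (hLm : ∀ x y z, π x = π y → L x z = L y z) (v : V)
    (hfree : ∀ a b c e, W v a * (1 - W v b) * (1 - W v c) * W v e * pathWeight W a b c e = 0)
    {δ δ' : ℝ} (hδ : 0 ≤ δ) (hδ' : 0 ≤ δ') {d : V → ℝ} (hd : d = ce π (W v)) :
    (∑ x, ∑ y, if Grey δ (d x) ∧ Grey δ (d y) ∧ Grey δ' (L x y) then (1 : ℝ) else 0) ^ 4 *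
      (δ ^ 4 * δ' ^ 4) ≤ 24 * γ * (Fintype.card V : ℝ) ^ 6 := by
  have hd0 : ∀ x, 0 ≤ d x := fun x => hd ▸ ce_nonneg (hW0 v) x
  have hd1 : ∀ x, d x ≤ 1 := fun x => hd ▸ ce_le_one (hW1 v) x
  have hLm' : ∀ x y z, π x = π y → L z x = L z y := fun x y z h => by
    rw [hLs z x, hLs z y, hLm x y z h]
  have habs : ∀ x, |W v x| ≤ 1 := fun x => abs_le.2 ⟨by linarith [hW0 v x], hW1 v x⟩
  have habs' : ∀ x, |1 - W v x| ≤ 1 :=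
    fun x => abs_le.2 ⟨by linarith [hW1 v x], by linarith [hW0 v x]⟩
  have hsub := hcut.pathWeight_sub hW0 hW1 hL0 hL1 habs habs' habs' habs
  have hzero : S4 (fun a b c e => W v a * (1 - W v b) * (1 - W v c) * W v e *
      pathWeight W a b c e) = 0 := by
    simp only [hfree, S4, Finset.sum_const_zero]
  have hce := S4_ce (π := π) (M := pathWeight L)
    (fun b c e x y h => by unfold pathWeight; simp only [hLm x y _ h])
    (fun b c e x y h => by unfold pathWeight; simp only [hLm x y _ h, hLm' x y _ h])
    (fun b c e x y h => by unfold pathWeight; simp only [hLm x y _ h, hLm' x y _ h])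
    (fun b c e x y h => by unfold pathWeight; simp only [hLm' x y _ h])
    (W v) (fun x => 1 - W v x) (fun x => 1 - W v x) (W v)
  set Φ : V → V → V → V → ℝ :=
    fun a b c e => d a * (1 - d b) * (1 - d c) * d e * pathWeight L a b c e with hΦ
  have hone : ∀ x, ce π (fun x => 1 - W v x) x = 1 - d x := by
    intro x
    rw [ce_sub, ce_one, hd]
  simp only [hone, ← hd] at hce
  rw [hzero, ← hce, zero_sub, abs_neg] at hsub
  have hΦle : S4 Φ ≤ 6 * (γ * (Fintype.card V : ℝ) ^ 2) := (le_abs_self _).trans hsub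
  set M : V → V → ℝ :=
    fun x y => if Grey δ (d x) ∧ Grey δ (d y) ∧ Grey δ' (L x y) then (1 : ℝ) else 0 with hM
  have hcyc := S4_cycle_ge M
  have hpt := S4_mono (grey_cycle_le hL0 hL1 hLs hd0 hd1 hδ hδ' (M := M) (fun x y => rfl) hΦ)
  have hsplit : S4 (fun x x' y y' => Φ x x' y y' + Φ y x x' y' + Φ x y y' x' + Φ x y x' y') =
      4 * S4 Φ := by
    rw [← S4_add, ← S4_add, ← S4_add]
    have e2 : S4 (fun x x' y y' => Φ y x x' y') = S4 Φ := by
      rw [S4_swap23, S4_swap12]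
    have e3 : S4 (fun x x' y y' => Φ x y y' x') = S4 Φ := by
      rw [S4_swap34, S4_swap23, S4_swap34]
      rw [S4_swap23, S4_swap34, S4_swap23]
    have e4 : S4 (fun x x' y y' => Φ x y x' y') = S4 Φ := by
      rw [S4_swap23]
    rw [e2, e3, e4]
    ring
  have hscale : S4 (fun x x' y y' => δ ^ 4 * δ' ^ 4 * (M x y * M x' y * (M x y' * M x' y'))) =
      δ ^ 4 * δ' ^ 4 * S4 (fun x x' y y' => M x y * M x' y * (M x y' * M x' y')) := by
    simp only [S4, Finset.mul_sum]
  rw [hscale, hsplit] at hpt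
  have hn : (0 : ℝ) ≤ (Fintype.card V : ℝ) ^ 4 := by positivity
  calc (∑ x, ∑ y, M x y) ^ 4 * (δ ^ 4 * δ' ^ 4)
      ≤ ((Fintype.card V : ℝ) ^ 4 * S4 (fun x x' y y' => M x y * M x' y * (M x y' * M x' y'))) *
        (δ ^ 4 * δ' ^ 4) := by gcongr
    _ = (Fintype.card V : ℝ) ^ 4 * (δ ^ 4 * δ' ^ 4 *
        S4 (fun x x' y y' => M x y * M x' y * (M x y' * M x' y'))) := by ring
    _ ≤ (Fintype.card V : ℝ) ^ 4 * (4 * (6 * (γ * (Fintype.card V : ℝ) ^ 2))) := by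
        refine mul_le_mul_of_nonneg_left (hpt.trans ?_) hn
        linarith
    _ = _ := by ring

end Pattern

/-! ### Energy increment and cut norm -/

section Energy

variable {V : Type*} [Fintype V] (G : SimpleGraph V)

/-- The adjacency kernel of `G`. -/
def adjK (v u : V) : ℝ := if G.Adj v u then 1 else 0

/-- The trace of `u` on `R`. -/
def lab (R : Finset V) (u : V) : V → Prop := fun r => r ∈ R ∧ G.Adj r u

/-- The density of `v` to the atom of `u`. -/
def dn (R : Finset V) (v : V) : V → ℝ := ce (lab G R) (adjK G v)

/-- The density between the atoms of `v` and `u`. -/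
def dd (R : Finset V) (v u : V) : ℝ := ce (lab G R) (fun w => dn G R w u) v

/-- The energy of the partition into atoms. -/
def energy (R : Finset V) : ℝ := ∑ v, ∑ u, dn G R v u ^ 2

theorem adjK_nonneg (v u : V) : 0 ≤ adjK G v u := by unfold adjK; split_ifs <;> norm_num

theorem adjK_le_one (v u : V) : adjK G v u ≤ 1 := by unfold adjK; split_ifs <;> norm_num

theorem adjK_symm (v u : V) : adjK G v u = adjK G u v := by unfold adjK; simp [G.adj_comm]

theorem dn_nonneg (R : Finset V) (v u : V) : 0 ≤ dn G R v u := ce_nonneg (adjK_nonneg G v) u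

theorem dn_le_one (R : Finset V) (v u : V) : dn G R v u ≤ 1 := ce_le_one (adjK_le_one G v) u

theorem dd_nonneg (R : Finset V) (v u : V) : 0 ≤ dd G R v u :=
  ce_nonneg (fun w => dn_nonneg G R w u) v

theorem dd_le_one (R : Finset V) (v u : V) : dd G R v u ≤ 1 :=
  ce_le_one (fun w => dn_le_one G R w u) v

theorem dd_symm (R : Finset V) (v u : V) : dd G R v u = dd G R u v := by
  unfold dd dn ce
  simp only [Finset.mul_sum]
  rw [Finset.sum_comm]
  refine Finset.sum_congr rfl (fun x _ => Finset.sum_congr rfl (fun y _ => ?_))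
  rw [adjK_symm G y x]
  ring

variable {G}

theorem lab_eq_iff {R : Finset V} {x y : V} :
    lab G R x = lab G R y ↔ ∀ r ∈ R, (G.Adj r x ↔ G.Adj r y) := by
  constructor
  · intro h r hr
    have := congrFun h r
    simpa [lab, hr] using this
  · intro h
    funext r
    unfold lab
    by_cases hr : r ∈ R
    · simp [hr, h r hr]
    · simp [hr]

theorem lab_mono {R R' : Finset V} (h : R ⊆ R') {x y : V} (hxy : lab G R' x = lab G R' y) :
    lab G R x = lab G R y :=
  lab_eq_iff.2 (fun r hr => lab_eq_iff.1 hxy r (h hr))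

theorem dn_const {R : Finset V} (v : V) {x y : V} (h : lab G R x = lab G R y) :
    dn G R v x = dn G R v y := ce_const _ h

theorem dd_const {R : Finset V} (v : V) {x y : V} (h : lab G R x = lab G R y) :
    dd G R x v = dd G R y v := ce_const _ h

variable (G)

theorem sum_dn_sub_sq {R R' : Finset V} (h : R ⊆ R') :
    ∑ v, ∑ u, (dn G R' v u - dn G R v u) ^ 2 = energy G R' - energy G R := by
  unfold energy
  rw [← Finset.sum_sub_distrib]
  refine Finset.sum_congr rfl (fun v _ => ?_)
  have h1 : ∑ u, dn G R' v u * dn G R v u = ∑ u, adjK G v u * dn G R v u :=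
    sum_ce_mul _ (fun x y hxy => dn_const v (lab_mono h hxy))
  have h2 : ∑ u, dn G R v u * dn G R v u = ∑ u, adjK G v u * dn G R v u :=
    sum_ce_mul _ (fun x y hxy => dn_const v hxy)
  calc ∑ u, (dn G R' v u - dn G R v u) ^ 2
      = ∑ u, dn G R' v u ^ 2 - 2 * ∑ u, dn G R' v u * dn G R v u +
        ∑ u, dn G R v u * dn G R v u := by
        rw [Finset.mul_sum, ← Finset.sum_sub_distrib, ← Finset.sum_add_distrib]
        exact Finset.sum_congr rfl (fun u _ => by ring)
    _ = ∑ u, dn G R' v u ^ 2 - ∑ u, dn G R v u * dn G R v u := by rw [h1, ← h2]; ring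
    _ = _ := by
        congr 1
        exact Finset.sum_congr rfl (fun u _ => by ring)

theorem energy_nonneg (R : Finset V) : 0 ≤ energy G R :=
  Finset.sum_nonneg (fun _ _ => Finset.sum_nonneg (fun _ _ => sq_nonneg _))

theorem energy_le (R : Finset V) : energy G R ≤ (Fintype.card V : ℝ) ^ 2 := by
  unfold energy
  refine (Finset.sum_le_sum (fun v _ => Finset.sum_le_sum (fun u _ =>
    pow_le_one₀ (dn_nonneg G R v u) (dn_le_one G R v u)))).trans (le_of_eq ?_)
  simp [sq]

theorem exists_energy_stable [Nonempty V] {ε : ℝ} (hε : 0 < ε) (Q : Finset V) :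
    ∃ R : Finset V, Disjoint R Q ∧ R.card ≤ ⌈1 / ε⌉₊ ∧
      ∀ v ∉ Q, energy G (insert v R) ≤ energy G R + ε * (Fintype.card V : ℝ) ^ 2 := by
  by_contra! hcon
  have hn : (0 : ℝ) < (Fintype.card V : ℝ) ^ 2 := by
    have : 0 < Fintype.card V := Fintype.card_pos
    positivity
  have key : ∀ k : ℕ, k ≤ ⌈1 / ε⌉₊ + 1 → ∃ R : Finset V, Disjoint R Q ∧ R.card ≤ k ∧
      (k : ℝ) * (ε * (Fintype.card V : ℝ) ^ 2) ≤ energy G R := by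
    intro k
    induction k with
    | zero => exact fun _ => ⟨∅, by simp, by simp, by simpa using energy_nonneg G ∅⟩
    | succ k ih =>
      intro hk
      obtain ⟨R, h1, h2, h3⟩ := ih (by omega)
      obtain ⟨v, hv, hlt⟩ := hcon R h1 (by omega)
      refine ⟨insert v R, Finset.disjoint_insert_left.2 ⟨hv, h1⟩,
        (Finset.card_insert_le _ _).trans (by omega), ?_⟩
      push_cast
      linarith
  obtain ⟨R, -, -, h⟩ := key _ le_rfl
  have h1 := h.trans (energy_le G R)
  have h2 : 1 / ε ≤ (⌈1 / ε⌉₊ : ℝ) := Nat.le_ceil _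
  rw [div_le_iff₀ hε] at h2
  push_cast at h1
  have : (Fintype.card V : ℝ) ^ 2 < (⌈1 / ε⌉₊ + 1) * (ε * (Fintype.card V : ℝ) ^ 2) := by
    nlinarith [mul_pos hε hn]
  linarith

theorem sum_abs_le_of_sq {f : V → V → ℝ} {η : ℝ} (hη : 0 ≤ η)
    (h : ∑ v, ∑ u, f v u ^ 2 ≤ η ^ 2 * (Fintype.card V : ℝ) ^ 2) :
    ∑ v, ∑ u, |f v u| ≤ η * (Fintype.card V : ℝ) ^ 2 := by
  refine le_of_sq_le_sq ?_ (by positivity)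
  have cs : ∀ g : V → ℝ, (∑ x, g x) ^ 2 ≤ (Fintype.card V : ℝ) * ∑ x, g x ^ 2 := by
    intro g
    simpa using sq_sum_le_card_mul_sum_sq (s := Finset.univ) (f := g)
  calc (∑ v, ∑ u, |f v u|) ^ 2 ≤ (Fintype.card V : ℝ) * ∑ v, (∑ u, |f v u|) ^ 2 := cs _
    _ ≤ (Fintype.card V : ℝ) * ∑ v, (Fintype.card V : ℝ) * ∑ u, |f v u| ^ 2 := by
        gcongr with v
        exact cs _
    _ = (Fintype.card V : ℝ) ^ 2 * ∑ v, ∑ u, f v u ^ 2 := by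
        simp only [sq_abs]
        rw [← Finset.mul_sum]
        ring
    _ ≤ (Fintype.card V : ℝ) ^ 2 * (η ^ 2 * (Fintype.card V : ℝ) ^ 2) := by gcongr
    _ = _ := by ring

theorem sum_corr_le {R Q : Finset V} {η : ℝ} (hη : 0 ≤ η) (hQ : (Q.card : ℝ) ≤ η * Fintype.card V)
    (hR : ∀ v ∉ Q, energy G (insert v R) ≤ energy G R + η ^ 2 * (Fintype.card V : ℝ) ^ 2) :
    ∑ v, ∑ v', |∑ u, (adjK G v u - dn G R v u) * (adjK G v' u - dn G R v' u)| ≤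
      2 * η * (Fintype.card V : ℝ) ^ 3 := by
  set n : ℝ := (Fintype.card V : ℝ) with hn
  have hn0 : 0 ≤ n := by positivity
  have hE1 : ∀ v u, |adjK G v u - dn G R v u| ≤ 1 := fun v u =>
    abs_le.2 ⟨by linarith [adjK_nonneg G v u, dn_le_one G R v u],
      by linarith [adjK_le_one G v u, dn_nonneg G R v u]⟩
  rw [Finset.sum_comm]
  have hin : ∀ v', ∑ v, |∑ u, (adjK G v u - dn G R v u) * (adjK G v' u - dn G R v' u)| ≤ n ^ 2 := by
    intro v'
    refine (Finset.sum_le_sum (fun v _ => (Finset.abs_sum_le_sum_abs _ _).trans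
      (Finset.sum_le_sum (fun u _ => abs_mul_le_one' (hE1 v u) (hE1 v' u))))).trans (le_of_eq ?_)
    simp [hn, sq]
  have hout : ∀ v' ∉ Q,
      ∑ v, |∑ u, (adjK G v u - dn G R v u) * (adjK G v' u - dn G R v' u)| ≤ η * n ^ 2 := by
    intro v' hv'
    have hsub : R ⊆ insert v' R := Finset.subset_insert _ _
    have hlab : ∀ x y, lab G (insert v' R) x = lab G (insert v' R) y →
        adjK G v' x - dn G R v' x = adjK G v' y - dn G R v' y := by
      intro x y hxy
      have h1 := lab_eq_iff.1 hxy v' (Finset.mem_insert_self _ _)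
      rw [dn_const v' (lab_mono hsub hxy)]
      unfold adjK
      simp [h1]
    have heq : ∀ v, ∑ u, (adjK G v u - dn G R v u) * (adjK G v' u - dn G R v' u) =
        ∑ u, (dn G (insert v' R) v u - dn G R v u) * (adjK G v' u - dn G R v' u) := by
      intro v
      have h1 := sum_ce_mul (adjK G v) hlab
      simp only [sub_mul, Finset.sum_sub_distrib]
      rw [← h1]
      rfl
    have h2 := sum_abs_le_of_sq (f := fun v u => dn G (insert v' R) v u - dn G R v u) hη
      (by rw [sum_dn_sub_sq G hsub]; linarith [hR v' hv'])
    refine le_trans (Finset.sum_le_sum (fun v _ => ?_)) h2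
    rw [heq v]
    refine (Finset.abs_sum_le_sum_abs _ _).trans (Finset.sum_le_sum (fun u _ => ?_))
    rw [abs_mul]
    exact mul_le_of_le_one_right (abs_nonneg _) (hE1 v' u)
  calc _ ≤ ∑ v', ((if v' ∈ Q then n ^ 2 else 0) + η * n ^ 2) := by
        refine Finset.sum_le_sum (fun v' _ => ?_)
        split_ifs with h
        · have := hin v'
          have : 0 ≤ η * n ^ 2 := by positivity
          linarith
        · simpa using hout v' h
    _ = Q.card * n ^ 2 + η * n ^ 3 := by
        rw [Finset.sum_add_distrib]
        simp only [Finset.sum_ite_mem, Finset.univ_inter, Finset.sum_const, Finset.card_univ,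
          nsmul_eq_mul]
        rw [← hn]
        ring
    _ ≤ η * n * n ^ 2 + η * n ^ 3 := by gcongr
    _ = _ := by ring

theorem cutLe_dn {R Q : Finset V} {η γ : ℝ} (hη : 0 ≤ η) (hQ : (Q.card : ℝ) ≤ η * Fintype.card V)
    (hR : ∀ v ∉ Q, energy G (insert v R) ≤ energy G R + η ^ 2 * (Fintype.card V : ℝ) ^ 2)
    (hγ : 0 ≤ γ) (hηγ : 2 * η ≤ γ ^ 2) :
    CutLe (fun v u => adjK G v u - dn G R v u) (γ * (Fintype.card V : ℝ) ^ 2) := by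
  intro s f hs hf
  have hcorr := sum_corr_le G hη hQ hR
  set n : ℝ := (Fintype.card V : ℝ) with hn
  have hn0 : 0 ≤ n := by positivity
  refine abs_le_of_sq_le_sq ?_ (by positivity)
  have hswap : ∑ v, ∑ u, s v * f u * (adjK G v u - dn G R v u) =
      ∑ u, f u * ∑ v, s v * (adjK G v u - dn G R v u) := by
    rw [Finset.sum_comm]
    refine Finset.sum_congr rfl (fun u _ => ?_)
    rw [Finset.mul_sum]
    exact Finset.sum_congr rfl (fun v _ => by ring)
  rw [hswap]
  refine (Finset.sum_mul_sq_le_sq_mul_sq _ _ _).trans ?_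
  have h1 : ∑ u, f u ^ 2 ≤ n := by
    refine (Finset.sum_le_sum (fun u _ => (sq_le_one_iff_abs_le_one _).2 (hf u))).trans ?_
    simp [hn]
  have h2 : ∑ u, (∑ v, s v * (adjK G v u - dn G R v u)) ^ 2 ≤ 2 * η * n ^ 3 := by
    refine le_trans ?_ hcorr
    have : ∑ u, (∑ v, s v * (adjK G v u - dn G R v u)) ^ 2 =
        ∑ v, ∑ v', s v * s v' * ∑ u, (adjK G v u - dn G R v u) * (adjK G v' u - dn G R v' u) := by
      have hsq : ∀ u, (∑ v, s v * (adjK G v u - dn G R v u)) ^ 2 =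
          ∑ v, ∑ v', s v * (adjK G v u - dn G R v u) * (s v' * (adjK G v' u - dn G R v' u)) :=
        fun u => by rw [sq, Finset.sum_mul_sum]
      simp only [hsq, Finset.mul_sum]
      rw [Finset.sum_comm]
      refine Finset.sum_congr rfl (fun v _ => ?_)
      rw [Finset.sum_comm]
      exact Finset.sum_congr rfl (fun v' _ => Finset.sum_congr rfl (fun u _ => by ring))
    rw [this]
    refine Finset.sum_le_sum (fun v _ => Finset.sum_le_sum (fun v' _ => ?_))
    refine (le_abs_self _).trans ?_
    rw [abs_mul]
    exact mul_le_of_le_one_left (abs_nonneg _) (abs_mul_le_one' (hs v) (hs v'))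
  have h3 : 0 ≤ ∑ u, (∑ v, s v * (adjK G v u - dn G R v u)) ^ 2 :=
    Finset.sum_nonneg (fun _ _ => sq_nonneg _)
  calc _ ≤ n * (2 * η * n ^ 3) := mul_le_mul h1 h2 h3 hn0
    _ = 2 * η * n ^ 4 := by ring
    _ ≤ γ ^ 2 * n ^ 4 := by gcongr
    _ = _ := by ring

theorem CutLe.dd {R : Finset V} {γ : ℝ} (h : CutLe (fun v u => adjK G v u - dn G R v u) γ) :
    CutLe (fun v u => adjK G v u - dd G R v u) (2 * γ) := by
  intro s f hs hf
  have h1 := h s f hs hf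
  have h2 := h (ce (lab G R) f) s (abs_ce_le_one hf) hs
  have e1 : ∑ v, ∑ u, s v * f u * (dn G R v u - _root_.dd G R v u) =
      ∑ u, ∑ v, ce (lab G R) f u * s v * (adjK G u v - dn G R u v) := by
    calc ∑ v, ∑ u, s v * f u * (dn G R v u - _root_.dd G R v u)
        = ∑ u, f u * (∑ v, s v * dn G R v u - ∑ v, s v * _root_.dd G R v u) := by
          rw [Finset.sum_comm]
          refine Finset.sum_congr rfl (fun u _ => ?_)
          rw [← Finset.sum_sub_distrib, Finset.mul_sum]
          exact Finset.sum_congr rfl (fun v _ => by ring)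
      _ = ∑ u, f u * (∑ v, s v * dn G R v u - ∑ v, ce (lab G R) s v * dn G R v u) := by
          refine Finset.sum_congr rfl (fun u _ => ?_)
          have := sum_ce_mul_comm (lab G R) s (fun w => dn G R w u)
          rw [this]
          rfl
      _ = ∑ v, (s v - ce (lab G R) s v) * ∑ u, f u * dn G R v u := by
          simp only [← Finset.sum_sub_distrib, Finset.mul_sum]
          rw [Finset.sum_comm]
          exact Finset.sum_congr rfl (fun v _ => Finset.sum_congr rfl (fun u _ => by ring))
      _ = ∑ v, (s v - ce (lab G R) s v) * ∑ u, ce (lab G R) f u * adjK G v u := by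
          refine Finset.sum_congr rfl (fun v _ => ?_)
          have := sum_ce_mul_comm (lab G R) f (adjK G v)
          rw [this]
          rfl
      _ = ∑ u, ce (lab G R) f u * (∑ v, s v * adjK G u v - ∑ v, ce (lab G R) s v * adjK G u v) := by
          simp only [← Finset.sum_sub_distrib, Finset.mul_sum]
          rw [Finset.sum_comm]
          refine Finset.sum_congr rfl (fun v _ => Finset.sum_congr rfl (fun u _ => ?_))
          rw [adjK_symm G v u]
          ring
      _ = ∑ u, ce (lab G R) f u * (∑ v, s v * adjK G u v - ∑ v, s v * dn G R u v) := by
          refine Finset.sum_congr rfl (fun u _ => ?_)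
          have := sum_ce_mul_comm (lab G R) s (adjK G u)
          rw [this]
          rfl
      _ = _ := by
          refine Finset.sum_congr rfl (fun u _ => ?_)
          rw [← Finset.sum_sub_distrib, Finset.mul_sum]
          exact Finset.sum_congr rfl (fun v _ => by ring)
  have e2 : ∑ v, ∑ u, s v * f u * (adjK G v u - _root_.dd G R v u) =
      ∑ v, ∑ u, s v * f u * (adjK G v u - dn G R v u) +
      ∑ v, ∑ u, s v * f u * (dn G R v u - _root_.dd G R v u) := by
    rw [← Finset.sum_add_distrib]
    refine Finset.sum_congr rfl (fun v _ => ?_)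
    rw [← Finset.sum_add_distrib]
    exact Finset.sum_congr rfl (fun u _ => by ring)
  rw [e2, e1]
  refine (abs_add_le _ _).trans ?_
  linarith

end Energy

/-! ### The grey bipartition -/

theorem card_markov {V : Type*} {B : Finset V} {f : V → ℝ} (hf : ∀ v ∈ B, 0 ≤ f v) {κ n : ℝ}
    (hκ : 0 < κ) (hn : 0 < n) (h : ∑ v ∈ B, f v ≤ κ ^ 2 * n ^ 2) :
    ((B.filter (fun v => κ * n < f v)).card : ℝ) ≤ κ * n := by
  have h1 : ((B.filter (fun v => κ * n < f v)).card : ℝ) * (κ * n) ≤ ∑ v ∈ B, f v := by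
    calc ((B.filter (fun v => κ * n < f v)).card : ℝ) * (κ * n)
        = ∑ v ∈ B.filter (fun v => κ * n < f v), κ * n := by rw [Finset.sum_const, nsmul_eq_mul]
      _ ≤ ∑ v ∈ B.filter (fun v => κ * n < f v), f v :=
          Finset.sum_le_sum (fun v hv => (Finset.mem_filter.1 hv).2.le)
      _ ≤ _ := Finset.sum_le_sum_of_subset_of_nonneg (Finset.filter_subset _ _)
          (fun v hv _ => hf v hv)
  have hκn : 0 < κ * n := mul_pos hκ hn
  refine le_of_mul_le_mul_right (h1.trans (h.trans (le_of_eq ?_))) hκn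
  ring

section GreySplit

variable {V : Type*} [Fintype V]

/-- The indicator of a relation. -/
def ind (g : V → V → Prop) (x y : V) : ℝ := if g x y then 1 else 0

theorem ind_nonneg (g : V → V → Prop) (x y : V) : 0 ≤ ind g x y := by
  unfold ind; split_ifs <;> norm_num

theorem ind_le_one (g : V → V → Prop) (x y : V) : ind g x y ≤ 1 := by
  unfold ind; split_ifs <;> norm_num

theorem sum_le_card_of_le_one {S : Finset V} {f : V → ℝ} (hf : ∀ x, f x ≤ 1) :
    ∑ x ∈ S, f x ≤ S.card :=
  (Finset.sum_le_sum (fun x _ => hf x)).trans (by simp)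

set_option maxHeartbeats 1000000 in
theorem grey_split {g gr : V → V → Prop} {M : Finset V → Prop} {R : Finset V}
    {n c ρ τ κ κ' : ℝ} (hn : n = Fintype.card V) (hn0 : 0 < n)
    (hMc : ∀ A, M A → M Aᶜ) (hMg : ∀ v, M (Finset.univ.filter (fun x => g v x)))
    (hT : ∀ v, ∑ x, ∑ y, ind g v x * ind g v y * ind gr x y ≤ τ * n ^ 2)
    (hstar : ∀ B, M B → ∀ x, ∑ v ∈ B, ind g v x ≤ ∑ v ∈ B, (ρ + ind gr v x))
    (hbig : ∀ v ∉ R, (1 / 2 - c) * n ≤ ∑ x, ind g v x)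
    (hc : 0 ≤ c) (hρ : 0 ≤ ρ) (hR : (R.card : ℝ) ≤ κ * n) (hκ : 0 < κ) (hκ1 : κ ≤ 1 / 16)
    (hcκ : c ≤ κ) (h1 : ρ + τ ≤ κ ^ 2) (hκ' : κ ≤ κ')
    (h2 : ρ + τ + 2 * (2 * c + κ) ≤ κ' ^ 2) (h3 : τ + ρ + (2 * c + κ) + 2 * κ ≤ κ' ^ 2) :
    ∃ A, M A ∧ (A.card : ℝ) ≤ (1 / 2 + c + κ) * n ∧ ((Aᶜ).card : ℝ) ≤ (1 / 2 + c + κ) * n ∧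
      (∀ v, ∑ x ∈ A, ind g v x ≤ κ' * n ∨ ∑ x ∈ Aᶜ, ind g v x ≤ κ' * n) ∧
      ((A.filter (fun v => κ' * n < ∑ x ∈ A, ind g v x)).card : ℝ) ≤ κ' * n ∧
      ((Aᶜ.filter (fun v => κ' * n < ∑ x ∈ Aᶜ, ind g v x)).card : ℝ) ≤ κ' * n := by
  have hcard : ∀ S : Finset V, (S.card : ℝ) ≤ n := fun S => by
    rw [hn]; exact_mod_cast Finset.card_le_univ S
  have hi0 := ind_nonneg (V := V)
  have hi1 := ind_le_one (V := V)
  have hκn : 0 < κ * n := mul_pos hκ hn0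
  have hTS : ∀ v (S S' : Finset V),
      ∑ x ∈ S, ∑ y ∈ S', ind g v x * ind g v y * ind gr x y ≤ τ * n ^ 2 := by
    intro v S S'
    refine le_trans ?_ (hT v)
    have hpos : ∀ x y, 0 ≤ ind g v x * ind g v y * ind gr x y := fun x y =>
      mul_nonneg (mul_nonneg (hi0 _ _ _) (hi0 _ _ _)) (hi0 _ _ _)
    refine (Finset.sum_le_sum (fun x _ => Finset.sum_le_sum_of_subset_of_nonneg
      (Finset.subset_univ S') (fun y _ _ => hpos x y))).trans ?_
    exact Finset.sum_le_sum_of_subset_of_nonneg (Finset.subset_univ S)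
      (fun x _ _ => Finset.sum_nonneg (fun y _ => hpos x y))
  have hin : ∀ S, M S → ∀ S' : Finset V, ∑ v ∈ S, ∑ x ∈ S', ind g v x ≤
      ρ * n ^ 2 + ∑ v ∈ S, ∑ x ∈ S', ind gr v x := by
    intro S hS S'
    rw [Finset.sum_comm, Finset.sum_comm (s := S) (t := S') (f := fun v x => ind gr v x)]
    refine (Finset.sum_le_sum (fun x _ => hstar S hS x)).trans ?_
    simp only [Finset.sum_add_distrib, Finset.sum_const, nsmul_eq_mul]
    have : (S'.card : ℝ) * (S.card * ρ) ≤ n * (n * ρ) := by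
      gcongr
      · exact hcard _
      · exact hcard _
    linarith
  obtain ⟨v0, hv0⟩ : ∃ v, v ∉ R := by
    by_contra! hcon
    have : R = Finset.univ := Finset.eq_univ_iff_forall.2 hcon
    rw [this, Finset.card_univ, ← hn] at hR
    nlinarith
  set B := Finset.univ.filter (fun x => g v0 x) with hB
  have hgB : ∀ x ∈ B, ind g v0 x = 1 := by
    intro x hx
    simp [ind, (Finset.mem_filter.1 hx).2]
  have hBcard : (B.card : ℝ) = ∑ x, ind g v0 x := by
    simp [hB, ind, Finset.sum_boole]
  have hBlow := hbig v0 hv0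
  rw [← hBcard] at hBlow
  have hAB : ((Bᶜ).card : ℝ) = n - B.card := by
    rw [Finset.card_compl, Nat.cast_sub (Finset.card_le_univ B), hn]
  have hBB : ∑ v ∈ B, ∑ x ∈ B, ind gr v x ≤ τ * n ^ 2 := by
    refine le_trans (le_of_eq ?_) (hTS v0 B B)
    refine Finset.sum_congr rfl (fun x hx => Finset.sum_congr rfl (fun y hy => ?_))
    rw [hgB x hx, hgB y hy]
    ring
  have hsumB : ∑ v ∈ B, ∑ x ∈ B, ind g v x ≤ κ ^ 2 * n ^ 2 := by
    have e1 := hin B (hMg v0) B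
    have e2 := mul_le_mul_of_nonneg_right h1 (sq_nonneg n)
    linarith
  have hbadB := card_markov (fun v _ => Finset.sum_nonneg (fun x _ => hi0 g v x)) hκ hn0 hsumB
  set Bb := B.filter (fun v => κ * n < ∑ x ∈ B, ind g v x) with hBb
  have hsplit : ∀ v, ∑ x ∈ Bᶜ, ind g v x + ∑ x ∈ B, ind g v x = ∑ x, ind g v x := fun v =>
    Finset.sum_compl_add_sum B _
  have hgood : ∀ v ∈ B, v ∉ Bb → v ∉ R → (1 / 2 - c - κ) * n ≤ ∑ x ∈ Bᶜ, ind g v x := by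
    intro v hv hvb hvR
    have e1 := hbig v hvR
    have e2 : ∑ x ∈ B, ind g v x ≤ κ * n := by
      by_contra! hcon
      exact hvb (Finset.mem_filter.2 ⟨hv, hcon⟩)
    linarith [hsplit v]
  obtain ⟨v1, hv1B, hv1b, hv1R⟩ : ∃ v ∈ B, v ∉ Bb ∧ v ∉ R := by
    by_contra! hcon
    have hsub : B ⊆ Bb ∪ R := by
      intro v hv
      by_cases h : v ∈ Bb
      · exact Finset.mem_union_left _ h
      · exact Finset.mem_union_right _ (hcon v hv h)
    have hle : (B.card : ℝ) ≤ Bb.card + R.card := by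
      exact_mod_cast (Finset.card_le_card hsub).trans (Finset.card_union_le _ _)
    nlinarith
  have hv1 := hgood v1 hv1B hv1b hv1R
  have hAlow : (1 / 2 - c - κ) * n ≤ (Bᶜ).card :=
    hv1.trans (sum_le_card_of_le_one (fun x => hi1 g v1 x))
  have hAup : ((Bᶜ).card : ℝ) ≤ (1 / 2 + c) * n := by rw [hAB]; linarith
  have hAA : ∑ v ∈ Bᶜ, ∑ x ∈ Bᶜ, ind gr v x ≤ (τ + 2 * (2 * c + κ)) * n ^ 2 := by
    have hpt : ∀ x y, ind gr x y ≤ ind g v1 x * ind g v1 y * ind gr x y +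
        (1 - ind g v1 x) + (1 - ind g v1 y) := by
      intro x y
      have a1 := hi0 g v1 x; have a2 := hi1 g v1 x; have a3 := hi0 g v1 y
      have a4 := hi1 g v1 y; have a5 := hi0 gr x y; have a6 := hi1 gr x y
      unfold ind at *
      split_ifs at * <;> norm_num
    refine (Finset.sum_le_sum (fun x _ => Finset.sum_le_sum (fun y _ => hpt x y))).trans ?_
    simp only [Finset.sum_add_distrib, Finset.sum_const, nsmul_eq_mul, Finset.sum_sub_distrib,
      mul_one, ← Finset.mul_sum]
    have e1 := hTS v1 Bᶜ Bᶜ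
    have e2 : ((Bᶜ).card : ℝ) - ∑ x ∈ Bᶜ, ind g v1 x ≤ (2 * c + κ) * n := by linarith
    have e3 : 0 ≤ ((Bᶜ).card : ℝ) - ∑ x ∈ Bᶜ, ind g v1 x :=
      sub_nonneg.2 (sum_le_card_of_le_one (fun x => hi1 g v1 x))
    have e4 : ((Bᶜ).card : ℝ) * (((Bᶜ).card : ℝ) - ∑ x ∈ Bᶜ, ind g v1 x) ≤
        n * ((2 * c + κ) * n) := mul_le_mul (hcard _) e2 e3 hn0.le
    linarith
  have hsumA : ∑ v ∈ Bᶜ, ∑ x ∈ Bᶜ, ind g v x ≤ κ' ^ 2 * n ^ 2 := by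
    have e1 := hin Bᶜ (hMc _ (hMg v0)) Bᶜ
    have e2 := mul_le_mul_of_nonneg_right h2 (sq_nonneg n)
    linarith
  have hκ'0 : 0 < κ' := hκ.trans_le hκ'
  have hbadA := card_markov (fun v _ => Finset.sum_nonneg (fun x _ => hi0 g v x)) hκ'0 hn0 hsumA
  have hsumB' : ∑ v ∈ B, ∑ x ∈ B, ind g v x ≤ κ' ^ 2 * n ^ 2 :=
    hsumB.trans (by gcongr)
  have hbadB' := card_markov (fun v _ => Finset.sum_nonneg (fun x _ => hi0 g v x)) hκ'0 hn0 hsumB'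
  have hnon : ∑ v ∈ B, ∑ x ∈ Bᶜ, (1 - ind gr v x) ≤ (ρ + (2 * c + κ) + 2 * κ) * n ^ 2 := by
    have e1 := hin B (hMg v0) Bᶜ
    have e2 : ∀ v ∈ B, ((Bᶜ).card : ℝ) - ∑ x ∈ Bᶜ, ind g v x ≤
        (2 * c + κ) * n + (if v ∈ Bb ∪ R then n else 0) := by
      intro v hv
      by_cases h : v ∈ Bb ∪ R
      · rw [if_pos h]
        have := Finset.sum_nonneg (fun x (_ : x ∈ Bᶜ) => hi0 g v x)
        have := hcard Bᶜ
        have : 0 ≤ (2 * c + κ) * n := by positivity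
        linarith
      · rw [if_neg h]
        rw [Finset.mem_union, not_or] at h
        have := hgood v hv h.1 h.2
        linarith
    have e3 := Finset.sum_le_sum e2
    rw [Finset.sum_sub_distrib, Finset.sum_add_distrib] at e3
    have e4 : ∑ v ∈ B, (if v ∈ Bb ∪ R then n else 0) ≤ 2 * κ * n * n := by
      calc ∑ v ∈ B, (if v ∈ Bb ∪ R then n else 0) ≤ ∑ v, (if v ∈ Bb ∪ R then n else 0) :=
            Finset.sum_le_sum_of_subset_of_nonneg (Finset.subset_univ _)
              (fun v _ _ => by split_ifs <;> linarith)
        _ = (Bb ∪ R).card * n := by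
            rw [Finset.sum_ite_mem, Finset.univ_inter, Finset.sum_const, nsmul_eq_mul]
        _ ≤ (Bb.card + R.card) * n := by
            gcongr
            exact_mod_cast Finset.card_union_le _ _
        _ ≤ 2 * κ * n * n := by
            gcongr
            linarith
    simp only [Finset.sum_sub_distrib, Finset.sum_const, nsmul_eq_mul, mul_one] at e3 ⊢
    have e5 : (B.card : ℝ) * ((2 * c + κ) * n) ≤ n * ((2 * c + κ) * n) :=
      mul_le_mul_of_nonneg_right (hcard B) (by positivity)
    linarith
  refine ⟨Bᶜ, hMc _ (hMg v0), by nlinarith, ?_, ?_, hbadA, ?_⟩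
  · rw [compl_compl]
    linarith
  · intro v
    rw [compl_compl]
    by_contra! hcon
    have hprod : (∑ x ∈ B, ind g v x) * (∑ y ∈ Bᶜ, ind g v y) ≤ κ' ^ 2 * n ^ 2 := by
      rw [Finset.sum_mul_sum]
      have hpt : ∀ x y, ind g v x * ind g v y ≤ ind g v x * ind g v y * ind gr x y +
          (1 - ind gr x y) := by
        intro x y
        unfold ind
        split_ifs <;> norm_num
      refine (Finset.sum_le_sum (fun x _ => Finset.sum_le_sum (fun y _ => hpt x y))).trans ?_
      simp only [Finset.sum_add_distrib]
      have e1 := hTS v B Bᶜ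
      have e2 := mul_le_mul_of_nonneg_right h3 (sq_nonneg n)
      linarith
    have hκn' : 0 < κ' * n := mul_pos hκ'0 hn0
    have := mul_lt_mul'' hcon.2 hcon.1 hκn'.le hκn'.le
    linarith
  · rw [compl_compl]
    exact hbadB'

end GreySplit

/-! ### The structure theorem for graphs without poor vertices -/

theorem ce_tail {V ι : Type*} [Fintype V] {π : V → ι} (f : V → ℝ) {a : ℝ} (ha : 0 ≤ a)
    (ha2 : a ≤ 1 / 2) {B : Finset V} (hB : ∀ x y, π x = π y → (x ∈ B ↔ y ∈ B)) :
    ∑ x ∈ B, ((if ce π f x < a then f x else 0) + (if 1 - a < ce π f x then 1 - f x else 0)) ≤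
      a * B.card := by
  let h1 : V → ℝ := fun x => if x ∈ B ∧ ce π f x < a then 1 else 0
  let h2 : V → ℝ := fun x => if x ∈ B ∧ 1 - a < ce π f x then 1 else 0
  have m1 : ∀ x y, π x = π y → h1 x = h1 y := fun x y h => by simp only [h1, ce_const f h, hB x y h]
  have m2 : ∀ x y, π x = π y → h2 x = h2 y := fun x y h => by simp only [h2, ce_const f h, hB x y h]
  have e : ∀ F : V → ℝ, ∑ x ∈ B, ((if ce π f x < a then F x else 0) +
      (if 1 - a < ce π f x then 1 - F x else 0)) =
      ∑ x, F x * h1 x + ∑ x, h2 x - ∑ x, F x * h2 x := by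
    intro F
    rw [← Finset.sum_add_distrib, ← Finset.sum_sub_distrib, ← Finset.univ_inter B,
      ← Finset.sum_ite_mem]
    refine Finset.sum_congr rfl (fun x _ => ?_)
    simp only [h1, h2]
    by_cases hx : x ∈ B <;> simp only [hx, true_and, false_and, if_true, if_false]
    · split_ifs <;> ring
    · ring
  rw [e f, ← sum_ce_mul f m1, ← sum_ce_mul f m2, ← e (ce π f)]
  calc _ ≤ ∑ x ∈ B, a := Finset.sum_le_sum (fun x _ => by split_ifs <;> linarith)
    _ = _ := by rw [Finset.sum_const, nsmul_eq_mul]; ring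

theorem meas_iff_lab {V : Type*} {G : SimpleGraph V} {R : Finset V} {P : V → Prop} :
    Meas G R P ↔ ∀ x y, lab G R x = lab G R y → (P x ↔ P y) := by
  have h : ∀ x y, lab G R x = lab G R y ↔ ∀ r ∈ R, (G.Adj r x ↔ G.Adj r y) := by
    intro x y
    constructor
    · intro h r hr
      simpa [lab, hr] using congrFun h r
    · intro h
      funext r
      by_cases hr : r ∈ R
      · simp [lab, hr, h r hr]
      · simp [lab, hr]
  unfold Meas
  simp only [h]

section Structure

variable {V : Type*} [Fintype V] {G : SimpleGraph V}

theorem tame_of_grey {R S : Finset V} (hS : Meas G R (· ∈ S)) (v : V) {δ : ℝ} (hδ : 0 ≤ δ)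
    (hδ2 : δ ≤ 1 / 2) {s : ℝ}
    (hs : ∑ x ∈ S, ind (fun v x => Grey δ (dn G R v x)) v x + δ * Fintype.card V ≤ s) :
    Tame G R v S s := by
  refine ⟨fun x => 1 / 2 < dn G R v x,
    meas_iff_lab.2 (fun x y h => by rw [dn_const v h]), le_trans ?_ hs⟩
  have h1 := ce_tail (adjK G v) hδ hδ2 (meas_iff_lab.1 hS)
  have h2 : δ * S.card ≤ δ * Fintype.card V := by
    gcongr
    exact Finset.card_le_univ S
  rw [Finset.card_filter]
  push_cast
  refine le_trans ?_ (add_le_add_right (h1.trans h2) _)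
  rw [← Finset.sum_add_distrib]
  refine Finset.sum_le_sum (fun x _ => ?_)
  change (if ¬ (G.Adj v x ↔ 1 / 2 < dn G R v x) then (1 : ℝ) else 0) ≤
    (if Grey δ (dn G R v x) then 1 else 0) + ((if dn G R v x < δ then adjK G v x else 0) +
      (if 1 - δ < dn G R v x then 1 - adjK G v x else 0))
  have hd0 := dn_nonneg G R v x
  unfold adjK Grey
  by_cases ha : G.Adj v x <;> simp only [ha, true_iff, false_iff, not_not, if_true, if_false] <;>
    by_cases h1 : dn G R v x < δ <;> by_cases h2 : 1 - δ < dn G R v x <;>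
    simp only [h1, h2, if_true, if_false] <;> split_ifs with a b <;> first
      | linarith
      | exact absurd ⟨not_lt.1 h1, not_lt.1 h2⟩ ‹¬ (_ ∧ _)›

theorem ind_grey_le {R B : Finset V} (hB : Meas G R (· ∈ B)) (x : V) {δ ρ : ℝ} (hδ : 0 < δ)
    (hρ : 0 ≤ ρ) (hρδ : ρ * δ ≤ 1 / 2) :
    ∑ v ∈ B, ind (fun v x => Grey δ (dn G R v x)) v x ≤
      ∑ v ∈ B, (ρ + ind (fun v x => Grey (ρ * δ) (dd G R v x)) v x) := by
  have h1 := ce_tail (fun v => dn G R v x) (by positivity : 0 ≤ ρ * δ) hρδ (meas_iff_lab.1 hB)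
  have h2 : ∀ v, δ * ind (fun v x => Grey δ (dn G R v x)) v x ≤
      δ * ind (fun v x => Grey (ρ * δ) (dd G R v x)) v x +
      ((if dd G R v x < ρ * δ then dn G R v x else 0) +
        (if 1 - ρ * δ < dd G R v x then 1 - dn G R v x else 0)) := by
    intro v
    have hd0 := dn_nonneg G R v x
    have hd1 := dn_le_one G R v x
    unfold ind Grey
    split_ifs with a b c d e <;> first | nlinarith [a.1, a.2] | linarith | nlinarith | skip
    all_goals
      exfalso
      apply b
      constructor <;> linarith
  have h3 := Finset.sum_le_sum (fun v (_ : v ∈ B) => h2 v)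
  rw [Finset.sum_add_distrib, ← Finset.mul_sum, ← Finset.mul_sum] at h3
  rw [Finset.sum_add_distrib, Finset.sum_const, nsmul_eq_mul]
  have h4 := h3.trans (add_le_add_right h1 _)
  refine le_of_mul_le_mul_left ?_ hδ
  linarith

variable (G) in
/-- No vertex is tame on noticeably more than half of the vertices. -/
def NonPoor (J : ℕ) (θ c : ℝ) : Prop :=
  ∀ (v : V) (R X : Finset V), v ∉ R → R.card ≤ J → Meas G R (· ∈ X) →
    (1 / 2 + c) * Fintype.card V ≤ X.card → ¬ Tame G R v X (θ * Fintype.card V)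

variable (G) in
/-- The sets `A` and `Aᶜ` are halves of `G` on which all vertices are essentially tame. -/
structure Halves (J : ℕ) (σ : ℝ) (R A : Finset V) : Prop where
  card_le : R.card ≤ J
  meas : Meas G R (· ∈ A)
  card_left : (A.card : ℝ) ≤ (1 / 2 + σ) * Fintype.card V
  card_right : ((Aᶜ).card : ℝ) ≤ (1 / 2 + σ) * Fintype.card V
  tame : ∀ v, Tame G R v A (σ * Fintype.card V) ∨ Tame G R v Aᶜ (σ * Fintype.card V)
  bad_left : ((A.filter (fun v => ¬ Tame G R v A (σ * Fintype.card V))).card : ℝ) ≤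
    σ * Fintype.card V
  bad_right : ((Aᶜ.filter (fun v => ¬ Tame G R v Aᶜ (σ * Fintype.card V))).card : ℝ) ≤
    σ * Fintype.card V

theorem exists_cutLe {γ : ℝ} (hγ : 0 < γ) : ∃ K n₀ : ℕ, ∀ (V : Type) [Fintype V]
    (G : SimpleGraph V) (Q : Finset V), n₀ ≤ Fintype.card V → Q.card ≤ 3 →
    ∃ R : Finset V, Disjoint R Q ∧ R.card ≤ K ∧
      CutLe (fun v u => adjK G v u - dd G R v u) (2 * (γ * (Fintype.card V : ℝ) ^ 2)) := by
  set η := γ ^ 2 / 2 with hη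
  have hη0 : 0 < η := by positivity
  refine ⟨⌈1 / η ^ 2⌉₊, ⌈3 / η⌉₊ + 1, fun V _ G Q hn hQ => ?_⟩
  have : Nonempty V := Fintype.card_pos_iff.1 (by omega)
  obtain ⟨R, h1, h2, h3⟩ := exists_energy_stable G (by positivity : 0 < η ^ 2) Q
  refine ⟨R, h1, h2, CutLe.dd G (cutLe_dn G hη0.le ?_ h3 hγ.le (by rw [hη]; linarith))⟩
  have e1 : 3 / η ≤ (⌈3 / η⌉₊ : ℝ) := Nat.le_ceil _
  have e2 : ((⌈3 / η⌉₊ + 1 : ℕ) : ℝ) ≤ Fintype.card V := by exact_mod_cast hn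
  have e3 : (Q.card : ℝ) ≤ 3 := by exact_mod_cast hQ
  push_cast at e2
  rw [div_le_iff₀ hη0] at e1
  nlinarith

theorem C5Free.adjK_pattern (hG : C5Free G) (v a b c e : V) :
    adjK G v a * (1 - adjK G v b) * (1 - adjK G v c) * adjK G v e *
      pathWeight (adjK G) a b c e = 0 := by
  have := hG v a b c e
  by_contra hne
  apply this
  unfold pathWeight at hne
  simp only [mul_eq_zero, not_or] at hne
  obtain ⟨⟨⟨⟨h1, h2⟩, h3⟩, h4⟩, ⟨⟨⟨⟨h5, h6⟩, h7⟩, h8⟩, h9⟩, h10⟩ := hne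
  have p : ∀ {x y}, adjK G x y ≠ 0 → G.Adj x y := by
    intro x y h
    by_contra hcon
    exact h (by simp [adjK, hcon])
  have q : ∀ {x y}, 1 - adjK G x y ≠ 0 → ¬ G.Adj x y := by
    intro x y h hcon
    exact h (by simp [adjK, hcon])
  exact ⟨p h1, p h5, p h6, p h7, (p h4).symm, q h2, q h3, q h8, q h9, q h10⟩

end Structure

theorem exists_halves {σ : ℝ} (hσ : 0 < σ) : ∃ c : ℝ, 0 < c ∧ ∀ θ : ℝ, 0 < θ → ∃ J n₀ : ℕ,
    ∀ (V : Type) [Fintype V] (G : SimpleGraph V) (Q : Finset V), n₀ ≤ Fintype.card V →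
      C5Free G → NonPoor G J θ c → Q.card ≤ 3 →
      ∃ R A : Finset V, Disjoint R Q ∧ Halves G J σ R A := by
  set ν := min (σ / 4) (1 / 16) with hν
  have hν0 : 0 < ν := lt_min (by positivity) (by norm_num)
  have hνσ : 4 * ν ≤ σ := by have := min_le_left (σ / 4) (1 / 16); linarith
  have hν1 : ν ≤ 1 / 16 := min_le_right _ _
  have hν2 : ν ^ 2 ≤ ν / 16 := by nlinarith
  have hν4 : ν ^ 4 ≤ ν ^ 2 / 16 := by nlinarith [sq_nonneg ν]
  set c := ν ^ 4 / 2 with hc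
  have hc0 : 0 < c := by positivity
  refine ⟨c, hc0, fun θ hθ => ?_⟩
  set δ := min θ ν with hδ
  have hδ0 : 0 < δ := lt_min hθ hν0
  have hδν : δ ≤ ν := min_le_right _ _
  have hδθ : δ ≤ θ := min_le_left _ _
  set γ := c ^ 4 * (δ ^ 4 * (c * δ) ^ 4) / 48 with hγ
  have hγ0 : 0 < γ := by positivity
  obtain ⟨K, n₀, hK⟩ := exists_cutLe hγ0
  refine ⟨K, max n₀ (⌈K / ν ^ 2⌉₊ + 1), fun V _ G Q hn hG hNP hQ => ?_⟩
  obtain ⟨R, hRQ, hRK, hcut⟩ := hK V G Q (le_trans (le_max_left _ _) hn) hQ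
  have hn1 := le_trans (le_max_right _ _) hn
  set n : ℝ := (Fintype.card V : ℝ) with hnn
  have hn0 : 0 < n := by
    have : 0 < Fintype.card V := by omega
    rw [hnn]
    exact_mod_cast this
  have hKn : (K : ℝ) ≤ ν ^ 2 * n := by
    have e1 : K / ν ^ 2 ≤ (⌈K / ν ^ 2⌉₊ : ℝ) := Nat.le_ceil _
    have e2 : ((⌈K / ν ^ 2⌉₊ + 1 : ℕ) : ℝ) ≤ n := by rw [hnn]; exact_mod_cast hn1
    push_cast at e2
    rw [div_le_iff₀ (by positivity)] at e1
    nlinarith [sq_nonneg ν]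
  have hcδ : c * δ ≤ 1 / 2 := by nlinarith
  have hδ2 : δ ≤ 1 / 2 := by linarith
  have hTall : ∀ v, ∑ x, ∑ y, ind (fun v x => Grey δ (dn G R v x)) v x *
      ind (fun v x => Grey δ (dn G R v x)) v y *
      ind (fun v x => Grey (c * δ) (dd G R v x)) x y ≤ c * n ^ 2 := by
    intro v
    have h1 := grey_sparse hcut (adjK_nonneg G) (adjK_le_one G) (dd_nonneg G R) (dd_le_one G R)
      (dd_symm G R) (fun x y z h => dd_const z h) v (hG.adjK_pattern v) hδ0.le
      (by positivity : 0 ≤ c * δ) (d := dn G R v) rfl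
    have h2 : ∑ x, ∑ y, ind (fun v x => Grey δ (dn G R v x)) v x *
        ind (fun v x => Grey δ (dn G R v x)) v y *
        ind (fun v x => Grey (c * δ) (dd G R v x)) x y =
        ∑ x, ∑ y, if Grey δ (dn G R v x) ∧ Grey δ (dn G R v y) ∧ Grey (c * δ) (dd G R x y)
          then (1 : ℝ) else 0 := by
      refine Finset.sum_congr rfl (fun x _ => Finset.sum_congr rfl (fun y _ => ?_))
      unfold ind
      by_cases a1 : Grey δ (dn G R v x) <;> by_cases a2 : Grey δ (dn G R v y) <;>
        by_cases a3 : Grey (c * δ) (dd G R x y) <;> simp [a1, a2, a3]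
    rw [h2]
    have hpos : 0 < δ ^ 4 * (c * δ) ^ 4 := by positivity
    refine le_of_pow_le_pow_left₀ (n := 4) (by norm_num) (by positivity) ?_
    refine le_of_mul_le_mul_right (h1.trans (le_of_eq ?_)) hpos
    rw [← hnn, hγ]
    ring
  obtain ⟨A, hA, hA1, hA2, hA3, hA4, hA5⟩ := grey_split (V := V)
    (g := fun v x => Grey δ (dn G R v x)) (gr := fun v x => Grey (c * δ) (dd G R v x))
    (M := fun B => Meas G R (· ∈ B)) (R := R) (n := n) (c := c) (ρ := c) (τ := c)
    (κ := ν ^ 2) (κ' := 3 * ν) hnn hn0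
    (fun A hA x y h => by simpa using not_congr (hA x y h))
    (fun v => meas_iff_lab.2 (fun x y h => by simp [dn_const v h]))
    hTall (fun B hB x => ind_grey_le hB x hδ0 hc0.le hcδ)
    (by
      intro v hv
      by_contra! hcon
      set X := Finset.univ.filter (fun x => ¬ Grey δ (dn G R v x)) with hX
      have hXm : Meas G R (· ∈ X) := meas_iff_lab.2 (fun x y h => by simp [hX, dn_const v h])
      refine hNP v R X hv hRK hXm ?_ (tame_of_grey hXm v hδ0.le hδ2 ?_)
      · have e1 : (X.card : ℝ) = n - ∑ x, ind (fun v x => Grey δ (dn G R v x)) v x := by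
          have := Finset.card_filter_add_card_filter_not (s := Finset.univ)
            (fun x => Grey δ (dn G R v x))
          have e2 : ((Finset.univ.filter (fun x => Grey δ (dn G R v x))).card : ℝ) =
              ∑ x, ind (fun v x => Grey δ (dn G R v x)) v x := by
            simp [ind, Finset.sum_boole]
          rw [← e2, hnn, ← Finset.card_univ, ← this]
          push_cast
          ring
        rw [e1]
        linarith
      · have e1 : ∑ x ∈ X, ind (fun v x => Grey δ (dn G R v x)) v x = 0 :=
          Finset.sum_eq_zero (fun x hx => by simp [ind, (Finset.mem_filter.1 hx).2])
        rw [e1, zero_add]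
        gcongr)
    hc0.le hc0.le (le_trans (by exact_mod_cast hRK) hKn) (by positivity) (by linarith)
    (by linarith) (by rw [hc]; linarith [pow_mul ν 2 2]) (by linarith)
    (by nlinarith) (by nlinarith)
  have hsz : (1 / 2 + c + ν ^ 2) * n ≤ (1 / 2 + σ) * n := by
    refine mul_le_mul_of_nonneg_right ?_ hn0.le
    linarith
  have hν' : 3 * ν * n ≤ σ * n := mul_le_mul_of_nonneg_right (by linarith) hn0.le
  have hAc : Meas G R (· ∈ Aᶜ) := fun x y h => by simpa using not_congr (hA x y h)
  have hmt : ∀ S, Meas G R (· ∈ S) → ∀ v,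
      ∑ x ∈ S, ind (fun v x => Grey δ (dn G R v x)) v x ≤ 3 * ν * n → Tame G R v S (σ * n) := by
    intro S hS v h
    refine tame_of_grey hS v hδ0.le hδ2 ?_
    have : δ * n ≤ ν * n := mul_le_mul_of_nonneg_right hδν hn0.le
    have : 4 * ν * n ≤ σ * n := mul_le_mul_of_nonneg_right hνσ hn0.le
    rw [← hnn]
    linarith
  have hbad : ∀ S : Finset V, Meas G R (· ∈ S) →
      ((S.filter (fun v => 3 * ν * n < ∑ x ∈ S, ind (fun v x => Grey δ (dn G R v x)) v x)).card : ℝ)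
        ≤ 3 * ν * n → ((S.filter (fun v => ¬ Tame G R v S (σ * n))).card : ℝ) ≤ σ * n := by
    intro S hS h
    refine le_trans (Nat.cast_le.2 (Finset.card_le_card ?_)) (h.trans hν')
    intro v hv
    rw [Finset.mem_filter] at hv ⊢
    refine ⟨hv.1, ?_⟩
    by_contra! hcon
    exact hv.2 (hmt S hS v hcon)
  exact ⟨R, A, hRQ, hRK, hA, hA1.trans hsz, hA2.trans hsz,
    fun v => (hA3 v).imp (hmt A hA v) (hmt Aᶜ hAc v), hbad A hA hA4, hbad Aᶜ hAc hA5⟩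

/-! ### A global labelling of the vertices -/

theorem Meas.mono {V : Type*} {G : SimpleGraph V} {R R' : Finset V} (h : R ⊆ R') {P : V → Prop}
    (hP : Meas G R P) : Meas G R' P :=
  fun x y hxy => hP x y (fun r hr => hxy r (h hr))

theorem Meas.compl {V : Type*} [Fintype V] {G : SimpleGraph V} {R A : Finset V}
    (h : Meas G R (· ∈ A)) : Meas G R (· ∈ Aᶜ) :=
  fun x y hxy => by simpa using not_congr (h x y hxy)

theorem Meas.union {V : Type*} [Fintype V] {G : SimpleGraph V} {R R' A A' : Finset V}
    (h : Meas G R (· ∈ A)) (h' : Meas G R' (· ∈ A')) : Meas G (R ∪ R') (· ∈ A ∪ A') := by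
  intro x y hxy
  have h1 := h x y (fun r hr => hxy r (Finset.mem_union_left _ hr))
  have h2 := h' x y (fun r hr => hxy r (Finset.mem_union_right _ hr))
  simp only [Finset.mem_union]
  exact or_congr h1 h2

theorem Tame.mono {V : Type*} {G : SimpleGraph V} {R A : Finset V} {v : V} {s s' : ℝ}
    (h : Tame G R v A s) (hs : s ≤ s') : Tame G R v A s' := by
  obtain ⟨Y, h1, h2⟩ := h
  exact ⟨Y, h1, h2.trans hs⟩

theorem Tame.union {V : Type*} [Fintype V] {G : SimpleGraph V} {R R' A A' : Finset V} {v : V}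
    {s s' : ℝ} (h : Tame G R v A s) (h' : Tame G R' v A' s') (hA : Meas G R (· ∈ A)) :
    Tame G (R ∪ R') v (A ∪ A') (s + s') := by
  obtain ⟨Y, h1, h2⟩ := h
  obtain ⟨Y', h1', h2'⟩ := h'
  refine ⟨fun x => (x ∈ A ∧ Y x) ∨ (x ∉ A ∧ Y' x), ?_, ?_⟩
  · intro x y hxy
    have e1 := hA x y (fun r hr => hxy r (Finset.mem_union_left _ hr))
    have e2 := h1 x y (fun r hr => hxy r (Finset.mem_union_left _ hr))
    have e3 := h1' x y (fun r hr => hxy r (Finset.mem_union_right _ hr))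
    simp only at e1 ⊢
    rw [e1, e2, e3]
  · have hsub : (A ∪ A').filter (fun x => ¬ (G.Adj v x ↔ (x ∈ A ∧ Y x) ∨ (x ∉ A ∧ Y' x))) ⊆
        A.filter (fun x => ¬ (G.Adj v x ↔ Y x)) ∪ A'.filter (fun x => ¬ (G.Adj v x ↔ Y' x)) := by
      intro x hx
      simp only [Finset.mem_filter, Finset.mem_union] at hx ⊢
      by_cases hxA : x ∈ A
      · simp only [hxA, true_and, not_true, false_and, or_false] at hx ⊢
        tauto
      · simp only [hxA, false_and, false_or, not_false_iff, true_and] at hx ⊢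
        tauto
    have h3 := (Finset.card_le_card hsub).trans (Finset.card_union_le _ _)
    have h4 : ((((A ∪ A').filter (fun x => ¬ (G.Adj v x ↔ (x ∈ A ∧ Y x) ∨ (x ∉ A ∧ Y' x)))).card
        : ℕ) : ℝ) ≤ (A.filter (fun x => ¬ (G.Adj v x ↔ Y x))).card +
        (A'.filter (fun x => ¬ (G.Adj v x ↔ Y' x))).card := by exact_mod_cast h3
    refine (le_of_eq ?_).trans (h4.trans (add_le_add h2 h2'))
    congr!

theorem NonPoor.mono {V : Type*} [Fintype V] {G : SimpleGraph V} {J J' : ℕ} {θ c : ℝ}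
    (hJ : J ≤ J') (h : NonPoor G J' θ c) : NonPoor G J θ c :=
  fun v R X hv hR => h v R X hv (hR.trans hJ)

theorem Halves.symm {V : Type*} [Fintype V] {G : SimpleGraph V} {J : ℕ} {σ : ℝ} {R A : Finset V}
    (h : Halves G J σ R A) : Halves G J σ R Aᶜ :=
  ⟨h.card_le, h.meas.compl, h.card_right, by rw [compl_compl]; exact h.card_left,
    fun v => by rw [compl_compl]; exact (h.tame v).symm, h.bad_right,
    by rw [compl_compl]; exact h.bad_left⟩

section Align

variable {V : Type*} [Fintype V] {G : SimpleGraph V} {J : ℕ} {σ c : ℝ}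

theorem NonPoor.card_union_lt (hNP : NonPoor G (2 * J) (2 * σ) c) {R R' A A' : Finset V} {v : V}
    (hv : v ∉ R) (hv' : v ∉ R') (hR : R.card ≤ J) (hR' : R'.card ≤ J)
    (hA : Meas G R (· ∈ A)) (hA' : Meas G R' (· ∈ A'))
    (h : Tame G R v A (σ * Fintype.card V)) (h' : Tame G R' v A' (σ * Fintype.card V)) :
    ((A ∪ A').card : ℝ) < (1 / 2 + c) * Fintype.card V := by
  by_contra! hcon
  refine hNP v (R ∪ R') (A ∪ A') (by simp [hv, hv']) ?_ (hA.union hA') hcon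
    ((h.union h' hA).mono (by linarith))
  have := Finset.card_union_le R R'
  omega

theorem card_sdiff_real (A B : Finset V) :
    ((A \ B).card : ℝ) = (A ∪ B).card - B.card := by
  have h1 := Finset.card_sdiff_add_card A B
  have h2 : (((A \ B).card + B.card : ℕ) : ℝ) = (A ∪ B).card := by rw [h1]
  push_cast at h2
  linarith

theorem card_compl_real (A : Finset V) : ((Aᶜ).card : ℝ) = Fintype.card V - A.card := by
  have h2 : ((A.card + (Aᶜ).card : ℕ) : ℝ) = Fintype.card V := by
    rw [Finset.card_add_card_compl]
  push_cast at h2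
  linarith

theorem Halves.align (hNP : NonPoor G (2 * J) (2 * σ) c) {R A R' A' : Finset V}
    (h : Halves G J σ R A) (h' : Halves G J σ R' A') (hJ : 2 * J ≤ σ * Fintype.card V)
    (hc : 0 ≤ c) (hσ : 0 ≤ σ) :
    (((A \ A').card : ℝ) ≤ (c + 5 * σ) * Fintype.card V ∧
      ((A' \ A).card : ℝ) ≤ (c + 5 * σ) * Fintype.card V) ∨
    (((A \ A'ᶜ).card : ℝ) ≤ (c + 5 * σ) * Fintype.card V ∧
      ((A'ᶜ \ A).card : ℝ) ≤ (c + 5 * σ) * Fintype.card V) := by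
  have hn : (0 : ℝ) ≤ Fintype.card V := Nat.cast_nonneg _
  have hσn : 0 ≤ σ * Fintype.card V := by positivity
  have hcn : 0 ≤ c * Fintype.card V := by positivity
  have hr := h.card_right
  have hr' := h'.card_right
  rw [card_compl_real] at hr hr'
  by_cases hv : ∃ v ∈ A ∩ A', v ∉ R ∧ v ∉ R' ∧ Tame G R v A (σ * Fintype.card V) ∧
      Tame G R' v A' (σ * Fintype.card V)
  · obtain ⟨v, -, h1, h2, h3, h4⟩ := hv
    have h5 := hNP.card_union_lt h1 h2 h.card_le h'.card_le h.meas h'.meas h3 h4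
    left
    rw [card_sdiff_real, card_sdiff_real, Finset.union_comm A' A]
    constructor <;> nlinarith
  · push Not at hv
    right
    have hsub : A ∩ A' ⊆ (R ∪ R') ∪
        (A.filter (fun v => ¬ Tame G R v A (σ * Fintype.card V)) ∪
        A'.filter (fun v => ¬ Tame G R' v A' (σ * Fintype.card V))) := by
      intro v hvA
      have := hv v hvA
      simp only [Finset.mem_union, Finset.mem_filter]
      rw [Finset.mem_inter] at hvA
      tauto
    have h1 : (((A ∩ A').card : ℕ) : ℝ) ≤ (R.card + R'.card) +
        ((A.filter (fun v => ¬ Tame G R v A (σ * Fintype.card V))).card +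
        (A'.filter (fun v => ¬ Tame G R' v A' (σ * Fintype.card V))).card) := by
      have a1 := (Finset.card_le_card hsub).trans (Finset.card_union_le _ _)
      have a2 := Finset.card_union_le R R'
      have a3 := Finset.card_union_le (A.filter (fun v => ¬ Tame G R v A (σ * Fintype.card V)))
        (A'.filter (fun v => ¬ Tame G R' v A' (σ * Fintype.card V)))
      exact_mod_cast a1.trans (add_le_add a2 a3)
    have h2 := h.bad_left
    have h3 := h'.bad_left
    have h4 : (R.card : ℝ) ≤ J := by exact_mod_cast h.card_le
    have h5 : (R'.card : ℝ) ≤ J := by exact_mod_cast h'.card_le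
    have h6 : ((A ∩ A').card : ℝ) ≤ 3 * (σ * Fintype.card V) := by linarith
    have h7 : A \ A'ᶜ = A ∩ A' := by ext; simp
    have h8 : A'ᶜ \ A = (A ∪ A')ᶜ := by ext; simp [and_comm]
    have h9 : ((A ∪ A').card : ℝ) + (A ∩ A').card = A.card + A'.card := by
      exact_mod_cast Finset.card_union_add_card_inter A A'
    rw [h7, h8, card_compl_real]
    constructor <;> nlinarith

end Align

/-- `S` is, up to a small error, one of the halves of every pair of halves. -/
def Labelled {V : Type*} [Fintype V] (G : SimpleGraph V) (J : ℕ) (ε : ℝ) (S : Finset V) : Prop :=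
  ∀ Q : Finset V, Q.card ≤ 3 → ∃ R A : Finset V, Disjoint R Q ∧ R.card ≤ J ∧ Meas G R (· ∈ A) ∧
    (A.card : ℝ) ≤ (1 / 2 + ε) * Fintype.card V ∧ ((Aᶜ).card : ℝ) ≤ (1 / 2 + ε) * Fintype.card V ∧
    ((A \ S).card : ℝ) ≤ ε * Fintype.card V ∧ ((S \ A).card : ℝ) ≤ ε * Fintype.card V ∧
    ∀ q ∈ Q, (q ∈ S → Tame G R q A (ε * Fintype.card V)) ∧
      (q ∉ S → Tame G R q Aᶜ (ε * Fintype.card V))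

theorem Labelled.symm {V : Type*} [Fintype V] {G : SimpleGraph V} {J : ℕ} {ε : ℝ} {S : Finset V}
    (h : Labelled G J ε S) : Labelled G J ε Sᶜ := by
  intro Q hQ
  obtain ⟨R, A, h1, h2, h3, h4, h5, h6, h7, h8⟩ := h Q hQ
  refine ⟨R, Aᶜ, h1, h2, h3.compl, h5, by rw [compl_compl]; exact h4, ?_, ?_, fun q hq => ?_⟩
  · rwa [show Aᶜ \ Sᶜ = S \ A by ext; simp [and_comm]]
  · rwa [show Sᶜ \ Aᶜ = A \ S by ext; simp [and_comm]]
  · have := h8 q hq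
    rw [compl_compl]
    simp only [Finset.mem_compl, not_not]
    exact this.symm

theorem exists_labelled_of_halves {V : Type*} [Fintype V] {G : SimpleGraph V} {J : ℕ} {σ c : ℝ}
    (hNP : NonPoor G (2 * J) (2 * σ) c) (hJ : 2 * J ≤ σ * Fintype.card V)
    (hc : 0 ≤ c) (hσ : 0 ≤ σ) (hcσ : 3 * c + 10 * σ ≤ 1 / 2)
    (hV : 0 < Fintype.card V)
    (h : ∀ Q : Finset V, Q.card ≤ 3 → ∃ R A : Finset V, Disjoint R Q ∧ Halves G J σ R A) :
    ∃ S, Labelled G J (c + 7 * σ) S := by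
  have hn : (0 : ℝ) < Fintype.card V := by exact_mod_cast hV
  set n : ℝ := (Fintype.card V : ℝ) with hnn
  have hσn : 0 ≤ σ * n := by positivity
  have hcn : 0 ≤ c * n := by positivity
  have hcσn : 3 * (c * n) + 10 * (σ * n) ≤ 1 / 2 * n := by nlinarith
  obtain ⟨R₀, A₀, -, h₀⟩ := h ∅ (by simp)
  have hal : ∀ Q : Finset V, Q.card ≤ 3 → ∃ R A : Finset V, Disjoint R Q ∧ Halves G J σ R A ∧
      ((A₀ \ A).card : ℝ) ≤ (c + 5 * σ) * n ∧ ((A \ A₀).card : ℝ) ≤ (c + 5 * σ) * n := by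
    intro Q hQ
    obtain ⟨R, A, h1, h2⟩ := h Q hQ
    rcases h₀.align hNP h2 hJ hc hσ with h3 | h3
    · exact ⟨R, A, h1, h2, h3⟩
    · exact ⟨R, Aᶜ, h1, h2.symm, h3⟩
  -- two tame sides of the same vertex cannot be opposite
  have hopp : ∀ {v : V} {R A R' A' : Finset V}, v ∉ R → v ∉ R' → Halves G J σ R A →
      Halves G J σ R' A' → ((A \ A').card : ℝ) ≤ 2 * (c + 5 * σ) * n →
      Tame G R' v A' (σ * n) → ¬ Tame G R v Aᶜ (σ * n) := by
    intro v R A R' A' hv hv' hA hA' hAA ht' ht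
    have h1 := hNP.card_union_lt hv hv' hA.card_le hA'.card_le hA.symm.meas hA'.meas ht ht'
    have h2 : Aᶜ ∪ A' = (A \ A')ᶜ := by ext; simp; tauto
    rw [h2, card_compl_real, ← hnn] at h1
    linarith
  have htri : ∀ {A A' B : Finset V} {a b : ℝ}, ((A \ B).card : ℝ) ≤ a → ((B \ A').card : ℝ) ≤ b →
      ((A \ A').card : ℝ) ≤ a + b := by
    intro A A' B a b h1 h2
    have h3 : A \ A' ⊆ (A \ B) ∪ (B \ A') := by
      intro x
      simp only [Finset.mem_union, Finset.mem_sdiff]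
      tauto
    have h4 : ((A \ A').card : ℝ) ≤ (A \ B).card + (B \ A').card := by
      exact_mod_cast (Finset.card_le_card h3).trans (Finset.card_union_le _ _)
    linarith
  have hcompl : ∀ A A' : Finset V, Aᶜ \ A'ᶜ = A' \ A := fun A A' => by ext; simp [and_comm]
  choose R A hRQ hH hd1 hd2 using hal
  have h1 : ∀ v : V, ({v} : Finset V).card ≤ 3 := fun v => by simp
  let S : Finset V := Finset.univ.filter (fun v => Tame G (R {v} (h1 v)) v (A {v} (h1 v)) (σ * n))
  have hvR : ∀ v, v ∉ R {v} (h1 v) := fun v => Finset.disjoint_singleton_right.1 (hRQ _ (h1 v))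
  have hS : ∀ v, v ∈ S → Tame G (R {v} (h1 v)) v (A {v} (h1 v)) (σ * n) :=
    fun v hv => (Finset.mem_filter.1 hv).2
  have hS' : ∀ v, v ∉ S → Tame G (R {v} (h1 v)) v (A {v} (h1 v))ᶜ (σ * n) := by
    intro v hv
    have : ¬ Tame G (R {v} (h1 v)) v (A {v} (h1 v)) (σ * n) := by simpa [S] using hv
    exact ((hH _ (h1 v)).tame v).resolve_left this
  have hbad1 : ((A₀ \ S).card : ℝ) ≤ 2 * (σ * n) := by
    have hsub : A₀ \ S ⊆ R₀ ∪ A₀.filter (fun v => ¬ Tame G R₀ v A₀ (σ * n)) := by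
      intro v hv
      rw [Finset.mem_sdiff] at hv
      simp only [Finset.mem_union, Finset.mem_filter]
      by_contra hcon
      push Not at hcon
      exact hopp (hvR v) hcon.1 (hH _ (h1 v)) h₀ ((hd2 _ _).trans (by nlinarith)) (hcon.2 hv.1)
        (hS' v hv.2)
    have h2 : ((A₀ \ S).card : ℝ) ≤ R₀.card +
        (A₀.filter (fun v => ¬ Tame G R₀ v A₀ (σ * n))).card := by
      exact_mod_cast (Finset.card_le_card hsub).trans (Finset.card_union_le _ _)
    have h3 := h₀.bad_left
    have h4 : (R₀.card : ℝ) ≤ J := by exact_mod_cast h₀.card_le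
    linarith [(Nat.cast_nonneg J : (0:ℝ) ≤ J)]
  have hbad2 : ((S \ A₀).card : ℝ) ≤ 2 * (σ * n) := by
    have hsub : S \ A₀ ⊆ R₀ ∪ A₀ᶜ.filter (fun v => ¬ Tame G R₀ v A₀ᶜ (σ * n)) := by
      intro v hv
      rw [Finset.mem_sdiff] at hv
      simp only [Finset.mem_union, Finset.mem_filter]
      by_contra hcon
      push Not at hcon
      refine hopp (hvR v) hcon.1 (hH _ (h1 v)).symm h₀.symm ?_
        (hcon.2 (Finset.mem_compl.2 hv.2)) (by rw [compl_compl]; exact hS v hv.1)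
      rw [hcompl]
      exact (hd1 _ _).trans (by nlinarith)
    have h2 : ((S \ A₀).card : ℝ) ≤ R₀.card +
        (A₀ᶜ.filter (fun v => ¬ Tame G R₀ v A₀ᶜ (σ * n))).card := by
      exact_mod_cast (Finset.card_le_card hsub).trans (Finset.card_union_le _ _)
    have h3 := h₀.bad_right
    have h4 : (R₀.card : ℝ) ≤ J := by exact_mod_cast h₀.card_le
    linarith [(Nat.cast_nonneg J : (0:ℝ) ≤ J)]
  refine ⟨S, fun Q hQ => ⟨R Q hQ, A Q hQ, hRQ Q hQ, (hH Q hQ).card_le, (hH Q hQ).meas,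
    (hH Q hQ).card_left.trans ?_, (hH Q hQ).card_right.trans ?_,
    (htri (hd2 Q hQ) hbad1).trans ?_, (htri hbad2 (hd1 Q hQ)).trans ?_,
    fun q hq => ⟨fun hqS => ?_, fun hqS => ?_⟩⟩⟩
  · rw [← hnn]; nlinarith
  · rw [← hnn]; nlinarith
  · rw [← hnn]; nlinarith
  · rw [← hnn]; nlinarith
  · have hqR : q ∉ R Q hQ := fun hqR => Finset.disjoint_left.1 (hRQ Q hQ) hqR hq
    refine (((hH Q hQ).tame q).resolve_right ?_).mono (by rw [← hnn]; nlinarith)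
    refine hopp hqR (hvR q) (hH Q hQ) (hH _ (h1 q)) ?_ (hS q hqS)
    exact (htri (hd2 _ _) (hd1 _ _)).trans (by linarith)
  · have hqR : q ∉ R Q hQ := fun hqR => Finset.disjoint_left.1 (hRQ Q hQ) hqR hq
    refine (((hH Q hQ).tame q).resolve_left ?_).mono (by rw [← hnn]; nlinarith)
    have h2 := hopp hqR (hvR q) (hH Q hQ).symm (hH _ (h1 q)).symm ?_ (hS' q hqS)
    · rwa [compl_compl] at h2
    · rw [hcompl]
      exact (htri (hd2 _ _) (hd1 _ _)).trans (by linarith)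

theorem SmallSub.anti {β θ θ' : ℝ} (h : SmallSub β θ) (hθ : θ' ≤ θ) : SmallSub β θ' := by
  intro V _ N hN
  refine le_trans (Nat.cast_le.2 (Finset.card_le_card fun S hS => ?_)) (h V N hN)
  rw [mem_csep] at hS ⊢
  have : (0 : ℝ) ≤ N := le_trans (Nat.cast_nonneg _) hN
  exact hS.trans (mul_le_mul_of_nonneg_right hθ this)

theorem Labelled.mono {V : Type*} [Fintype V] {G : SimpleGraph V} {J J' : ℕ} {ε ε' : ℝ}
    {S : Finset V} (h : Labelled G J ε S) (hJ : J ≤ J') (hε : ε ≤ ε') : Labelled G J' ε' S := by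
  have hn : (0 : ℝ) ≤ Fintype.card V := Nat.cast_nonneg _
  have h1 : ε * Fintype.card V ≤ ε' * Fintype.card V := mul_le_mul_of_nonneg_right hε hn
  have h2 : (1 / 2 + ε) * Fintype.card V ≤ (1 / 2 + ε') * Fintype.card V :=
    mul_le_mul_of_nonneg_right (by linarith) hn
  intro Q hQ
  obtain ⟨R, A, a1, a2, a3, a4, a5, a6, a7, a8⟩ := h Q hQ
  exact ⟨R, A, a1, a2.trans hJ, a3, a4.trans h2, a5.trans h2, a6.trans h1, a7.trans h1,
    fun q hq => ⟨fun hS => ((a8 q hq).1 hS).mono h1, fun hS => ((a8 q hq).2 hS).mono h1⟩⟩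

theorem exists_labelled {ε : ℝ} (hε : 0 < ε) : ∃ (J n₀ : ℕ) (θ₁ c₁ θ₂ c₂ : ℝ),
    0 < c₁ ∧ 0 < c₂ ∧ SmallSub (c₁ / 2) θ₁ ∧ SmallSub (c₂ / 2) θ₂ ∧
    ∀ (V : Type) [Fintype V] (G : SimpleGraph V), n₀ ≤ Fintype.card V → C5Free G →
      NonPoor G J θ₁ c₁ → NonPoor G J θ₂ c₂ → ∃ S, Labelled G J ε S := by
  set c₂ := min (ε / 2) (1 / 20) with hc₂
  have hc₂0 : 0 < c₂ := lt_min (by positivity) (by norm_num)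
  obtain ⟨θ, hθ0, hθ⟩ := small_subsets (by positivity : 0 < c₂ / 2)
  set σ := min (θ / 2) (min (ε / 14) (1 / 100)) with hσ
  have hσ0 : 0 < σ := lt_min (by positivity) (lt_min (by positivity) (by norm_num))
  have e1 : c₂ ≤ ε / 2 := min_le_left _ _
  have e2 : c₂ ≤ 1 / 20 := min_le_right _ _
  have e3 : σ ≤ θ / 2 := min_le_left _ _
  have e4 : σ ≤ ε / 14 := (min_le_right _ _).trans (min_le_left _ _)
  have e5 : σ ≤ 1 / 100 := (min_le_right _ _).trans (min_le_right _ _)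
  obtain ⟨c₁, hc₁, hH⟩ := exists_halves hσ0
  obtain ⟨θ₁, hθ₁0, hθ₁⟩ := small_subsets (by positivity : 0 < c₁ / 2)
  obtain ⟨J, n₀, hJ⟩ := hH θ₁ hθ₁0
  refine ⟨2 * J, max n₀ (⌈2 * J / σ⌉₊ + 1), θ₁, c₁, 2 * σ, c₂, hc₁, hc₂0, hθ₁,
    SmallSub.anti hθ (by linarith), fun V _ G hn hG h1 h2 => ?_⟩
  have hn1 := le_trans (le_max_right _ _) hn
  have hn2 : 2 * (J : ℝ) ≤ σ * Fintype.card V := by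
    have a1 : 2 * J / σ ≤ (⌈2 * J / σ⌉₊ : ℝ) := Nat.le_ceil _
    have a2 : ((⌈2 * J / σ⌉₊ + 1 : ℕ) : ℝ) ≤ Fintype.card V := by exact_mod_cast hn1
    push_cast at a2
    rw [div_le_iff₀ hσ0] at a1
    nlinarith
  obtain ⟨S, hS⟩ := exists_labelled_of_halves h2 hn2 hc₂0.le hσ0.le (by linarith) (by omega)
    (fun Q hQ => hJ V G Q (le_trans (le_max_left _ _) hn) hG (h1.mono (by omega)) hQ)
  exact ⟨S, hS.mono (by omega) (by linarith)⟩

/-! ### Counting lossy graphs -/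

theorem extBad_loss {W : Type} [Fintype W] (H : SimpleGraph W) {k : ℕ}
    (F : Fin k → W → Prop) (J : ℕ) (t : ℕ → ℕ) {α β θ l : ℝ} (hS : SmallSub β θ)
    (ht : ∀ᶠ n : ℕ in atTop,
      (1 - 1 / (2 : ℝ) ^ (k * Fintype.card W)) ^ t n ≤ (2 : ℝ) ^ (-(l * n)))
    (hl : k * (β + α) < l) :
    ∃ s : ℝ, 0 < s ∧ ∀ᶠ n : ℕ in atTop,
      (gcount (fun G : SimpleGraph (Fin n) => C5Free G ∧
        ∃ e, ExtBad G H F J (t n) ((1 / 2 + α) * n) (θ * n) e) : ℝ) ≤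
      (2 : ℝ) ^ ((k : ℝ) * n / 2 - s * n) * fN (n - k) := by
  set s := (l - k * (β + α)) / 2 with hs
  have hs0 : 0 < s := by rw [hs]; linarith
  refine ⟨s, hs0, ?_⟩
  filter_upwards [ht, exp_linear_absorb (2 ^ (k * k) * 2 ^ (2 ^ J * (k + 1))) (k + J) hs0]
    with n h1 h2
  refine (extBad_count H F J (t n) hS (Fintype.card_fin n)).trans ?_
  have e1 : ((n : ℝ)) ^ k ≤ ((n : ℝ) + 1) ^ k := by gcongr; linarith
  have e2 : ((2 : ℝ) ^ (β * n)) ^ k * ((2 : ℝ) ^ (k * ((1 / 2 + α) * n)) * 2 ^ (-(l * n))) =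
      2 ^ ((k : ℝ) * n / 2 - s * n) * 2 ^ (-(s * n)) := by
    rw [← Real.rpow_natCast, ← Real.rpow_mul (by norm_num), ← Real.rpow_add (by norm_num),
      ← Real.rpow_add (by norm_num), ← Real.rpow_add (by norm_num)]
    congr 1
    rw [hs]
    ring
  have e3 : (2 : ℝ) ^ (s * n) * 2 ^ (-(s * n)) = 1 := by
    rw [← Real.rpow_add (by norm_num)]; simp
  calc _ ≤ ((n : ℝ) + 1) ^ k * (fN (n - k) * 2 ^ (k * k) *
        (((n : ℝ) + 1) ^ J * 2 ^ (2 ^ J * (k + 1)) *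
        (((2 : ℝ) ^ (β * n)) ^ k * ((2 : ℝ) ^ (k * ((1 / 2 + α) * n)) * 2 ^ (-(l * n)))))) := by
        have : (0 : ℝ) ≤ 1 - 1 / 2 ^ (k * Fintype.card W) := by
          rw [sub_nonneg, div_le_one (by positivity)]
          exact one_le_pow₀ (by norm_num)
        gcongr
    _ = (2 ^ (k * k) * 2 ^ (2 ^ J * (k + 1)) * ((n : ℝ) + 1) ^ (k + J)) *
        (2 ^ ((k : ℝ) * n / 2 - s * n) * 2 ^ (-(s * n)) * fN (n - k)) := by
        rw [e2]; ring
    _ ≤ 2 ^ (s * n) * (2 ^ ((k : ℝ) * n / 2 - s * n) * 2 ^ (-(s * n)) * fN (n - k)) := by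
        gcongr
    _ = (2 ^ (s * n) * 2 ^ (-(s * n))) * (2 ^ ((k : ℝ) * n / 2 - s * n) * fN (n - k)) := by ring
    _ = _ := by rw [e3, one_mul]

/-- The cycle of length five. -/
def fiveCycle : SimpleGraph (Fin 5) where
  Adj i j := i = j + 1 ∨ j = i + 1
  symm := ⟨fun _ _ h => h.symm⟩
  loopless := ⟨fun i h => by revert h; fin_cases i <;> decide⟩

theorem C5Free.not_fiveCycle {V : Type*} {G : SimpleGraph V} (hG : C5Free G)
    (q : fiveCycle ↪g G) : False := by
  have h : ∀ i j, G.Adj (q i) (q j) ↔ (i = j + 1 ∨ j = i + 1) := fun i j => q.map_rel_iff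
  apply hG (q 0) (q 1) (q 2) (q 3) (q 4)
  simp only [h]
  decide

theorem poor_loss (J : ℕ) {θ c : ℝ} (hc : 0 < c) (hS : SmallSub (c / 2) θ) :
    ∃ s : ℝ, 0 < s ∧ ∀ᶠ n : ℕ in atTop,
      (gcount (fun G : SimpleGraph (Fin n) => C5Free G ∧ ¬ NonPoor G J θ c) : ℝ) ≤
      (2 : ℝ) ^ (((1 : ℕ) : ℝ) * n / 2 - s * n) * fN (n - 1) := by
  obtain ⟨s, hs, h⟩ := extBad_loss (k := 1) fiveCycle (fun _ _ => True) J (fun _ => 0)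
    (α := -c) (l := 0) hS (by simp) (by push_cast; linarith)
  refine ⟨s, hs, h.mono fun n hn => le_trans (Nat.cast_le.2 (gcount_mono ?_)) hn⟩
  rintro G ⟨hG, hP⟩
  refine ⟨hG, ?_⟩
  unfold NonPoor at hP
  push Not at hP
  obtain ⟨v, R, X, hv, hR, hX, hcard, ht⟩ := hP
  rw [Fintype.card_fin] at hcard ht
  refine ⟨⟨fun _ => v, fun _ _ _ => Subsingleton.elim _ _⟩, R, X, fun _ => hv, hR, hX, ?_,
    fun _ => ht, ⟨fun i => i.elim0, fun i => i.elim0, fun i => i.elim0⟩,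
    fun q => (hG.not_fiveCycle q).elim⟩
  rw [card_compl_real, Fintype.card_fin]
  linarith

/-! ### The induced paths on three vertices -/

/-- The path on three vertices. -/
def path3 : SimpleGraph (Fin 3) where
  Adj i j := (i = 1 ∧ j ≠ 1) ∨ (j = 1 ∧ i ≠ 1)
  symm := ⟨fun _ _ h => h.symm⟩
  loopless := ⟨fun i h => by tauto⟩

theorem exists_path3 {V : Type*} {G : SimpleGraph V} {x y z : V} (hxy : G.Adj x y)
    (hyz : G.Adj y z) (hne : x ≠ z) (hxz : ¬ G.Adj x z) :
    ∃ e : path3 ↪g G, ∀ i, e i = x ∨ e i = y ∨ e i = z := by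
  have h1 := hxy.ne
  have h2 := hyz.ne
  have hzx : ¬ G.Adj z x := fun h => hxz h.symm
  refine ⟨⟨⟨![x, y, z], ?_⟩, ?_⟩, ?_⟩
  · intro i j
    fin_cases i <;> fin_cases j <;> simp [h1, h2, hne, h1.symm, h2.symm, hne.symm]
  · intro i j
    change G.Adj (![x, y, z] i) (![x, y, z] j) ↔ _
    fin_cases i <;> fin_cases j <;> simp [path3, hxy, hyz, hxy.symm, hyz.symm, hxz, hzx]
  · intro i
    fin_cases i
    · exact Or.inl rfl
    · exact Or.inr (Or.inl rfl)
    · exact Or.inr (Or.inr rfl)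

theorem adj_of_path3_free {V : Type*} {G : SimpleGraph V} {S : Finset V}
    (h : ∀ e : path3 ↪g G, ¬ ∀ i, e i ∈ S) {x y z : V} (hx : x ∈ S) (hy : y ∈ S) (hz : z ∈ S)
    (hxy : G.Adj x y) (hyz : G.Adj y z) (hne : x ≠ z) : G.Adj x z := by
  by_contra hxz
  obtain ⟨e, he⟩ := exists_path3 hxy hyz hne hxz
  refine h e (fun i => ?_)
  rcases he i with h | h | h <;> rw [h] <;> assumption

theorem exists_edge {V : Type*} {G : SimpleGraph V} {x y : V} (hxy : G.Adj x y) :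
    ∃ e : (⊤ : SimpleGraph (Fin 2)) ↪g G, ∀ i, e i = x ∨ e i = y := by
  refine ⟨⟨⟨![x, y], ?_⟩, ?_⟩, ?_⟩
  · intro i j
    fin_cases i <;> fin_cases j <;> simp [hxy.ne, hxy.ne.symm]
  · intro i j
    change G.Adj (![x, y] i) (![x, y] j) ↔ _
    fin_cases i <;> fin_cases j <;> simp [hxy, hxy.symm]
  · intro i
    fin_cases i
    · exact Or.inl rfl
    · exact Or.inr rfl

/-- How a path and an edge form a cycle of length five. -/
def cross (i : Fin 3) (w : Fin 2) : Prop := (i = 0 ∧ w = 0) ∨ (i = 2 ∧ w = 1)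

theorem C5Free.not_cross {V : Type*} {G : SimpleGraph V} (hG : C5Free G) (e : path3 ↪g G)
    (q : (⊤ : SimpleGraph (Fin 2)) ↪g G) : ¬ ∀ i w, (G.Adj (e i) (q w) ↔ cross i w) := by
  intro h
  have h1 : ∀ i j, G.Adj (e i) (e j) ↔ path3.Adj i j := fun i j => e.map_rel_iff
  have h2 : ∀ i j, G.Adj (q i) (q j) ↔ i ≠ j := fun i j => q.map_rel_iff
  refine hG (e 1) (e 2) (q 1) (q 0) (e 0) ⟨(h1 _ _).2 ?_, (h _ _).2 ?_, (h2 _ _).2 ?_,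
    ((h _ _).2 ?_).symm, (h1 _ _).2 ?_, mt (h _ _).1 ?_, mt (h _ _).1 ?_, mt (h _ _).1 ?_,
    mt (h1 _ _).1 ?_, fun hc => mt (h _ _).1 ?_ hc.symm⟩ <;> simp [path3, cross]

theorem C5Free.not_cross_compl {V : Type*} {G : SimpleGraph V} (hG : C5Free G)
    (e : path3ᶜ ↪g G) (q : (⊤ : SimpleGraph (Fin 2))ᶜ ↪g G) :
    ¬ ∀ i w, (G.Adj (e i) (q w) ↔ ¬ cross i w) := by
  intro h
  have h1 : ∀ i j, G.Adj (e i) (e j) ↔ path3ᶜ.Adj i j := fun i j => e.map_rel_iff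
  have h2 : ∀ i j, ¬ G.Adj (q i) (q j) := fun i j hq => by simpa using q.map_rel_iff.1 hq
  have h3 : ∀ i j, e i = e j ↔ i = j := fun i j => e.injective.eq_iff
  have h4 : ∀ i j, q i = q j ↔ i = j := fun i j => q.injective.eq_iff
  have h5 : ∀ i w, cross i w → e i ≠ q w := by
    intro i w hc heq
    have a1 := h 1 w
    rw [← heq, h1] at a1
    rcases hc with ⟨rfl, rfl⟩ | ⟨rfl, rfl⟩
    · exact absurd (a1.2 (by simp [cross])) (by simp [path3])
    · exact absurd (a1.2 (by simp [cross])) (by simp [path3])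
  have h6 : ∀ i w, (Gᶜ).Adj (e i) (q w) ↔ cross i w := by
    intro i w
    rw [SimpleGraph.compl_adj, h]
    exact ⟨fun hc => not_not.1 hc.2, fun hc => ⟨h5 i w hc, not_not.2 hc⟩⟩
  have h7 : ∀ i j, (Gᶜ).Adj (e i) (e j) ↔ path3.Adj i j := by
    intro i j
    rw [SimpleGraph.compl_adj, h1, SimpleGraph.compl_adj, Ne, h3]
    exact ⟨fun hc => by_contra fun hn => hc.2 ⟨hc.1, hn⟩, fun hc => ⟨hc.ne, fun hn => hn.2 hc⟩⟩
  have h8 : ∀ i j, (Gᶜ).Adj (q i) (q j) ↔ i ≠ j := by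
    intro i j
    rw [SimpleGraph.compl_adj, Ne, h4]
    exact ⟨fun hc => hc.1, fun hc => ⟨hc, h2 i j⟩⟩
  refine hG.compl (e 1) (e 2) (q 1) (q 0) (e 0) ⟨(h7 _ _).2 ?_, (h6 _ _).2 ?_, (h8 _ _).2 ?_,
    ((h6 _ _).2 ?_).symm, (h7 _ _).2 ?_, mt (h6 _ _).1 ?_, mt (h6 _ _).1 ?_, mt (h6 _ _).1 ?_,
    mt (h7 _ _).1 ?_, fun hc => mt (h6 _ _).1 ?_ hc.symm⟩ <;> simp [path3, cross]

/-- An embedding into a complement, seen from the other side. -/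
def complEmbOf {V W : Type*} {G : SimpleGraph V} {H : SimpleGraph W} (φ : H ↪g Gᶜ) : Hᶜ ↪g G where
  toFun := φ
  inj' := φ.injective
  map_rel_iff' := by
    intro a b
    have h : Gᶜ.Adj (φ a) (φ b) ↔ H.Adj a b := φ.map_rel_iff
    change G.Adj (φ a) (φ b) ↔ Hᶜ.Adj a b
    rw [SimpleGraph.compl_adj, φ.injective.ne_iff] at h
    rw [SimpleGraph.compl_adj, ← h]
    have : G.Adj (φ a) (φ b) → a ≠ b := fun h e => h.ne (congrArg φ e)
    tauto

theorem Pack.of_compl {V W : Type*} {G : SimpleGraph V} {H : SimpleGraph W} {X : Finset V} {t : ℕ}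
    (h : Pack Gᶜ H X t) : Pack G Hᶜ X t := by
  obtain ⟨φ, h1, h2⟩ := h
  exact ⟨fun i => complEmbOf (φ i), h1, h2⟩

theorem Labelled.not_pack {V W : Type} [Fintype V] {G : SimpleGraph V} {J : ℕ} {ε : ℝ}
    {S : Finset V} (hL : Labelled G J ε S) {k : ℕ} (hk : k ≤ 3) {H₁ : SimpleGraph (Fin k)}
    {H₂ : SimpleGraph W} {F : Fin k → W → Prop} {t t₀ : ℕ} {θ : ℝ} (hε : ε ≤ θ)
    (hF : ∀ (e : H₁ ↪g G) (q : H₂ ↪g G), ¬ ∀ i w, (G.Adj (e i) (q w) ↔ F i w))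
    (hbad : ¬ ∃ e, ExtBad G H₂ F J t ((1 / 2 + ε) * Fintype.card V) (θ * Fintype.card V) e)
    (ht : (t : ℝ) + 3 + ε * Fintype.card V ≤ t₀) (e : H₁ ↪g G) (he : ∀ i, e i ∈ S) :
    ¬ Pack G H₂ Sᶜ t₀ := by
  intro hP
  set Q : Finset V := Finset.univ.map e.toEmbedding with hQ
  have hQc : Q.card ≤ 3 := by rw [hQ, Finset.card_map, Finset.card_univ, Fintype.card_fin]; exact hk
  obtain ⟨R, A, h1, h2, h3, -, h5, h6, -, h8⟩ := hL Q hQc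
  have hmem : ∀ i, e i ∈ Q := fun i => Finset.mem_map_of_mem e.toEmbedding (Finset.mem_univ i)
  apply hbad
  refine ⟨e.toEmbedding, R, A, fun i hi => Finset.disjoint_left.1 h1 hi (hmem i), h2, h3, h5,
    fun i => ((h8 _ (hmem i)).1 (he i)).mono (by gcongr), ?_, fun q => hF e q⟩
  have hZ : ((A \ S) ∪ Q).card + t ≤ t₀ := by
    have e1 : ((((A \ S) ∪ Q).card : ℕ) : ℝ) ≤ (A \ S).card + Q.card := by
      exact_mod_cast Finset.card_union_le _ _
    have e2 : (Q.card : ℝ) ≤ 3 := by exact_mod_cast hQc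
    have e3 : ((((A \ S) ∪ Q).card + t : ℕ) : ℝ) ≤ t₀ := by push_cast; linarith
    exact_mod_cast e3
  refine (hP.sdiff hZ).mono le_rfl (fun x hx => ?_)
  simp only [Finset.mem_sdiff, Finset.mem_compl, Finset.mem_union, not_or, not_and, not_not]
    at hx ⊢
  exact ⟨fun hA => hx.1 (hx.2.1 hA), hx.2.2⟩

/-- No small set extends badly, in the four ways that are relevant for five-cycles. -/
def NoExtBad {V : Type} [Fintype V] (G : SimpleGraph V) (J t : ℕ) (a s : ℝ) : Prop :=
  (¬ ∃ e, ExtBad G (⊤ : SimpleGraph (Fin 2)) cross J t a s e) ∧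
  (¬ ∃ e, ExtBad G path3 (fun i w => cross w i) J t a s e) ∧
  (¬ ∃ e, ExtBad G (⊤ : SimpleGraph (Fin 2))ᶜ (fun i w => ¬ cross i w) J t a s e) ∧
  (¬ ∃ e, ExtBad G path3ᶜ (fun i w => ¬ cross w i) J t a s e)

/-- An induced path in `S` excludes many edges outside, and an edge excludes many paths. -/
def Excl1 {V : Type} [Fintype V] (G : SimpleGraph V) (S : Finset V) (t : ℕ) : Prop :=
  ((∃ e : path3 ↪g G, ∀ i, e i ∈ S) → ¬ Pack G (⊤ : SimpleGraph (Fin 2)) Sᶜ t) ∧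
  ((∃ e : (⊤ : SimpleGraph (Fin 2)) ↪g G, ∀ i, e i ∈ S) → ¬ Pack G path3 Sᶜ t)

/-- The conditions of `Excl1` for a graph and its complement. -/
def Excl {V : Type} [Fintype V] (G : SimpleGraph V) (S : Finset V) (t : ℕ) : Prop :=
  Excl1 G S t ∧ Excl1 Gᶜ S t

theorem Excl.compl {V : Type} [Fintype V] {G : SimpleGraph V} {S : Finset V} {t : ℕ}
    (h : Excl G S t) : Excl Gᶜ S t := ⟨h.2, by rw [compl_compl]; exact h.1⟩

theorem Labelled.excl {V : Type} [Fintype V] {G : SimpleGraph V} (hG : C5Free G) {J : ℕ} {ε : ℝ}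
    {S : Finset V} (hL : Labelled G J ε S) {t t₀ : ℕ} {θ : ℝ} (hε : ε ≤ θ)
    (hbad : NoExtBad G J t ((1 / 2 + ε) * Fintype.card V) (θ * Fintype.card V))
    (ht : (t : ℝ) + 3 + ε * Fintype.card V ≤ t₀) : Excl G S t₀ := by
  obtain ⟨b1, b2, b3, b4⟩ := hbad
  refine ⟨⟨?_, ?_⟩, ?_, ?_⟩
  · rintro ⟨e, he⟩
    exact hL.not_pack (by norm_num) hε (fun e q => hG.not_cross e q) b1 ht e he
  · rintro ⟨e, he⟩
    refine hL.not_pack (by norm_num) hε (fun e q h => hG.not_cross q e (fun i w => ?_)) b2 ht e he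
    rw [G.adj_comm]
    exact h w i
  · rintro ⟨e, he⟩ hP
    exact hL.not_pack (by norm_num) hε (fun e q => hG.not_cross_compl e q) b3 ht (complEmbOf e) he
      hP.of_compl
  · rintro ⟨e, he⟩ hP
    refine hL.not_pack (by norm_num) hε (fun e q h => hG.not_cross_compl q e (fun i w => ?_)) b4 ht
      (complEmbOf e) he hP.of_compl
    rw [G.adj_comm]
    exact h w i

/-- `G` has no induced path in `S`, and few disjoint complements of one. -/
def P3Few {V : Type} (G : SimpleGraph V) (S : Finset V) (z : ℕ) : Prop :=
  (∀ e : path3 ↪g G, ¬ ∀ i, e i ∈ S) ∧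
  ∃ Z ⊆ S, Z.card ≤ z ∧ ∀ e : path3 ↪g Gᶜ, ¬ ∀ i, e i ∈ S \ Z

/-- One of `G` and its complement satisfies `P3Few`. -/
def Few {V : Type} (G : SimpleGraph V) (S : Finset V) (z : ℕ) : Prop :=
  P3Few G S z ∨ P3Few Gᶜ S z

/-- The vertex set splits into two parts satisfying `Few`. -/
def TwoFew {V : Type} [Fintype V] (G : SimpleGraph V) (z : ℕ) : Prop :=
  ∃ S : Finset V, Few G S z ∧ Few G Sᶜ z

theorem pack_edge_or {V : Type} [Fintype V] (G : SimpleGraph V) {S : Finset V} {t : ℕ}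
    (h : 4 * t ≤ S.card) : Pack G (⊤ : SimpleGraph (Fin 2)) S t ∨
      Pack Gᶜ (⊤ : SimpleGraph (Fin 2)) S t := by
  rcases pack_or_cover G (⊤ : SimpleGraph (Fin 2)) S t with h1 | ⟨Z, hZ, hZc, hZ'⟩
  · exact Or.inl h1
  right
  rw [Fintype.card_fin] at hZc
  have h2 : t * 2 ≤ (S \ Z).card := by
    have := Finset.le_card_sdiff Z S
    omega
  obtain ⟨T, hT, hTc⟩ := Finset.exists_subset_card_eq h2
  let f : Fin t × Fin 2 ≃ T := finProdFinEquiv.trans ((finCongr hTc.symm).trans T.equivFin.symm)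
  have hf : ∀ x, (f x : V) ∈ S \ Z := fun x => hT (f x).2
  have hinj : ∀ x y, (f x : V) = f y → x = y := fun x y h => f.injective (Subtype.ext h)
  refine ⟨fun i => ⟨⟨fun w => f (i, w), fun w w' h => ?_⟩, fun {w w'} => ?_⟩, fun i w => ?_, ?_⟩
  · simpa using hinj _ _ h
  · change (Gᶜ).Adj (f (i, w)) (f (i, w')) ↔ w ≠ w'
    rw [SimpleGraph.compl_adj]
    constructor
    · rintro ⟨hc, -⟩ rfl
      exact hc rfl
    · intro hne
      refine ⟨fun hc => hne (by simpa using hinj _ _ hc), fun hadj => ?_⟩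
      obtain ⟨e, he⟩ := exists_edge hadj
      refine hZ' e (fun j => ?_)
      rcases he j with h | h <;> rw [h] <;> exact hf _
  · exact (Finset.mem_sdiff.1 (hf (i, w))).1
  · intro i j w w' h
    exact congrArg Prod.fst (hinj _ _ h)

theorem isCoUnipolar_of_excl {V : Type} [Fintype V] {G : SimpleGraph V} {S : Finset V} {t : ℕ}
    (ht : 1 ≤ t) (h : Excl G S t) (h' : Excl G Sᶜ t) (hS : 4 * t ≤ (Sᶜ).card)
    (hP : Pack G path3 S t) : IsCoUnipolar G := by
  have h1 : ∀ e : (⊤ : SimpleGraph (Fin 2)) ↪g G, ¬ ∀ i, e i ∈ Sᶜ := by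
    intro e he
    refine h'.1.2 ⟨e, he⟩ ?_
    rwa [compl_compl]
  have h2 : Pack Gᶜ (⊤ : SimpleGraph (Fin 2)) Sᶜ t := by
    refine (pack_edge_or G hS).resolve_left ?_
    rintro ⟨φ, hφ, -⟩
    exact h1 (φ ⟨0, ht⟩) (hφ _)
  have h3 : ∀ e : path3 ↪g Gᶜ, ¬ ∀ i, e i ∈ S := fun e he => h.2.1 ⟨e, he⟩ h2
  refine isUnipolar_iff.2 ⟨(Sᶜ : Finset V), ?_, ?_⟩
  · intro x hx y hy hxy
    rw [SimpleGraph.compl_adj]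
    refine ⟨hxy, fun hadj => ?_⟩
    obtain ⟨e, he⟩ := exists_edge hadj
    refine h1 e (fun j => ?_)
    rcases he j with h | h <;> rw [h] <;> assumption
  · intro x hx y hy z hz hxy hyz hne
    have hmem : ∀ u, u ∉ ((Sᶜ : Finset V) : Set V) → u ∈ S := fun u hu => by simpa using hu
    exact adj_of_path3_free h3 (hmem x hx) (hmem y hy) (hmem z hz) hxy hyz hne

theorem few_of_excl {V : Type} [Fintype V] {G : SimpleGraph V} {S : Finset V} {t : ℕ}
    (h : Excl G S t) (hS : 4 * t ≤ (Sᶜ).card) (hP : ¬ Pack G path3 S t)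
    (hP' : ¬ Pack Gᶜ path3 S t) : Few G S (3 * t) := by
  have key : ∀ {G : SimpleGraph V}, Excl1 G S t → Pack G (⊤ : SimpleGraph (Fin 2)) Sᶜ t →
      ¬ Pack Gᶜ path3 S t → P3Few G S (3 * t) := by
    intro G hE hp hn
    refine ⟨fun e he => hE.1 ⟨e, he⟩ hp, ?_⟩
    obtain ⟨Z, h1, h2, h3⟩ := (pack_or_cover Gᶜ path3 S t).resolve_left hn
    rw [Fintype.card_fin] at h2
    exact ⟨Z, h1, by omega, h3⟩
  rcases pack_edge_or G hS with h1 | h1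
  · exact Or.inl (key h.1 h1 hP')
  · exact Or.inr (key h.2 h1 (by rwa [compl_compl]))

theorem genSplit_or_few {V : Type} [Fintype V] {G : SimpleGraph V} {S : Finset V} {t : ℕ}
    (ht : 1 ≤ t) (h : Excl G S t) (h' : Excl G Sᶜ t) (hS : 4 * t ≤ S.card)
    (hS' : 4 * t ≤ (Sᶜ).card) : IsGenSplit G ∨ (Few G S (3 * t) ∧ Few G Sᶜ (3 * t)) := by
  have hcc : (Sᶜ)ᶜ = S := compl_compl S
  have c1 : ∀ {G : SimpleGraph V}, Excl G S t → Excl G Sᶜ t → Pack G path3 S t → IsCoUnipolar G :=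
    fun h h' => isCoUnipolar_of_excl ht h h' hS'
  have c2 : ∀ {G : SimpleGraph V}, Excl G S t → Excl G Sᶜ t → Pack G path3 Sᶜ t →
      IsCoUnipolar G :=
    fun h h' => isCoUnipolar_of_excl ht h' (by rwa [hcc]) (by rwa [hcc])
  by_cases p1 : Pack G path3 S t
  · exact Or.inl (Or.inr (c1 h h' p1))
  by_cases p2 : Pack G path3 Sᶜ t
  · exact Or.inl (Or.inr (c2 h h' p2))
  by_cases p3 : Pack Gᶜ path3 S t
  · exact Or.inl (Or.inl (isCoUnipolar_compl.1 (c1 h.compl h'.compl p3)))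
  by_cases p4 : Pack Gᶜ path3 Sᶜ t
  · exact Or.inl (Or.inl (isCoUnipolar_compl.1 (c2 h.compl h'.compl p4)))
  exact Or.inr ⟨few_of_excl h hS' p1 p3, few_of_excl h' (by rwa [hcc]) p2 p4⟩

theorem Labelled.genSplit_or_few {V : Type} [Fintype V] {G : SimpleGraph V} (hG : C5Free G)
    {J : ℕ} {ε : ℝ} {S : Finset V} (hL : Labelled G J ε S) {t t₀ : ℕ} {θ : ℝ} (hε : ε ≤ θ)
    (hbad : NoExtBad G J t ((1 / 2 + ε) * Fintype.card V) (θ * Fintype.card V))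
    (ht : (t : ℝ) + 3 + ε * Fintype.card V ≤ t₀) (ht₁ : 1 ≤ t₀)
    (ht₂ : (4 * t₀ : ℝ) ≤ (1 / 2 - 2 * ε) * Fintype.card V) :
    IsGenSplit G ∨ TwoFew G (3 * t₀) := by
  have hsz : ∀ {S}, Labelled G J ε S → 4 * t₀ ≤ S.card := by
    intro S hL
    obtain ⟨R, A, -, -, -, -, h5, h6, -, -⟩ := hL ∅ (by simp)
    rw [card_compl_real] at h5
    rw [card_sdiff_real] at h6
    have h7 : (A.card : ℝ) ≤ (A ∪ S).card := by
      exact_mod_cast Finset.card_le_card Finset.subset_union_left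
    have h8 : ((4 * t₀ : ℕ) : ℝ) ≤ S.card := by push_cast; linarith
    exact_mod_cast h8
  exact (_root_.genSplit_or_few ht₁ (hL.excl hG hε hbad ht) (hL.symm.excl hG hε hbad ht)
    (hsz hL) (hsz hL.symm)).imp id fun h => ⟨S, h⟩

theorem exists_pow_le {c : ℝ} (hc0 : 0 < c) (hc1 : c < 1) : ∃ l : ℝ, 0 < l ∧
    ∀ᶠ n : ℕ in atTop, c ^ (n / 64) ≤ (2 : ℝ) ^ (-(l * n)) := by
  refine ⟨-Real.logb 2 c / 128, ?_, ?_⟩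
  · have := Real.logb_neg (b := 2) (by norm_num) hc0 hc1
    linarith
  · filter_upwards [eventually_ge_atTop 128] with n hn
    have h1 : (2 : ℝ) ^ (-(-Real.logb 2 c / 128 * n)) = c ^ ((n : ℝ) / 128) := by
      rw [show -(-Real.logb 2 c / 128 * n) = Real.logb 2 c * (n / 128) by ring,
        Real.rpow_mul (by norm_num), Real.rpow_logb (by norm_num) (by norm_num) hc0]
    rw [h1, ← Real.rpow_natCast]
    refine Real.rpow_le_rpow_of_exponent_ge hc0 hc1.le ?_
    have h2 : n ≤ 128 * (n / 64) := by omega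
    have h3 : (n : ℝ) ≤ 128 * ((n / 64 : ℕ) : ℝ) := by exact_mod_cast h2
    linarith

theorem nonSplit_le : ∃ s : ℝ, 0 < s ∧ ∀ᶠ n : ℕ in atTop,
    (gcount (fun G : SimpleGraph (Fin n) => C5Free G ∧ ¬ IsGenSplit G) : ℝ) ≤
      2 * ((2 : ℝ) ^ (((1 : ℕ) : ℝ) * n / 2 - s * n) * fN (n - 1)) +
      2 * ((2 : ℝ) ^ (((2 : ℕ) : ℝ) * n / 2 - s * n) * fN (n - 2)) +
      2 * ((2 : ℝ) ^ (((3 : ℕ) : ℝ) * n / 2 - s * n) * fN (n - 3)) +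
      gcount (fun G : SimpleGraph (Fin n) => TwoFew G (3 * (n / 32))) := by
  obtain ⟨l, hl0, hl⟩ := exists_pow_le (c := 1 - 1 / (2 : ℝ) ^ 6) (by norm_num) (by norm_num)
  obtain ⟨θ, hθ0, hθ⟩ := small_subsets (by positivity : 0 < l / 10)
  set ε := min (l / 10) (min θ (1 / 1000)) with hε
  have hε0 : 0 < ε := lt_min (by positivity) (lt_min hθ0 (by norm_num))
  have hε1 : ε ≤ l / 10 := min_le_left _ _
  have hε2 : ε ≤ θ := (min_le_right _ _).trans (min_le_left _ _)
  have hε3 : ε ≤ 1 / 1000 := (min_le_right _ _).trans (min_le_right _ _)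
  obtain ⟨J, n₀, θ₁, c₁, θ₂, c₂, hc₁, hc₂, hS₁, hS₂, hlab⟩ := exists_labelled hε0
  obtain ⟨s₁, hs₁, H₁⟩ := poor_loss J hc₁ hS₁
  obtain ⟨s₂, hs₂, H₂⟩ := poor_loss J hc₂ hS₂
  obtain ⟨s₃, hs₃, H₃⟩ := extBad_loss (⊤ : SimpleGraph (Fin 2)) cross J (fun n => n / 64)
    (α := ε) (l := l) hθ (by simpa using hl) (by push_cast; linarith)
  obtain ⟨s₄, hs₄, H₄⟩ := extBad_loss path3 (fun i w => cross w i) J (fun n => n / 64)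
    (α := ε) (l := l) hθ (by simpa using hl) (by push_cast; linarith)
  obtain ⟨s₅, hs₅, H₅⟩ := extBad_loss (⊤ : SimpleGraph (Fin 2))ᶜ (fun i w => ¬ cross i w) J
    (fun n => n / 64) (α := ε) (l := l) hθ (by simpa using hl) (by push_cast; linarith)
  obtain ⟨s₆, hs₆, H₆⟩ := extBad_loss path3ᶜ (fun i w => ¬ cross w i) J (fun n => n / 64)
    (α := ε) (l := l) hθ (by simpa using hl) (by push_cast; linarith)
  set s := min s₁ (min s₂ (min s₃ (min s₄ (min s₅ s₆)))) with hs
  have hle : s ≤ s₁ ∧ s ≤ s₂ ∧ s ≤ s₃ ∧ s ≤ s₄ ∧ s ≤ s₅ ∧ s ≤ s₆ := by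
    simp [hs]
  refine ⟨s, by simp [*], ?_⟩
  filter_upwards [H₁, H₂, H₃, H₄, H₅, H₆, eventually_ge_atTop n₀, eventually_ge_atTop 1000]
    with n h1 h2 h3 h4 h5 h6 hn hn2
  have hmono : ∀ {s' : ℝ} (k : ℕ) (m : ℕ), s ≤ s' →
      (2 : ℝ) ^ ((k : ℝ) * n / 2 - s' * n) * fN m ≤ (2 : ℝ) ^ ((k : ℝ) * n / 2 - s * n) * fN m := by
    intro s' k m hs'
    refine mul_le_mul_of_nonneg_right (Real.rpow_le_rpow_of_exponent_le (by norm_num) ?_)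
      (Nat.cast_nonneg _)
    have : s * n ≤ s' * n := mul_le_mul_of_nonneg_right hs' (Nat.cast_nonneg _)
    linarith
  have g1 := h1.trans (hmono 1 (n - 1) hle.1)
  have g2 := h2.trans (hmono 1 (n - 1) hle.2.1)
  have g3 := h3.trans (hmono 3 (n - 3) hle.2.2.1)
  have g4 := h4.trans (hmono 2 (n - 2) hle.2.2.2.1)
  have g5 := h5.trans (hmono 3 (n - 3) hle.2.2.2.2.1)
  have g6 := h6.trans (hmono 2 (n - 2) hle.2.2.2.2.2)
  have hor : ∀ {P Q : SimpleGraph (Fin n) → Prop} {a b : ℝ}, (gcount P : ℝ) ≤ a →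
      (gcount Q : ℝ) ≤ b → (gcount (fun G => P G ∨ Q G) : ℝ) ≤ a + b := by
    intro P Q a b ha hb
    have : (gcount (fun G => P G ∨ Q G) : ℝ) ≤ gcount P + gcount Q := by
      exact_mod_cast gcount_or_le P Q
    linarith
  have hall := hor g1 (hor g2 (hor g3 (hor g4 (hor g5 (hor g6 (le_refl
    (gcount (fun G : SimpleGraph (Fin n) => TwoFew G (3 * (n / 32))) : ℝ)))))))
  refine le_trans (Nat.cast_le.2 (gcount_mono ?_)) (hall.trans (by linarith))
  rintro G ⟨hG, hns⟩
  by_cases k1 : NonPoor G J θ₁ c₁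
  swap
  · exact Or.inl ⟨hG, k1⟩
  by_cases k2 : NonPoor G J θ₂ c₂
  swap
  · exact Or.inr (Or.inl ⟨hG, k2⟩)
  by_cases k3 : ∃ e, ExtBad G (⊤ : SimpleGraph (Fin 2)) cross J (n / 64) ((1 / 2 + ε) * n)
    (θ * n) e
  · exact Or.inr (Or.inr (Or.inl ⟨hG, k3⟩))
  by_cases k4 : ∃ e, ExtBad G path3 (fun i w => cross w i) J (n / 64) ((1 / 2 + ε) * n) (θ * n) e
  · exact Or.inr (Or.inr (Or.inr (Or.inl ⟨hG, k4⟩)))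
  by_cases k5 : ∃ e, ExtBad G (⊤ : SimpleGraph (Fin 2))ᶜ (fun i w => ¬ cross i w) J (n / 64)
    ((1 / 2 + ε) * n) (θ * n) e
  · exact Or.inr (Or.inr (Or.inr (Or.inr (Or.inl ⟨hG, k5⟩))))
  by_cases k6 : ∃ e, ExtBad G path3ᶜ (fun i w => ¬ cross w i) J (n / 64) ((1 / 2 + ε) * n)
    (θ * n) e
  · exact Or.inr (Or.inr (Or.inr (Or.inr (Or.inr (Or.inl ⟨hG, k6⟩)))))
  refine Or.inr (Or.inr (Or.inr (Or.inr (Or.inr (Or.inr ?_)))))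
  obtain ⟨S, hS⟩ := hlab _ G (by rwa [Fintype.card_fin]) hG k1 k2
  have hn3 : (1000 : ℝ) ≤ n := by exact_mod_cast hn2
  have d1 : ((n / 64 : ℕ) : ℝ) ≤ n / 64 := Nat.cast_div_le
  have d2 : (n : ℝ) ≤ 32 * ((n / 32 : ℕ) : ℝ) + 32 := by
    have : n ≤ 32 * (n / 32) + 32 := by omega
    exact_mod_cast this
  have d3 : ((n / 32 : ℕ) : ℝ) ≤ n / 32 := Nat.cast_div_le
  have d4 : ε * n ≤ 1 / 1000 * n := by gcongr
  refine (hS.genSplit_or_few hG hε2 (t := n / 64) (t₀ := n / 32) ?_ ?_ (by omega) ?_).resolve_left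
    hns
  · rw [Fintype.card_fin]
    exact ⟨k3, k4, k5, k6⟩
  · rw [Fintype.card_fin]
    linarith
  · rw [Fintype.card_fin]
    linarith

/-! ### Encoding cluster graphs with few large blocks -/

theorem exists_fun {V : Type} [Fintype V] (s : Setoid V) (D Z : Finset V) {q : ℕ} (hq : 1 ≤ q)
    (hD : ∀ x y, s x y → x ∉ D → x = y)
    (hQ : ∀ Q : Finset V, (∀ v ∈ Q, q < ((D \ Z).filter (fun x => s x v)).card) →
      (∀ v ∈ Q, ∀ w ∈ Q, s v w → v = w) → Q.card ≤ q) :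
    ∃ f : V → V, (∀ x y, f x = f y ↔ s x y) ∧ ∃ P T : Finset V, P.card ≤ q ∧
      q * T.card ≤ (q - 1) * D.card + q * Z.card ∧ ∀ u ∉ T, f u = u ∨ f u ∈ P := by
  have hg : ∀ c : Quotient s, ∃ v : V, (⟦v⟧ : Quotient s) = c ∧
      ((∃ x ∈ D \ Z, (⟦x⟧ : Quotient s) = c) → v ∈ D \ Z) := by
    intro c
    by_cases h : ∃ x ∈ D \ Z, (⟦x⟧ : Quotient s) = c
    · obtain ⟨x, hx, rfl⟩ := h
      exact ⟨x, rfl, fun _ => hx⟩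
    · obtain ⟨x, rfl⟩ := Quotient.exists_rep c
      exact ⟨x, rfl, fun h' => absurd h' h⟩
  choose g hg1 hg2 using hg
  set f : V → V := fun x => g ⟦x⟧ with hf
  have hfs : ∀ x, s (f x) x := fun x => Quotient.exact (hg1 ⟦x⟧)
  have hker : ∀ x y, f x = f y ↔ s x y := by
    intro x y
    constructor
    · intro h
      exact s.trans' (s.symm' (hfs x)) (h ▸ hfs y)
    · intro h
      simp only [hf]
      rw [Quotient.sound h]
  set big : V → Prop := fun v => q < ((D \ Z).filter (fun x => s x v)).card with hbig
  set P := (Finset.univ.filter big).image f with hP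
  set M := (D \ Z).filter (fun u => f u ∉ P) with hM
  set T := Finset.univ.filter (fun u => f u ≠ u ∧ f u ∉ P) with hT
  set A := M.filter (fun u => f u = u) with hA
  have hcongr : ∀ {v w}, s v w → (big v ↔ big w) := by
    intro v w h
    have : (D \ Z).filter (fun x => s x v) = (D \ Z).filter (fun x => s x w) := by
      refine Finset.filter_congr (fun x _ => ⟨fun h' => s.trans' h' h, fun h' =>
        s.trans' h' (s.symm' h)⟩)
    simp only [hbig, this]
  refine ⟨f, hker, P, T, hQ P ?_ ?_, ?_, ?_⟩
  · intro v hv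
    obtain ⟨u, hu, rfl⟩ := Finset.mem_image.1 hv
    exact (hcongr (hfs u)).2 (Finset.mem_filter.1 hu).2
  · intro v hv w hw h
    obtain ⟨u, -, rfl⟩ := Finset.mem_image.1 hv
    obtain ⟨u', -, rfl⟩ := Finset.mem_image.1 hw
    exact (hker _ _).2 (s.trans' (s.symm' (hfs u)) (s.trans' h (hfs u')))
  · have hTM : T ⊆ (M \ A) ∪ Z := by
      intro u hu
      obtain ⟨-, h1, h2⟩ := Finset.mem_filter.1 hu
      by_cases hZ : u ∈ Z
      · exact Finset.mem_union_right _ hZ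
      have hDu : u ∈ D := by
        by_contra hcon
        exact h1 (hD u (f u) (s.symm' (hfs u)) hcon).symm
      refine Finset.mem_union_left _ ?_
      simp only [Finset.mem_sdiff, hA, hM, Finset.mem_filter]
      tauto
    have hmaps : ∀ u ∈ M, f u ∈ A := by
      intro u hu
      obtain ⟨h1, h2⟩ := Finset.mem_filter.1 hu
      have h3 : f (f u) = f u := (hker _ _).2 (hfs u)
      exact Finset.mem_filter.2 ⟨Finset.mem_filter.2 ⟨hg2 _ ⟨u, h1, rfl⟩, by rwa [h3]⟩, h3⟩
    have hfib : ∀ v ∈ A, (M.filter (fun u => f u = v)).card ≤ q := by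
      intro v hv
      obtain ⟨h1, h2⟩ := Finset.mem_filter.1 hv
      obtain ⟨h3, h4⟩ := Finset.mem_filter.1 h1
      have hnb : ¬ big v := fun hb => h4 (Finset.mem_image.2 ⟨v, by simpa using hb, rfl⟩)
      refine le_trans (Finset.card_le_card ?_) (not_lt.1 hnb)
      intro u hu
      obtain ⟨h5, h6⟩ := Finset.mem_filter.1 hu
      refine Finset.mem_filter.2 ⟨(Finset.mem_filter.1 h5).1, ?_⟩
      rw [← hker, h2, h6]
    have hcard := Finset.card_le_mul_card_image_of_maps_to hmaps q hfib
    have hTc := (Finset.card_le_card hTM).trans (Finset.card_union_le _ _)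
    have hAM : A ⊆ M := Finset.filter_subset _ _
    have hMA := Finset.card_sdiff_add_card_eq_card hAM
    have hMD : M.card ≤ D.card :=
      Finset.card_le_card ((Finset.filter_subset _ _).trans Finset.sdiff_subset)
    obtain ⟨k, rfl⟩ : ∃ k, q = k + 1 := ⟨q - 1, by omega⟩
    simp only [Nat.add_sub_cancel]
    have h7 : (k + 1) * (M \ A).card ≤ k * M.card := by nlinarith
    calc (k + 1) * T.card ≤ (k + 1) * ((M \ A).card + Z.card) := Nat.mul_le_mul_left _ hTc
      _ = (k + 1) * (M \ A).card + (k + 1) * Z.card := by ring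
      _ ≤ k * D.card + (k + 1) * Z.card :=
          Nat.add_le_add_right (h7.trans (Nat.mul_le_mul_left _ hMD)) _
  · intro u hu
    by_contra hcon
    push Not at hcon
    exact hu (Finset.mem_filter.2 ⟨Finset.mem_univ _, hcon⟩)

/-- Functions which, off a set of size at most `N`, are the identity or take values in a fixed
set of size at most `K`. -/
def FewFun {V : Type} (K N : ℕ) (f : V → V) : Prop :=
  ∃ P T : Finset V, P.card ≤ K ∧ T.card ≤ N ∧ ∀ u ∉ T, f u = u ∨ f u ∈ P

theorem card_fewFun {V : Type} [Fintype V] (hV : 1 ≤ Fintype.card V) (K N : ℕ) :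
    ((csep (FewFun (V := V) K N)).card : ℝ) ≤
      4 ^ Fintype.card V * (K + 1) ^ Fintype.card V * (Fintype.card V : ℝ) ^ N := by
  have h1 : ∀ i : Finset V × Finset V, ((csep (fun f : V → V => i.1.card ≤ K ∧ i.2.card ≤ N ∧
      ∀ u ∉ i.2, f u = u ∨ f u ∈ i.1)).card : ℝ) ≤
      (K + 1) ^ Fintype.card V * (Fintype.card V : ℝ) ^ N := by
    rintro ⟨P, T⟩
    by_cases hPT : P.card ≤ K ∧ T.card ≤ N
    swap
    · have : csep (fun f : V → V => P.card ≤ K ∧ T.card ≤ N ∧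
          ∀ u ∉ T, f u = u ∨ f u ∈ P) = ∅ := by
        ext f
        simp only [mem_csep, Finset.notMem_empty, iff_false]
        tauto
      simp only [this, Finset.card_empty, Nat.cast_zero]
      positivity
    have hsub : csep (fun f : V → V => P.card ≤ K ∧ T.card ≤ N ∧ ∀ u ∉ T, f u = u ∨ f u ∈ P) ⊆
        Fintype.piFinset (fun u => if u ∈ T then Finset.univ else insert u P) := by
      intro f hf
      rw [mem_csep] at hf
      rw [Fintype.mem_piFinset]
      intro u
      by_cases hu : u ∈ T
      · simp [hu]
      · simpa [hu] using hf.2.2 u hu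
    have h2 := Finset.card_le_card hsub
    rw [Fintype.card_piFinset] at h2
    have h3 : ∏ u : V, (if u ∈ T then Finset.univ else insert u P : Finset V).card ≤
        ∏ u : V, ((K + 1) * if u ∈ T then Fintype.card V else 1) := by
      refine Finset.prod_le_prod' (fun u _ => ?_)
      by_cases hu : u ∈ T
      · simp only [hu, if_true, Finset.card_univ]
        nlinarith
      · simp only [hu, if_false, mul_one]
        exact (Finset.card_insert_le _ _).trans (by omega)
    rw [Finset.prod_mul_distrib, Finset.prod_const, Finset.card_univ, Finset.prod_ite] at h3
    simp only [Finset.prod_const, one_pow, mul_one, Finset.filter_univ_mem] at h3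
    have h4 : Fintype.card V ^ T.card ≤ Fintype.card V ^ N := Nat.pow_le_pow_right hV hPT.2
    have h5 := h2.trans (h3.trans (Nat.mul_le_mul_left _ h4))
    exact_mod_cast h5
  have h2 := card_exists_le (fun (i : Finset V × Finset V) (f : V → V) => i.1.card ≤ K ∧
    i.2.card ≤ N ∧ ∀ u ∉ i.2, f u = u ∨ f u ∈ i.1) _ h1
  have h3 : ∀ f : V → V, FewFun K N f ↔ ∃ i : Finset V × Finset V, i.1.card ≤ K ∧
      i.2.card ≤ N ∧ ∀ u ∉ i.2, f u = u ∨ f u ∈ i.1 := by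
    intro f
    simp [FewFun, Prod.exists]
  have h4 : csep (FewFun (V := V) K N) = csep (fun f => ∃ i : Finset V × Finset V, i.1.card ≤ K ∧
      i.2.card ≤ N ∧ ∀ u ∉ i.2, f u = u ∨ f u ∈ i.1) := by
    ext f
    rw [mem_csep, mem_csep, h3]
  rw [h4]
  refine h2.trans (le_of_eq ?_)
  rw [Fintype.card_prod, Fintype.card_finset, ← mul_assoc]
  push_cast
  rw [← mul_pow]
  norm_num

/-- Graphs with prescribed adjacency inside both parts of a partition are counted by their
bipartite part. -/
theorem cross_count {V : Type} [Fintype V] (S : Finset V) (R : V → V → Prop)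
    (Q : ({x // x ∈ S} × {x // x ∉ S} → Prop) → Prop) :
    gcount (fun G : SimpleGraph V => (∀ x y, (x ∈ S ↔ y ∈ S) → (G.Adj x y ↔ R x y)) ∧
      Q (fun p => G.Adj p.1 p.2)) ≤ (csep Q).card := by
  unfold gcount
  refine Finset.card_le_card_of_injOn (fun G p => G.Adj p.1 p.2) ?_ ?_
  · intro G hG
    simp only [Finset.mem_coe, mem_csep] at hG ⊢
    exact hG.2
  · intro G hG G' hG' h
    simp only [Finset.mem_coe, mem_csep] at hG hG'
    have hc : ∀ x y, x ∈ S → y ∉ S → (G.Adj x y ↔ G'.Adj x y) := by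
      intro x y hx hy
      exact iff_of_eq (congrFun h (⟨x, hx⟩, ⟨y, hy⟩))
    ext x y
    by_cases hx : x ∈ S <;> by_cases hy : y ∈ S
    · rw [hG.1 x y (by tauto), hG'.1 x y (by tauto)]
    · exact hc x y hx hy
    · rw [G.adj_comm, G'.adj_comm]
      exact hc y x hy hx
    · rw [hG.1 x y (by tauto), hG'.1 x y (by tauto)]

theorem split_count {V : Type} [Fintype V] (S : Finset V) (R : V → V → Prop) :
    (gcount (fun G : SimpleGraph V => ∀ x y, (x ∈ S ↔ y ∈ S) → (G.Adj x y ↔ R x y)) : ℝ) ≤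
      2 ^ (S.card * (Sᶜ).card) := by
  have h1 := cross_count S R (fun _ => True)
  have h2 : (csep (fun _ : {x // x ∈ S} × {x // x ∉ S} → Prop => True)).card =
      2 ^ (S.card * (Sᶜ).card) := by
    have : csep (fun _ : {x // x ∈ S} × {x // x ∉ S} → Prop => True) = Finset.univ := by
      ext; simp
    rw [this, Finset.card_univ]
    simp only [Fintype.card_fun, Fintype.card_prop, Fintype.card_prod, Fintype.card_coe]
    congr 2
    rw [Fintype.card_subtype_compl, Fintype.card_coe, Finset.card_compl]
  rw [h2] at h1
  simp only [and_true] at h1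
  exact_mod_cast h1

theorem card_mul_card_compl_le {V : Type} [Fintype V] (S : Finset V) :
    ((S.card * (Sᶜ).card : ℕ) : ℝ) ≤ (Fintype.card V : ℝ) ^ 2 / 4 := by
  push_cast
  rw [card_compl_real]
  nlinarith [sq_nonneg ((S.card : ℝ) - Fintype.card V / 2)]

theorem two_pow_card_le {V : Type} [Fintype V] (S : Finset V) :
    (2 : ℝ) ^ (S.card * (Sᶜ).card) ≤ 2 ^ ((Fintype.card V : ℝ) ^ 2 / 4) := by
  rw [← Real.rpow_natCast]
  exact Real.rpow_le_rpow_of_exponent_le (by norm_num) (card_mul_card_compl_le S)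

/-- The components of `G` inside `D`, when these are cliques; other vertices are alone. -/
def sideSetoid {V : Type} (G : SimpleGraph V) (D : Finset V)
    (h : ∀ x ∈ D, ∀ y ∈ D, ∀ z ∈ D, G.Adj x y → G.Adj y z → x ≠ z → G.Adj x z) : Setoid V where
  r x y := x = y ∨ (x ∈ D ∧ y ∈ D ∧ G.Adj x y)
  iseqv := by
    refine ⟨fun _ => Or.inl rfl, ?_, ?_⟩
    · rintro x y (rfl | ⟨hx, hy, h⟩)
      · exact Or.inl rfl
      · exact Or.inr ⟨hy, hx, h.symm⟩
    · rintro x y z (rfl | ⟨hx, hy, h1⟩) h2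
      · exact h2
      · rcases h2 with rfl | ⟨-, hz, h2⟩
        · exact Or.inr ⟨hx, hy, h1⟩
        · by_cases hxz : x = z
          · exact Or.inl hxz
          · exact Or.inr ⟨hx, hz, h x hx y hy z hz h1 h2 hxz⟩

theorem exists_cliqueUnion {V : Type} [Fintype V] {G : SimpleGraph V} {D : Finset V}
    (h : ∀ x ∈ D, ∀ y ∈ D, ∀ z ∈ D, G.Adj x y → G.Adj y z → x ≠ z → G.Adj x z) {Y Q : Finset V}
    (hYD : Y ⊆ D) {r : ℕ} (hr : r ≤ Q.card)
    (hbig : ∀ v ∈ Q, r ≤ (Y.filter (fun x => sideSetoid G D h x v)).card)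
    (hne : ∀ v ∈ Q, ∀ w ∈ Q, sideSetoid G D h v w → v = w) :
    ∃ φ : cliqueUnion r ↪g G, ∀ i, φ i ∈ Y := by
  obtain ⟨a⟩ : Nonempty (Fin r ↪ Q) := by
    rw [Function.Embedding.nonempty_iff_card_le]
    simpa using hr
  have hb : ∀ i, Nonempty (Fin r ↪ (Y.filter (fun x => sideSetoid G D h x (a i)))) := by
    intro i
    rw [Function.Embedding.nonempty_iff_card_le]
    rw [Fintype.card_fin, Fintype.card_coe]
    exact hbig _ (a i).2
  have b := fun i => (hb i).some
  have hbY : ∀ i j, (b i j : V) ∈ Y := fun i j => (Finset.mem_filter.1 (b i j).2).1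
  have hbs : ∀ i j, sideSetoid G D h (b i j) (a i) := fun i j => (Finset.mem_filter.1 (b i j).2).2
  have hrel : ∀ i j i' j', sideSetoid G D h (b i j) (b i' j') ↔ i = i' := by
    intro i j i' j'
    constructor
    · intro hs
      have := hne _ (a i).2 _ (a i').2 ((sideSetoid G D h).trans'
        ((sideSetoid G D h).symm' (hbs i j)) ((sideSetoid G D h).trans' hs (hbs i' j')))
      exact a.injective (Subtype.ext this)
    · rintro rfl
      exact (sideSetoid G D h).trans' (hbs i j) ((sideSetoid G D h).symm' (hbs i j'))
  have hinj : Function.Injective (fun p : Fin r × Fin r => (b p.1 p.2 : V)) := by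
    rintro ⟨i, j⟩ ⟨i', j'⟩ hp
    dsimp only at hp
    obtain rfl := (hrel i j i' j').1 (hp ▸ (sideSetoid G D h).refl' _)
    rw [(b i).injective (Subtype.ext hp)]
  refine ⟨⟨⟨_, hinj⟩, ?_⟩, fun i => hbY _ _⟩
  rintro ⟨i, j⟩ ⟨i', j'⟩
  have h1 := hrel i j i' j'
  have h2 : (b i j : V) = b i' j' ↔ (i, j) = (i', j') := hinj.eq_iff (a := (i, j)) (b := (i', j'))
  change G.Adj (b i j) (b i' j') ↔ (i = i' ∧ (i, j) ≠ (i', j'))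
  change (_ ∨ _) ↔ _ at h1
  have h3 : G.Adj (b i j) (b i' j') → (b i j : V) ≠ b i' j' := fun h => h.ne
  have h4 := hYD (hbY i j)
  have h5 := hYD (hbY i' j')
  rw [← h1, ne_eq, ← h2]
  tauto

/-- A cluster graph with few disjoint copies of `cliqueUnion (q + 1)` is encoded by a `FewFun`. -/
theorem exists_fewFun {V : Type} [Fintype V] {G : SimpleGraph V} {D : Finset V}
    (h : ∀ x ∈ D, ∀ y ∈ D, ∀ z ∈ D, G.Adj x y → G.Adj y z → x ≠ z → G.Adj x z) {Z : Finset V}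
    {q : ℕ} (hq : 1 ≤ q) (hZ : ∀ φ : cliqueUnion (q + 1) ↪g G, ¬ ∀ i, φ i ∈ D \ Z) :
    ∃ f : V → V, (∀ x ∈ D, ∀ y ∈ D, G.Adj x y ↔ x ≠ y ∧ f x = f y) ∧
      ∃ P T : Finset V, P.card ≤ q ∧
        q * T.card ≤ (q - 1) * D.card + q * Z.card ∧ ∀ u ∉ T, f u = u ∨ f u ∈ P := by
  obtain ⟨f, hf, hfew⟩ := exists_fun (sideSetoid G D h) D Z hq (by
    rintro x y (rfl | ⟨h1, -⟩) hx
    · rfl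
    · exact absurd h1 hx) (by
    intro Q h1 h2
    by_contra hcon
    obtain ⟨φ, hφ⟩ := exists_cliqueUnion h Finset.sdiff_subset (Nat.lt_of_not_le hcon) h1 h2
    exact hZ φ hφ)
  refine ⟨f, fun x hx y hy => ?_, hfew⟩
  rw [hf]
  change _ ↔ _ ∧ (_ ∨ _)
  have : G.Adj x y → x ≠ y := fun h => h.ne
  tauto

theorem P3Few.exists_fewFun {V : Type} [Fintype V] {G : SimpleGraph V} {S : Finset V} {z : ℕ}
    (h : P3Few G S z) : ∃ f : V → V, (∀ x ∈ S, ∀ y ∈ S, G.Adj x y ↔ x ≠ y ∧ f x = f y) ∧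
      FewFun 1 z f := by
  obtain ⟨h1, Z, -, hZ, h2⟩ := h
  obtain ⟨f, hf, P, T, hP, hT, hfew⟩ := _root_.exists_fewFun (q := 1) (Z := Z)
    (fun x hx y hy z hz => adj_of_path3_free h1 hx hy hz) le_rfl (by
      intro φ hφ
      change cliqueUnion 2 ↪g G at φ
      have ha : ∀ i j, G.Adj (φ i) (φ j) ↔ (cliqueUnion 2).Adj i j := fun i j => φ.map_rel_iff
      have hn : ∀ i j, φ i = φ j ↔ i = j := fun i j => φ.injective.eq_iff
      have h3 : Gᶜ.Adj (φ (0, 0)) (φ (1, 0)) := by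
        rw [SimpleGraph.compl_adj, ne_eq, hn, ha]
        simp [cliqueUnion]
      have h4 : Gᶜ.Adj (φ (1, 0)) (φ (0, 1)) := by
        rw [SimpleGraph.compl_adj, ne_eq, hn, ha]
        simp [cliqueUnion]
      have h5 : ¬ Gᶜ.Adj (φ (0, 0)) (φ (0, 1)) := by
        rw [SimpleGraph.compl_adj, ne_eq, hn, ha]
        simp [cliqueUnion]
      obtain ⟨e, he⟩ := exists_path3 h3 h4 (by rw [ne_eq, hn]; simp) h5
      refine h2 e (fun i => ?_)
      rcases he i with h | h | h <;> rw [h] <;> exact hφ _)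
  exact ⟨f, hf, P, T, hP, by omega, hfew⟩

theorem Few.exists_fewFun {V : Type} [Fintype V] {G : SimpleGraph V} {S : Finset V} {z : ℕ}
    (h : Few G S z) : ∃ b : Prop, ∃ f : V → V,
      (∀ x ∈ S, ∀ y ∈ S, G.Adj x y ↔ x ≠ y ∧ (f x = f y ↔ b)) ∧ FewFun 1 z f := by
  rcases h with h | h
  · obtain ⟨f, hf, h⟩ := h.exists_fewFun
    exact ⟨True, f, by simpa using hf, h⟩
  · obtain ⟨f, hf, h⟩ := h.exists_fewFun
    refine ⟨False, f, fun x hx y hy => ?_, h⟩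
    have h1 := hf x hx y hy
    rw [SimpleGraph.compl_adj] at h1
    have : G.Adj x y → x ≠ y := fun h => h.ne
    tauto

theorem TwoFew.exists_fewFun {V : Type} [Fintype V] {G : SimpleGraph V} {z : ℕ}
    (h : TwoFew G z) : ∃ i : Finset V × Prop × Prop, ∃ f ∈ csep (FewFun (V := V) 2 (2 * z)),
      ∀ x y, (x ∈ i.1 ↔ y ∈ i.1) →
        (G.Adj x y ↔ x ≠ y ∧ (f x = f y ↔ (x ∈ i.1 ∧ i.2.1 ∨ x ∉ i.1 ∧ i.2.2))) := by
  obtain ⟨S, h1, h2⟩ := h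
  obtain ⟨b₁, f₁, hf₁, P₁, T₁, hP₁, hT₁, hfew₁⟩ := h1.exists_fewFun
  obtain ⟨b₂, f₂, hf₂, P₂, T₂, hP₂, hT₂, hfew₂⟩ := h2.exists_fewFun
  refine ⟨(S, b₁, b₂), fun x => if x ∈ S then f₁ x else f₂ x, ?_, ?_⟩
  · rw [mem_csep]
    refine ⟨P₁ ∪ P₂, T₁ ∪ T₂, (Finset.card_union_le _ _).trans (by omega),
      (Finset.card_union_le _ _).trans (by omega), fun u hu => ?_⟩
    simp only [Finset.mem_union, not_or] at hu ⊢
    have h1 := hfew₁ u hu.1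
    have h2 := hfew₂ u hu.2
    split_ifs <;> tauto
  · intro x y hxy
    dsimp only at hxy ⊢
    by_cases hx : x ∈ S
    · have hy := hxy.1 hx
      rw [hf₁ x hx y hy]
      simp [hx, hy]
    · have hy : y ∉ S := fun h => hx (hxy.2 h)
      rw [hf₂ x (by simpa using hx) y (by simpa using hy)]
      simp [hx, hy]

theorem twoFew_count {n : ℕ} (hn : 1 ≤ n) (z : ℕ) :
    (gcount (fun G : SimpleGraph (Fin n) => TwoFew G z) : ℝ) ≤
      4 * 24 ^ n * (n : ℝ) ^ (2 * z) * 2 ^ ((n : ℝ) ^ 2 / 4) := by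
  have h1 := gcount_exists_le (V := Fin n) (ι := Finset (Fin n) × Prop × Prop)
    (fun i G => ∃ f ∈ csep (FewFun (V := Fin n) 2 (2 * z)), ∀ x y, (x ∈ i.1 ↔ y ∈ i.1) →
        (G.Adj x y ↔ x ≠ y ∧ (f x = f y ↔ (x ∈ i.1 ∧ i.2.1 ∨ x ∉ i.1 ∧ i.2.2)))) _
    (fun i => gcount_exists_mem_le _ _ (2 ^ ((n : ℝ) ^ 2 / 4)) (fun f _ => by
      have h := two_pow_card_le i.1
      rw [Fintype.card_fin] at h
      exact (split_count i.1 _).trans h))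
  have h2 := card_fewFun (V := Fin n) (by simpa using hn) 2 (2 * z)
  rw [Fintype.card_fin] at h2
  refine (Nat.cast_le.2 (gcount_mono fun G hG => hG.exists_fewFun)).trans (h1.trans ?_)
  simp only [Fintype.card_prod, Fintype.card_finset, Fintype.card_fin, Fintype.card_prop]
  push_cast
  calc _ ≤ (2 : ℝ) ^ n * 4 * ((4 ^ n * ((2 : ℕ) + 1) ^ n * (n : ℝ) ^ (2 * z)) *
        2 ^ ((n : ℝ) ^ 2 / 4)) := by gcongr
    _ = _ := by
      rw [show (24 : ℝ) = 2 * 4 * 3 by norm_num, mul_pow, mul_pow]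
      push_cast
      ring

theorem twoFew_le : ∀ᶠ n : ℕ in atTop,
    (gcount (fun G : SimpleGraph (Fin n) => TwoFew G (3 * (n / 32))) : ℝ) ≤
      2 ^ (-(n : ℝ)) * uN n := by
  filter_upwards [uN_asymp (κ := 3 / 16) (by norm_num) (by norm_num) (C := 192) (by norm_num),
    eventually_ge_atTop 1] with n h hn
  have hn' : (1 : ℝ) ≤ n := by exact_mod_cast hn
  have h1 : (n : ℝ) ^ (2 * (3 * (n / 32))) ≤ (n : ℝ) ^ ((3 / 16 : ℝ) * n) := by
    rw [← Real.rpow_natCast]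
    refine Real.rpow_le_rpow_of_exponent_le hn' ?_
    have : ((n / 32 : ℕ) : ℝ) ≤ n / 32 := Nat.cast_div_le
    push_cast
    linarith
  have h2 : (4 : ℝ) ≤ 4 ^ n := le_self_pow₀ (by norm_num) (by omega)
  rw [Real.rpow_neg (by norm_num), Real.rpow_natCast, inv_mul_eq_div, le_div_iff₀ (by positivity)]
  calc _ ≤ (4 * 24 ^ n * (n : ℝ) ^ (2 * (3 * (n / 32))) * 2 ^ ((n : ℝ) ^ 2 / 4)) * 2 ^ n := by
        gcongr
        exact twoFew_count hn _
    _ ≤ (4 ^ n * 24 ^ n * (n : ℝ) ^ ((3 / 16 : ℝ) * n) * 2 ^ ((n : ℝ) ^ 2 / 4)) * 2 ^ n := by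
        gcongr
    _ = 2 ^ ((n : ℝ) ^ 2 / 4) * 192 ^ n * (n : ℝ) ^ ((3 / 16 : ℝ) * n) := by
        rw [show (192 : ℝ) = 4 * 24 * 2 by norm_num, mul_pow, mul_pow]
        ring
    _ ≤ _ := h

/-! ### Almost all graphs without an induced five-cycle are generalised split graphs -/

theorem uN_add (m k : ℕ) :
    (2 : ℝ) ^ ((k : ℝ) * (m + k : ℕ) / 2) * uN m ≤ 2 ^ (k ^ 2) * uN (m + k) := by
  induction k with
  | zero => simp
  | succ k ih =>
    have h1 := uN_succ (m + k)
    have h2 : (2 : ℝ) ^ (((k + 1 : ℕ) : ℝ) * (m + (k + 1) : ℕ) / 2) =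
        2 ^ ((k : ℝ) * (m + k : ℕ) / 2) * (2 ^ (((m + k : ℕ) : ℝ) / 2) * 2 ^ ((k : ℝ) / 2 + 1 / 2)) := by
      rw [← Real.rpow_add (by norm_num), ← Real.rpow_add (by norm_num)]
      congr 1
      push_cast
      ring
    have h3 : (2 : ℝ) ^ ((k : ℝ) / 2 + 1 / 2) * 2 ^ (k ^ 2) ≤ 2 ^ ((k + 1) ^ 2) := by
      rw [← Real.rpow_natCast, ← Real.rpow_natCast, ← Real.rpow_add (by norm_num)]
      refine Real.rpow_le_rpow_of_exponent_le (by norm_num) ?_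
      push_cast
      nlinarith [(Nat.cast_nonneg k : (0 : ℝ) ≤ k)]
    calc _ = ((2 : ℝ) ^ (((m + k : ℕ) : ℝ) / 2) * 2 ^ ((k : ℝ) / 2 + 1 / 2)) *
          (2 ^ ((k : ℝ) * (m + k : ℕ) / 2) * uN m) := by rw [h2]; ring
      _ ≤ (2 ^ (((m + k : ℕ) : ℝ) / 2) * 2 ^ ((k : ℝ) / 2 + 1 / 2)) * (2 ^ (k ^ 2) * uN (m + k)) := by
          gcongr
      _ = (2 ^ ((k : ℝ) / 2 + 1 / 2) * 2 ^ (k ^ 2)) * (2 ^ (((m + k : ℕ) : ℝ) / 2) * uN (m + k)) := by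
          ring
      _ ≤ 2 ^ ((k + 1) ^ 2) * uN (m + k + 1) := by gcongr

theorem uN_sub {n k : ℕ} (hk : k ≤ 3) (hn : k ≤ n) :
    (2 : ℝ) ^ ((k : ℝ) * n / 2) * uN (n - k) ≤ 512 * uN n := by
  have h := uN_add (n - k) k
  rw [Nat.sub_add_cancel hn] at h
  refine h.trans (mul_le_mul_of_nonneg_right ?_ (Nat.cast_nonneg _))
  calc (2 : ℝ) ^ (k ^ 2) ≤ 2 ^ 9 := pow_le_pow_right₀ (by norm_num) (by nlinarith)
    _ = 512 := by norm_num

theorem gcount_isCoUnipolar (n : ℕ) : gcount (V := Fin n) IsCoUnipolar = uN n := by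
  rw [← gcount_isUnipolar (Fintype.card_fin n)]
  exact gcount_compl IsUnipolar

/-- The number of graphs on `n` vertices with no induced five-cycle that are not generalised
split graphs. -/
def nsN (n : ℕ) : ℕ := gcount (fun G : SimpleGraph (Fin n) => C5Free G ∧ ¬ IsGenSplit G)

theorem fN_le (n : ℕ) : (fN n : ℝ) ≤ 2 * uN n + nsN n := by
  have h1 : fN n ≤ gcount (fun G : SimpleGraph (Fin n) => IsGenSplit G ∨
      (C5Free G ∧ ¬ IsGenSplit G)) := by
    rw [← gcount_c5Free (Fintype.card_fin n)]
    exact gcount_mono fun G hG => by tauto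
  have h2 := h1.trans (gcount_or_le _ _)
  have h3 := gcount_or_le (V := Fin n) IsUnipolar IsCoUnipolar
  rw [gcount_isCoUnipolar, gcount_isUnipolar (Fintype.card_fin n)] at h3
  have h4 : fN n ≤ (uN n + uN n) + nsN n := h2.trans (Nat.add_le_add_right h3 _)
  have h5 : (fN n : ℝ) ≤ (uN n + uN n) + nsN n := by exact_mod_cast h4
  linarith

theorem nsN_step : ∃ s : ℝ, 0 < s ∧ ∃ n₁ : ℕ, 3 ≤ n₁ ∧ ∀ n, n₁ ≤ n → ∀ K : ℝ, 0 ≤ K →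
    (∀ m < n, (fN m : ℝ) ≤ K * uN m) →
      (nsN n : ℝ) ≤ (3072 * K * 2 ^ (-(s * n)) + 2 ^ (-(n : ℝ))) * uN n := by
  obtain ⟨s, hs, h⟩ := nonSplit_le
  obtain ⟨n₁, hn₁⟩ := eventually_atTop.1 (h.and (twoFew_le.and (eventually_ge_atTop 3)))
  refine ⟨s, hs, max n₁ 3, le_max_right _ _, fun n hn K hK hind => ?_⟩
  obtain ⟨h1, h2, h3⟩ := hn₁ n ((le_max_left _ _).trans hn)
  have key : ∀ k : ℕ, 1 ≤ k → k ≤ 3 → (2 : ℝ) ^ ((k : ℝ) * n / 2 - s * n) * fN (n - k) ≤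
      512 * K * 2 ^ (-(s * n)) * uN n := by
    intro k hk1 hk3
    rw [sub_eq_add_neg, Real.rpow_add (by norm_num)]
    calc (2 : ℝ) ^ ((k : ℝ) * n / 2) * 2 ^ (-(s * n)) * fN (n - k)
        ≤ (2 : ℝ) ^ ((k : ℝ) * n / 2) * 2 ^ (-(s * n)) * (K * uN (n - k)) := by
          gcongr
          exact hind _ (by omega)
      _ = (K * 2 ^ (-(s * n))) * ((2 : ℝ) ^ ((k : ℝ) * n / 2) * uN (n - k)) := by ring
      _ ≤ (K * 2 ^ (-(s * n))) * (512 * uN n) :=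
          mul_le_mul_of_nonneg_left (uN_sub hk3 (by omega)) (by positivity)
      _ = _ := by ring
  have k1 := key 1 le_rfl (by norm_num)
  have k2 := key 2 (by norm_num) (by norm_num)
  have k3 := key 3 (by norm_num) le_rfl
  unfold nsN
  refine h1.trans ?_
  linarith

theorem fN_le_mul_uN : ∃ K : ℝ, 0 ≤ K ∧ ∀ n, (fN n : ℝ) ≤ K * uN n := by
  obtain ⟨s, hs, n₁, h3, hstep⟩ := nsN_step
  obtain ⟨n₂, hn₂⟩ := eventually_atTop.1 (exp_linear_absorb (4 * 3072) 0 hs)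
  set K : ℝ := 4 + ∑ m ∈ Finset.range (max n₁ n₂), (fN m : ℝ) with hK
  have hK4 : 4 ≤ K := by
    have : 0 ≤ ∑ m ∈ Finset.range (max n₁ n₂), (fN m : ℝ) :=
      Finset.sum_nonneg fun _ _ => Nat.cast_nonneg _
    linarith
  refine ⟨K, by linarith, fun n => ?_⟩
  induction n using Nat.strong_induction_on with
  | _ n ih =>
    have hu : (1 : ℝ) ≤ uN n := by exact_mod_cast uN_pos n
    rcases lt_or_ge n (max n₁ n₂) with hn | hn
    · have h1 : (fN n : ℝ) ≤ ∑ m ∈ Finset.range (max n₁ n₂), (fN m : ℝ) :=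
        Finset.single_le_sum (f := fun m => (fN m : ℝ)) (fun _ _ => Nat.cast_nonneg _)
          (Finset.mem_range.2 hn)
      nlinarith
    · have h1 := hstep n ((le_max_left _ _).trans hn) K (by linarith) ih
      have h2 := hn₂ n ((le_max_right _ _).trans hn)
      rw [pow_zero, mul_one] at h2
      have h4 : 3072 * (2 : ℝ) ^ (-(s * n)) ≤ 1 / 4 := by
        rw [Real.rpow_neg (by norm_num), ← div_eq_mul_inv, div_le_div_iff₀ (by positivity)
          (by norm_num)]
        linarith
      have h5 : (2 : ℝ) ^ (-(n : ℝ)) ≤ 1 :=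
        Real.rpow_le_one_of_one_le_of_nonpos (by norm_num) (by simp)
      have h6 : 3072 * K * (2 : ℝ) ^ (-(s * n)) + 2 ^ (-(n : ℝ)) ≤ K - 2 := by nlinarith
      have h7 := fN_le n
      have h8 := mul_le_mul_of_nonneg_right h6 (by linarith : (0 : ℝ) ≤ uN n)
      linarith

theorem nsN_le : ∃ c : ℝ, 0 < c ∧ ∀ᶠ n : ℕ in atTop, (nsN n : ℝ) ≤ 2 ^ (-(c * n)) * uN n := by
  obtain ⟨s, hs, n₁, -, hstep⟩ := nsN_step
  obtain ⟨K, hK, hf⟩ := fN_le_mul_uN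
  set c := min s 1 / 2 with hc
  have hc0 : 0 < c := by have := lt_min hs one_pos; positivity
  have hcs : c * 2 ≤ s := by rw [hc]; linarith [min_le_left s 1]
  have hc1 : c * 2 ≤ 1 := by rw [hc]; linarith [min_le_right s 1]
  refine ⟨c, hc0, ?_⟩
  filter_upwards [eventually_ge_atTop n₁, exp_linear_absorb (3072 * K + 1) 0 hc0] with n hn h
  rw [pow_zero, mul_one] at h
  refine (hstep n hn K hK fun m _ => hf m).trans (mul_le_mul_of_nonneg_right ?_ (Nat.cast_nonneg _))
  have hn0 : (0 : ℝ) ≤ n := Nat.cast_nonneg n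
  have h1 : (2 : ℝ) ^ (-(s * n)) ≤ 2 ^ (-(c * n)) * 2 ^ (-(c * n)) := by
    rw [← Real.rpow_add (by norm_num)]
    refine Real.rpow_le_rpow_of_exponent_le (by norm_num) ?_
    nlinarith
  have h2 : (2 : ℝ) ^ (-(n : ℝ)) ≤ 2 ^ (-(c * n)) * 2 ^ (-(c * n)) := by
    rw [← Real.rpow_add (by norm_num)]
    refine Real.rpow_le_rpow_of_exponent_le (by norm_num) ?_
    nlinarith
  calc 3072 * K * (2 : ℝ) ^ (-(s * n)) + 2 ^ (-(n : ℝ))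
      ≤ 3072 * K * (2 ^ (-(c * n)) * 2 ^ (-(c * n))) + 2 ^ (-(c * n)) * 2 ^ (-(c * n)) := by
        gcongr
    _ = (3072 * K + 1) * (2 ^ (-(c * n)) * 2 ^ (-(c * n))) := by ring
    _ ≤ 2 ^ (c * n) * (2 ^ (-(c * n)) * 2 ^ (-(c * n))) := by gcongr
    _ = 2 ^ (-(c * n)) := by
        rw [← mul_assoc, ← Real.rpow_add (by norm_num), add_neg_cancel, Real.rpow_zero, one_mul]

/-! ### Almost all unipolar graphs contain a given unipolar graph -/

/-- `G` is unipolar with central clique `C` and side cliques given by the fibres of `f`. -/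
def UniBase {V : Type} (C : Finset V) (f : V → V) (G : SimpleGraph V) : Prop :=
  ∀ x y, (x ∈ C ↔ y ∈ C) → (G.Adj x y ↔ x ≠ y ∧ (x ∈ C ∨ f x = f y))

theorem pack_count {V W : Type} [Fintype V] [Fintype W] {H : SimpleGraph W} (hH : IsUnipolar H)
    {r : ℕ} (hr : Fintype.card W ≤ r) (C : Finset V) (f : V → V) {t : ℕ}
    (ht : t * Fintype.card W ≤ C.card) :
    (gcount (fun G : SimpleGraph V => UniBase C f G ∧ Pack G (cliqueUnion r) Cᶜ t ∧
      ¬ Nonempty (H ↪g G)) : ℝ) ≤ 2 ^ (C.card * (Cᶜ).card) *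
        (1 - 1 / 2 ^ (Fintype.card W * Fintype.card W)) ^ (t * t) := by
  have hρ : (0 : ℝ) ≤ 1 - 1 / 2 ^ (Fintype.card W * Fintype.card W) := by
    rw [sub_nonneg, div_le_one (by positivity)]
    exact one_le_pow₀ (by norm_num)
  by_cases h0 : ∃ G₀, UniBase C f G₀ ∧ Pack G₀ (cliqueUnion r) Cᶜ t
  swap
  · have : gcount (fun G : SimpleGraph V => UniBase C f G ∧ Pack G (cliqueUnion r) Cᶜ t ∧
      ¬ Nonempty (H ↪g G)) = 0 := by
      refine Finset.card_eq_zero.2 (Finset.eq_empty_of_forall_notMem fun G hG => h0 ⟨G, ?_⟩)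
      rw [mem_csep] at hG
      exact ⟨hG.1, hG.2.1⟩
    rw [this, Nat.cast_zero]
    positivity
  obtain ⟨G₀, hG₀, φ, hφ1, hφ2⟩ := h0
  obtain ⟨CH, hCH1, hCH2⟩ := isUnipolar_iff.1 hH
  obtain ⟨ι⟩ : Nonempty (W ↪ Fin r) := by
    rw [Function.Embedding.nonempty_iff_card_le]
    simpa using hr
  obtain ⟨ψ⟩ : Nonempty (Fin t × W ↪ {x // x ∈ C}) := by
    rw [Function.Embedding.nonempty_iff_card_le]
    simpa using ht
  set D : Finset W := Finset.univ.filter (fun w => w ∉ CH) with hD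
  have hmD : ∀ {w}, w ∈ D ↔ w ∉ CH := by simp [hD]
  set s := sideSetoid H D (fun x hx y hy z hz => hCH2 x (hmD.1 hx) y (hmD.1 hy) z (hmD.1 hz))
    with hs
  set rep : W → W := fun w => (Quotient.mk s w).out with hrep
  have hrep' : ∀ w w', rep w = rep w' ↔ s w w' := by
    intro w w'
    simp only [hrep, Quotient.out_inj]
    exact Quotient.eq
  set χ : Fin t → W → V := fun j w => φ j (ι (rep w), ι w) with hχ
  have hχC : ∀ j w, χ j w ∉ C := fun j w => by simpa using hφ1 j (ι (rep w), ι w)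
  have hχinj : ∀ j w j' w', χ j w = χ j' w' → j = j' ∧ w = w' := by
    intro j w j' w' h
    obtain rfl := hφ2 _ _ _ _ h
    have := (φ j).injective h
    exact ⟨rfl, ι.injective (Prod.ext_iff.1 this).2⟩
  have hχadj : ∀ j w w', w ∉ CH → w' ∉ CH →
      (χ j w ≠ χ j w' ∧ f (χ j w) = f (χ j w') ↔ H.Adj w w') := by
    intro j w w' hw hw'
    have h1 := hG₀ (χ j w) (χ j w') (by simp [hχC])
    have h2 : G₀.Adj (χ j w) (χ j w') ↔ (cliqueUnion r).Adj (ι (rep w), ι w) (ι (rep w'), ι w') :=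
      (φ j).map_rel_iff
    have h3 : (cliqueUnion r).Adj (ι (rep w), ι w) (ι (rep w'), ι w') ↔
        ι (rep w) = ι (rep w') ∧ (ι (rep w), ι w) ≠ (ι (rep w'), ι w') := Iff.rfl
    rw [ι.injective.eq_iff, hrep', ne_eq, Prod.mk.injEq, ι.injective.eq_iff, ι.injective.eq_iff,
      hrep'] at h3
    have h4 : s w w' ↔ w = w' ∨ (w ∈ D ∧ w' ∈ D ∧ H.Adj w w') := Iff.rfl
    rw [hmD, hmD] at h4
    have h5 : H.Adj w w' → w ≠ w' := fun h => h.ne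
    have h6 := hχC j w
    tauto
  set Φ : (Fin t × Fin t) × (W × W) → {x // x ∈ C} × {x // x ∉ C} :=
    fun p => (ψ (p.1.1, p.2.1), ⟨χ p.1.2 p.2.2, hχC _ _⟩) with hΦ
  have hΦinj : Function.Injective Φ := by
    rintro ⟨⟨i, j⟩, ⟨w, w'⟩⟩ ⟨⟨i₂, j₂⟩, ⟨w₂, w'₂⟩⟩ h
    simp only [hΦ, Prod.mk.injEq, Subtype.mk.injEq, ψ.injective.eq_iff] at h
    obtain ⟨⟨rfl, rfl⟩, h⟩ := h
    obtain ⟨rfl, rfl⟩ := hχinj _ _ _ _ h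
    rfl
  have hcount := avoid_count Φ hΦinj (fun _ w => H.Adj w.1 w.2)
  have hcross := cross_count C (fun x y => x ≠ y ∧ (x ∈ C ∨ f x = f y))
    (fun g => ∀ i, ¬ ∀ w : W × W, (g (Φ (i, w)) ↔ H.Adj w.1 w.2))
  have hmono : gcount (fun G : SimpleGraph V => UniBase C f G ∧ Pack G (cliqueUnion r) Cᶜ t ∧
      ¬ Nonempty (H ↪g G)) ≤ gcount (fun G : SimpleGraph V =>
        (∀ x y, (x ∈ C ↔ y ∈ C) → (G.Adj x y ↔ x ≠ y ∧ (x ∈ C ∨ f x = f y))) ∧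
        ∀ i : Fin t × Fin t, ¬ ∀ w : W × W,
          (G.Adj (Φ (i, w)).1 (Φ (i, w)).2 ↔ H.Adj w.1 w.2)) := by
    refine gcount_mono fun G hG => ⟨hG.1, ?_⟩
    rintro ⟨i, j⟩ hm
    refine hG.2.2 ?_
    have hm' : ∀ w w', G.Adj (ψ (i, w)) (χ j w') ↔ H.Adj w w' := fun w w' => hm (w, w')
    set e : W → V := fun w => if w ∈ CH then ψ (i, w) else χ j w with he
    have hψinj : ∀ w w', (ψ (i, w) : V) = ψ (i, w') → w = w' := by
      intro w w' h
      have := ψ.injective (Subtype.ext h)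
      simpa using this
    have heinj : Function.Injective e := by
      intro w w' h
      by_cases hw : w ∈ CH <;> by_cases hw' : w' ∈ CH <;> simp only [he, hw, hw', if_true, if_false]
        at h
      · exact hψinj _ _ h
      · exact absurd (h ▸ (ψ (i, w)).2) (hχC j w')
      · exact absurd (h ▸ (ψ (i, w')).2) (hχC j w)
      · exact (hχinj _ _ _ _ h).2
    refine ⟨⟨⟨e, heinj⟩, ?_⟩⟩
    intro w w'
    change G.Adj (e w) (e w') ↔ _
    by_cases hw : w ∈ CH <;> by_cases hw' : w' ∈ CH <;> simp only [he, hw, hw', if_true, if_false]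
    · rw [hG.1 _ _ (by simp)]
      have h1 : H.Adj w w' → w ≠ w' := fun h => h.ne
      have h2 := hCH1 w hw w' hw'
      have h3 : (ψ (i, w) : V) ∈ C := (ψ (i, w)).2
      have h4 : (ψ (i, w) : V) = ψ (i, w') ↔ w = w' := ⟨hψinj w w', fun h => h ▸ rfl⟩
      rw [ne_eq, h4]
      tauto
    · exact hm' w w'
    · rw [G.adj_comm, H.adj_comm]
      exact hm' w' w
    · rw [hG.1 _ _ (by simp [hχC]), ← hχadj j w w' hw hw']
      simp [hχC]
  refine (Nat.cast_le.2 (hmono.trans hcross)).trans (hcount.trans (le_of_eq ?_))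
  simp only [Fintype.card_prod, Fintype.card_coe, Fintype.card_fin]
  congr 3
  rw [Fintype.card_subtype_compl, Fintype.card_coe, Finset.card_compl]

theorem quad_absorb {l : ℝ} (hl : 0 < l) : ∀ᶠ n : ℕ in atTop,
    3 * (2 : ℝ) ^ n * (n : ℝ) ^ n * 2 ^ (-(l * (n : ℝ) ^ 2)) ≤ 2 ^ (-(n : ℝ)) := by
  filter_upwards [exp_linear_absorb 12 1 hl, eventually_ge_atTop 1] with n h hn
  rw [pow_one] at h
  have h1 : (12 * ((n : ℝ) + 1)) ^ n ≤ 2 ^ (l * (n : ℝ) ^ 2) := by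
    calc _ ≤ ((2 : ℝ) ^ (l * n)) ^ n := by gcongr
      _ = _ := by
        rw [← Real.rpow_natCast, ← Real.rpow_mul (by norm_num)]
        congr 1
        ring
  rw [Real.rpow_neg (by norm_num), Real.rpow_neg (by norm_num), Real.rpow_natCast,
    ← div_eq_mul_inv, div_le_iff₀ (by positivity), inv_mul_eq_div, le_div_iff₀ (by positivity)]
  have h2 : (3 : ℝ) ≤ 3 ^ n := le_self_pow₀ (by norm_num) (by omega)
  calc 3 * (2 : ℝ) ^ n * (n : ℝ) ^ n * 2 ^ n ≤ 3 ^ n * 2 ^ n * ((n : ℝ) + 1) ^ n * 2 ^ n := by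
        gcongr
        linarith
    _ = (12 * ((n : ℝ) + 1)) ^ n := by
        rw [← mul_pow, ← mul_pow, ← mul_pow]
        congr 1
        ring
    _ ≤ _ := h1

theorem exists_uniBase {V : Type} [Fintype V] {G : SimpleGraph V} (hG : IsUnipolar G) :
    ∃ C : Finset V, (∃ f, UniBase C f G) ∧
      ∀ (Z : Finset V) (q : ℕ), (∀ φ : cliqueUnion (q + 2) ↪g G, ¬ ∀ i, φ i ∈ Cᶜ \ Z) →
        ∃ f, UniBase C f G ∧ ∃ P T : Finset V, P.card ≤ q + 1 ∧
          (q + 1) * T.card ≤ q * (Cᶜ).card + (q + 1) * Z.card ∧ ∀ u ∉ T, f u = u ∨ f u ∈ P := by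
  obtain ⟨C', h1, h2⟩ := isUnipolar_iff.1 hG
  set C : Finset V := Finset.univ.filter (fun x => x ∈ C') with hC
  have hmC : ∀ {x}, x ∈ C ↔ x ∈ C' := by simp [hC]
  have hside : ∀ x ∈ Cᶜ, ∀ y ∈ Cᶜ, ∀ z ∈ Cᶜ, G.Adj x y → G.Adj y z → x ≠ z → G.Adj x z := by
    simp only [Finset.mem_compl, hmC]
    exact h2
  have hbase : ∀ f : V → V, (∀ x ∈ Cᶜ, ∀ y ∈ Cᶜ, G.Adj x y ↔ x ≠ y ∧ f x = f y) →
      UniBase C f G := by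
    intro f hf x y hxy
    by_cases hx : x ∈ C
    · have h3 := h1 x (hmC.1 hx) y (hmC.1 (hxy.1 hx))
      have h4 : G.Adj x y → x ≠ y := fun h => h.ne
      tauto
    · have hy : y ∉ C := fun h => hx (hxy.2 h)
      rw [hf x (by simpa using hx) y (by simpa using hy)]
      tauto
  refine ⟨C, ?_, fun Z q hZ => ?_⟩
  · refine ⟨fun x => (Quotient.mk (sideSetoid G Cᶜ hside) x).out, hbase _ fun x hx y hy => ?_⟩
    rw [Quotient.out_inj, Quotient.eq]
    change _ ↔ _ ∧ (_ ∨ _)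
    have : G.Adj x y → x ≠ y := fun h => h.ne
    tauto
  · obtain ⟨f, hf, h⟩ := exists_fewFun (q := q + 1) hside (by omega) hZ
    exact ⟨f, hbase f hf, h⟩

theorem uniBase_count {V : Type} [Fintype V] (C : Finset V) (f : V → V) :
    (gcount (UniBase C f) : ℝ) ≤ 2 ^ (C.card * (Cᶜ).card) :=
  split_count C (fun x y => x ≠ y ∧ (x ∈ C ∨ f x = f y))

theorem unbalanced_count (V : Type) [Fintype V] (b : ℝ) :
    (gcount (fun G : SimpleGraph V => ∃ i : Finset V × (V → V),
      ((i.1.card * (i.1ᶜ).card : ℕ) : ℝ) ≤ b ∧ UniBase i.1 i.2 G) : ℝ) ≤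
      2 ^ Fintype.card V * (Fintype.card V : ℝ) ^ Fintype.card V * 2 ^ b := by
  refine (gcount_exists_le _ (2 ^ b) fun i => ?_).trans (le_of_eq ?_)
  · by_cases hi : ((i.1.card * (i.1ᶜ).card : ℕ) : ℝ) ≤ b
    · refine (Nat.cast_le.2 (gcount_mono fun G hG => hG.2)).trans ((uniBase_count i.1 i.2).trans ?_)
      rw [← Real.rpow_natCast]
      exact Real.rpow_le_rpow_of_exponent_le (by norm_num) hi
    · have : gcount (fun G : SimpleGraph V =>
          ((i.1.card * (i.1ᶜ).card : ℕ) : ℝ) ≤ b ∧ UniBase i.1 i.2 G) = 0 := by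
        refine Finset.card_eq_zero.2 (Finset.eq_empty_of_forall_notMem fun G hG => ?_)
        rw [mem_csep] at hG
        exact hi hG.1
      rw [this, Nat.cast_zero]
      positivity
  · rw [Fintype.card_prod, Fintype.card_finset, Fintype.card_fun]
    push_cast
    ring

theorem fewFun_base_count (V : Type) [Fintype V] (hV : 1 ≤ Fintype.card V) (K N : ℕ) :
    (gcount (fun G : SimpleGraph V => ∃ C : Finset V, ∃ f ∈ csep (FewFun (V := V) K N),
      UniBase C f G) : ℝ) ≤ 2 ^ Fintype.card V * ((4 ^ Fintype.card V * (K + 1) ^ Fintype.card V *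
        (Fintype.card V : ℝ) ^ N) * 2 ^ ((Fintype.card V : ℝ) ^ 2 / 4)) := by
  refine (gcount_exists_le _ _ fun C => gcount_exists_mem_le _ _ (2 ^ ((Fintype.card V : ℝ) ^ 2 / 4))
    fun f _ => (uniBase_count C f).trans (two_pow_card_le C)).trans ?_
  rw [Fintype.card_finset]
  push_cast
  gcongr
  exact card_fewFun hV K N

theorem pack_base_count (V : Type) {W : Type} [Fintype V] [Fintype W] {H : SimpleGraph W}
    (hH : IsUnipolar H) {r : ℕ} (hr : Fintype.card W ≤ r) (t : ℕ) :
    (gcount (fun G : SimpleGraph V => ∃ i : Finset V × (V → V), t * Fintype.card W ≤ i.1.card ∧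
      UniBase i.1 i.2 G ∧ Pack G (cliqueUnion r) i.1ᶜ t ∧ ¬ Nonempty (H ↪g G)) : ℝ) ≤
      2 ^ Fintype.card V * (Fintype.card V : ℝ) ^ Fintype.card V *
        (2 ^ ((Fintype.card V : ℝ) ^ 2 / 4) *
          (1 - 1 / 2 ^ (Fintype.card W * Fintype.card W)) ^ (t * t)) := by
  have hρ : (0 : ℝ) ≤ 1 - 1 / 2 ^ (Fintype.card W * Fintype.card W) := by
    rw [sub_nonneg, div_le_one (by positivity)]
    exact one_le_pow₀ (by norm_num)
  refine (gcount_exists_le _ (2 ^ ((Fintype.card V : ℝ) ^ 2 / 4) *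
          (1 - 1 / 2 ^ (Fintype.card W * Fintype.card W)) ^ (t * t)) fun i => ?_).trans (le_of_eq ?_)
  · by_cases hi : t * Fintype.card W ≤ i.1.card
    · refine (Nat.cast_le.2 (gcount_mono fun G hG => hG.2)).trans
        ((pack_count hH hr i.1 i.2 hi).trans ?_)
      gcongr
      exact two_pow_card_le i.1
    · have : gcount (fun G : SimpleGraph V => t * Fintype.card W ≤ i.1.card ∧
          UniBase i.1 i.2 G ∧ Pack G (cliqueUnion r) i.1ᶜ t ∧ ¬ Nonempty (H ↪g G)) = 0 := by
        refine Finset.card_eq_zero.2 (Finset.eq_empty_of_forall_notMem fun G hG => ?_)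
        rw [mem_csep] at hG
        exact hi hG.1
      rw [this, Nat.cast_zero]
      positivity
  · rw [Fintype.card_prod, Fintype.card_finset, Fintype.card_fun]
    push_cast
    ring

theorem unipolar_avoid_cases {V W : Type} [Fintype V] [Fintype W] (H : SimpleGraph W) {w t : ℕ}
    (hw : Fintype.card W = w) (ht : t = Fintype.card V / (8 * (w + 1) * (w + 2) ^ 2))
    {G : SimpleGraph V} (hG : IsUnipolar G) (hGH : ¬ Nonempty (H ↪g G)) :
    (∃ i : Finset V × (V → V), ((i.1.card * (i.1ᶜ).card : ℕ) : ℝ) ≤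
      (1 / 4 - (1 / (8 * ((w : ℝ) + 1))) ^ 2) * (Fintype.card V : ℝ) ^ 2 ∧ UniBase i.1 i.2 G) ∨
    ((∃ C : Finset V, ∃ f ∈ csep (FewFun (V := V) (w + 1)
        ⌊(1 / 2 - 1 / (4 * ((w : ℝ) + 1))) * Fintype.card V⌋₊), UniBase C f G) ∨
      ∃ i : Finset V × (V → V), t * Fintype.card W ≤ i.1.card ∧
        UniBase i.1 i.2 G ∧ Pack G (cliqueUnion (w + 2)) i.1ᶜ t ∧ ¬ Nonempty (H ↪g G)) := by
  obtain ⟨C, ⟨f, hf⟩, hC⟩ := exists_uniBase hG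
  set n : ℝ := (Fintype.card V : ℝ) with hn
  have hn0 : 0 ≤ n := Nat.cast_nonneg _
  set g : ℝ := 1 / (8 * ((w : ℝ) + 1)) with hg
  have hw1 : (0 : ℝ) < (w : ℝ) + 1 := by positivity
  have hg0 : 0 < g := by positivity
  have hgw : 8 * (g * ((w : ℝ) + 1)) = 1 := by
    rw [hg]
    field_simp
  have hCc : (C.card : ℝ) = n - (Cᶜ).card := by
    have := card_compl_real C
    linarith
  by_cases h1 : ((C.card * (Cᶜ).card : ℕ) : ℝ) ≤ (1 / 4 - g ^ 2) * n ^ 2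
  · exact Or.inl ⟨(C, f), h1, hf⟩
  refine Or.inr ?_
  have hD : ((Cᶜ).card : ℝ) ≤ (1 / 2 + g) * n := by
    by_contra hcon
    push Not at hcon
    refine h1 ?_
    push_cast
    rw [hCc]
    nlinarith [mul_nonneg (sub_nonneg.2 hcon.le)
      (by nlinarith [mul_nonneg hg0.le hn0] : 0 ≤ ((Cᶜ).card : ℝ) - (1 / 2 - g) * n)]
  have ht8 : (t : ℝ) * (8 * (w + 1) * (w + 2) ^ 2) ≤ n := by
    have := Nat.div_mul_le_self (Fintype.card V) (8 * (w + 1) * (w + 2) ^ 2)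
    rw [← ht] at this
    rw [hn]
    exact_mod_cast this
  have hw0 : (0 : ℝ) ≤ w := Nat.cast_nonneg w
  have ht0 : (0 : ℝ) ≤ t := Nat.cast_nonneg t
  rcases pack_or_cover G (cliqueUnion (w + 2)) Cᶜ t with hP | ⟨Z, -, hZ, hφ⟩
  · refine Or.inr ⟨(C, f), ?_, hf, hP, hGH⟩
    have h2 : (t : ℝ) * (8 * w) ≤ t * (8 * (w + 1) * (w + 2) ^ 2) := by
      refine mul_le_mul_of_nonneg_left ?_ ht0
      nlinarith [sq_nonneg ((w : ℝ) + 2), mul_nonneg hw0 hw0]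
    have h3 : g ≤ 1 / 8 := by nlinarith [mul_nonneg hg0.le hw0]
    have h4 : ((t * w : ℕ) : ℝ) ≤ C.card := by
      rw [hCc]
      push_cast
      nlinarith
    rw [hw]
    exact_mod_cast h4
  · obtain ⟨f, hf, P, T, hP, hT, hfew⟩ := hC Z w hφ
    refine Or.inl ⟨C, f, ?_, hf⟩
    rw [mem_csep]
    refine ⟨P, T, hP, Nat.le_floor ?_, hfew⟩
    have hZ' : (Z.card : ℝ) ≤ t * (w + 2) ^ 2 := by
      have : Z.card ≤ t * (w + 2) ^ 2 := by
        simpa [Fintype.card_prod, sq] using hZ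
      exact_mod_cast this
    have hT' : ((w : ℝ) + 1) * T.card ≤ w * (Cᶜ).card + (w + 1) * Z.card := by exact_mod_cast hT
    have h5 : 1 / (4 * ((w : ℝ) + 1)) = 2 * g := by
      rw [hg]
      field_simp
      norm_num
    rw [h5]
    refine le_of_mul_le_mul_left (hT'.trans ?_) hw1
    have h6 : (w : ℝ) * (Cᶜ).card ≤ w * ((1 / 2 + g) * n) := mul_le_mul_of_nonneg_left hD hw0
    have h7 : ((w : ℝ) + 1) * Z.card ≤ n / 8 := by
      have := mul_le_mul_of_nonneg_left hZ' hw1.le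
      linarith
    have h8 : (w : ℝ) * ((1 / 2 + g) * n) + n / 8 ≤ (w + 1) * ((1 / 2 - 2 * g) * n) := by
      have h9 : g * ((w : ℝ) + 1) * n = n / 8 := by linear_combination n / 8 * hgw
      nlinarith [mul_nonneg hg0.le hn0]
    linarith

theorem unipolar_avoid_le {W : Type} [Fintype W] (H : SimpleGraph W) (hH : IsUnipolar H) :
    ∀ᶠ n : ℕ in atTop, (gcount (fun G : SimpleGraph (Fin n) => IsUnipolar G ∧ ¬ Nonempty (H ↪g G))
      : ℝ) ≤ 2 ^ (-(n : ℝ)) * uN n := by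
  obtain ⟨w, hw⟩ : ∃ w, Fintype.card W = w := ⟨_, rfl⟩
  set g : ℝ := 1 / (8 * ((w : ℝ) + 1)) with hg
  set κ : ℝ := 1 / 2 - 1 / (4 * ((w : ℝ) + 1)) with hκ
  set ρ : ℝ := 1 - 1 / 2 ^ (w * w + 1) with hρ
  set k : ℕ := 8 * (w + 1) * (w + 2) ^ 2 with hk
  have hg0 : 0 < g := by positivity
  have hκ0 : 0 ≤ κ := by
    rw [hκ, sub_nonneg, div_le_div_iff₀ (by positivity) (by norm_num)]
    nlinarith [(Nat.cast_nonneg w : (0 : ℝ) ≤ w)]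
  have hκ1 : κ < 1 / 2 := by
    have : (0 : ℝ) < 1 / (4 * ((w : ℝ) + 1)) := by positivity
    linarith
  have hpow : (1 : ℝ) / 2 ^ (w * w + 1) ≤ 1 / 2 := by
    rw [pow_succ]
    have : (1 : ℝ) ≤ 2 ^ (w * w) := one_le_pow₀ (by norm_num)
    rw [div_le_div_iff₀ (by positivity) (by norm_num)]
    linarith
  have hρ0 : 0 < ρ := by linarith
  have hρ1 : ρ < 1 := by
    have : (0 : ℝ) < 1 / 2 ^ (w * w + 1) := by positivity
    linarith
  have hk0 : (0 : ℝ) < k := by rw [hk]; positivity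
  set l : ℝ := -Real.logb 2 ρ / (4 * (k : ℝ) ^ 2) with hl
  have hl0 : 0 < l := by
    have := Real.logb_neg (b := 2) (by norm_num) hρ0 hρ1
    have h2 : 0 < -Real.logb 2 ρ := by linarith
    positivity
  filter_upwards [uN_asymp (κ := 0) le_rfl (by norm_num) (C := 1) le_rfl,
    uN_asymp hκ0 hκ1 (C := 48 * ((w : ℝ) + 2)) (by linarith [(Nat.cast_nonneg w : (0 : ℝ) ≤ w)]),
    quad_absorb (sq_pos_of_pos hg0), quad_absorb hl0, eventually_ge_atTop (2 * k),
    eventually_ge_atTop 1] with n h1 h2 h3 h4 hn hn1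
  have hn1' : (1 : ℝ) ≤ n := by exact_mod_cast hn1
  simp only [one_pow, mul_one, zero_mul, Real.rpow_zero] at h1
  have c1 := unbalanced_count (Fin n) ((1 / 4 - g ^ 2) * (n : ℝ) ^ 2)
  have c2 := fewFun_base_count (Fin n) (by simpa using hn1) (w + 1) ⌊κ * n⌋₊
  have c3 := pack_base_count (Fin n) hH (r := w + 2) (by omega) (n / k)
  rw [Fintype.card_fin] at c1 c2 c3
  have hle := (gcount_mono (V := Fin n) fun G (hG : IsUnipolar G ∧ ¬ Nonempty (H ↪g G)) => by
    have := unipolar_avoid_cases H hw rfl hG.1 hG.2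
    rw [Fintype.card_fin] at this
    exact this).trans ((gcount_or_le _ _).trans (Nat.add_le_add_left (gcount_or_le _ _) _))
  have hle' := (Nat.cast_le (α := ℝ)).2 hle
  rw [Nat.cast_add, Nat.cast_add] at hle'
  push_cast at c2
  have hX : (0 : ℝ) ≤ 2 ^ ((n : ℝ) ^ 2 / 4) := by positivity
  have b1 : (2 : ℝ) ^ n * (n : ℝ) ^ n * 2 ^ ((1 / 4 - g ^ 2) * (n : ℝ) ^ 2) ≤
      1 / 3 * (2 ^ (-(n : ℝ)) * uN n) := by
    rw [show (1 / 4 - g ^ 2) * (n : ℝ) ^ 2 = (n : ℝ) ^ 2 / 4 + -(g ^ 2 * (n : ℝ) ^ 2) by ring,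
      Real.rpow_add (by norm_num)]
    calc _ = 1 / 3 * ((3 * (2 : ℝ) ^ n * (n : ℝ) ^ n * 2 ^ (-(g ^ 2 * (n : ℝ) ^ 2))) *
          2 ^ ((n : ℝ) ^ 2 / 4)) := by ring
      _ ≤ _ := by gcongr
  have b3 : (2 : ℝ) ^ n * (n : ℝ) ^ n * (2 ^ ((n : ℝ) ^ 2 / 4) *
      (1 - 1 / 2 ^ (Fintype.card W * Fintype.card W)) ^ (n / k * (n / k))) ≤
      1 / 3 * (2 ^ (-(n : ℝ)) * uN n) := by
    have e1 : (1 - 1 / 2 ^ (Fintype.card W * Fintype.card W) : ℝ) ^ (n / k * (n / k)) ≤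
        2 ^ (-(l * (n : ℝ) ^ 2)) := by
      rw [hw]
      have e2 : (2 : ℝ) ^ (-(l * (n : ℝ) ^ 2)) = ρ ^ ((n : ℝ) ^ 2 / (4 * (k : ℝ) ^ 2)) := by
        rw [show -(l * (n : ℝ) ^ 2) = Real.logb 2 ρ * ((n : ℝ) ^ 2 / (4 * (k : ℝ) ^ 2)) by
          rw [hl]; ring, Real.rpow_mul (by norm_num), Real.rpow_logb (by norm_num) (by norm_num) hρ0]
      have e3 : (1 - 1 / 2 ^ (w * w) : ℝ) ≤ ρ := by
        rw [hρ, pow_succ]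
        gcongr
        have : (0 : ℝ) < 2 ^ (w * w) := by positivity
        linarith
      have e4 : (0 : ℝ) ≤ 1 - 1 / 2 ^ (w * w) := by
        rw [sub_nonneg, div_le_one (by positivity)]
        exact one_le_pow₀ (by norm_num)
      refine (pow_le_pow_left₀ e4 e3 _).trans ?_
      rw [e2, ← Real.rpow_natCast]
      refine Real.rpow_le_rpow_of_exponent_ge hρ0 hρ1.le ?_
      have e5 : (n : ℝ) / (2 * k) ≤ ((n / k : ℕ) : ℝ) := by
        rw [div_le_iff₀ (by positivity)]
        have : n ≤ (n / k) * (2 * k) := by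
          have hkn : 0 < k := by exact_mod_cast hk0
          have e6 := Nat.lt_div_mul_add (a := n) hkn
          nlinarith
        exact_mod_cast this
      have e7 := mul_self_le_mul_self (by positivity) e5
      push_cast
      calc (n : ℝ) ^ 2 / (4 * (k : ℝ) ^ 2) = (n : ℝ) / (2 * k) * ((n : ℝ) / (2 * k)) := by
            field_simp
            ring
        _ ≤ _ := e7
    calc _ ≤ (2 : ℝ) ^ n * (n : ℝ) ^ n * (2 ^ ((n : ℝ) ^ 2 / 4) * 2 ^ (-(l * (n : ℝ) ^ 2))) := by
          gcongr
      _ = 1 / 3 * ((3 * (2 : ℝ) ^ n * (n : ℝ) ^ n * 2 ^ (-(l * (n : ℝ) ^ 2))) *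
          2 ^ ((n : ℝ) ^ 2 / 4)) := by ring
      _ ≤ _ := by gcongr
  have b2 : (2 : ℝ) ^ n * (4 ^ n * ((w : ℝ) + 1 + 1) ^ n * (n : ℝ) ^ ⌊κ * n⌋₊ *
      2 ^ ((n : ℝ) ^ 2 / 4)) ≤ 1 / 3 * (2 ^ (-(n : ℝ)) * uN n) := by
    have e1 : (n : ℝ) ^ ⌊κ * n⌋₊ ≤ (n : ℝ) ^ (κ * n) := by
      rw [← Real.rpow_natCast]
      exact Real.rpow_le_rpow_of_exponent_le hn1' (Nat.floor_le (by positivity))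
    have e2 : (3 : ℝ) ≤ 3 ^ n := le_self_pow₀ (by norm_num) (by omega)
    rw [Real.rpow_neg (by norm_num), Real.rpow_natCast, inv_mul_eq_div, one_div,
      inv_mul_eq_div, le_div_iff₀ (by norm_num), le_div_iff₀ (by positivity)]
    calc _ ≤ (2 : ℝ) ^ n * (4 ^ n * ((w : ℝ) + 1 + 1) ^ n * (n : ℝ) ^ (κ * n) *
          2 ^ ((n : ℝ) ^ 2 / 4)) * 3 ^ n * 2 ^ n := by gcongr
      _ = 2 ^ ((n : ℝ) ^ 2 / 4) * (48 * ((w : ℝ) + 2)) ^ n * (n : ℝ) ^ (κ * n) := by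
          rw [show 48 * ((w : ℝ) + 2) = 2 * 4 * (w + 1 + 1) * 3 * 2 by ring, mul_pow, mul_pow,
            mul_pow, mul_pow]
          ring
      _ ≤ _ := h2
  calc _ ≤ _ := hle'
    _ ≤ _ := add_le_add (c1.trans b1) (add_le_add (c2.trans b2) (c3.trans b3))
    _ = _ := by ring

/-! ### The trichotomy -/

theorem natCard_subtype_eq_gcount {V : Type} [Fintype V] (P : SimpleGraph V → Prop) :
    Nat.card {G : SimpleGraph V // P G} = gcount P := by
  rw [Nat.subtype_card (csep P) fun G => mem_csep]
  rfl

theorem gcount_add_le {V : Type} [Fintype V] {P Q R : SimpleGraph V → Prop}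
    (hP : ∀ G, P G → R G) (hQ : ∀ G, Q G → R G) (hPQ : ∀ G, P G → ¬ Q G) :
    gcount P + gcount Q ≤ gcount R := by
  unfold gcount
  rw [← Finset.card_union_of_disjoint]
  · refine Finset.card_le_card fun G hG => ?_
    rw [Finset.mem_union, mem_csep, mem_csep] at hG
    exact mem_csep.2 (hG.elim (hP G) (hQ G))
  · rw [Finset.disjoint_left]
    intro G hG hG'
    exact hPQ G (mem_csep.1 hG) (mem_csep.1 hG')

theorem gcount_le_add_not {V : Type} [Fintype V] (P Q : SimpleGraph V → Prop) :
    gcount P ≤ gcount (fun G => P G ∧ Q G) + gcount (fun G => P G ∧ ¬ Q G) :=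
  (gcount_mono fun G hG => by tauto).trans (gcount_or_le _ _)

theorem coUnipolar_avoid_le {W : Type} [Fintype W] (H : SimpleGraph W) (hH : IsCoUnipolar H) :
    ∀ᶠ n : ℕ in atTop, (gcount (fun G : SimpleGraph (Fin n) => IsCoUnipolar G ∧
      ¬ Nonempty (H ↪g G)) : ℝ) ≤ 2 ^ (-(n : ℝ)) * uN n := by
  filter_upwards [unipolar_avoid_le Hᶜ hH] with n hn
  refine le_trans ?_ hn
  rw [← gcount_compl (fun G : SimpleGraph (Fin n) => IsUnipolar G ∧ ¬ Nonempty (Hᶜ ↪g G))]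
  refine Nat.cast_le.2 (gcount_mono fun G hG => ⟨hG.1, fun ⟨φ⟩ => hG.2 ⟨?_⟩⟩)
  simpa using complEmb φ

theorem unipolar_coUnipolar_le : ∀ᶠ n : ℕ in atTop,
    (gcount (fun G : SimpleGraph (Fin n) => IsCoUnipolar G ∧ IsUnipolar G) : ℝ) ≤
      2 ^ (-(n : ℝ)) * uN n := by
  filter_upwards [unipolar_avoid_le _ (isUnipolar_cliqueUnion 3)] with n hn
  refine le_trans ?_ hn
  exact Nat.cast_le.2 (gcount_mono fun G hG => ⟨hG.2, fun ⟨φ⟩ =>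
    not_isCoUnipolar_cliqueUnion (hG.1.comap φ)⟩)

theorem uN_le_gcount_isPerfect (n : ℕ) :
    uN n ≤ gcount (V := Fin n) IsPerfect := by
  rw [← gcount_isUnipolar (Fintype.card_fin n)]
  exact gcount_mono fun G hG => IsGenSplit.isPerfect (Or.inl hG)

theorem gcount_isPerfect_le (n : ℕ) :
    gcount (V := Fin n) IsPerfect ≤ uN n + uN n + nsN n := by
  have h := gcount_or_le (V := Fin n) IsUnipolar IsCoUnipolar
  rw [gcount_isUnipolar (Fintype.card_fin n), gcount_isCoUnipolar] at h
  refine le_trans ?_ (Nat.add_le_add_right h _)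
  refine le_trans (gcount_mono fun G hG => ?_) (gcount_or_le _ _)
  by_cases hs : IsGenSplit G
  · exact Or.inl hs
  · exact Or.inr ⟨hG.c5Free, hs⟩

theorem two_mul_uN_le (n : ℕ) :
    uN n + uN n ≤ gcount (V := Fin n) IsPerfect +
      gcount (fun G : SimpleGraph (Fin n) => IsCoUnipolar G ∧ IsUnipolar G) := by
  have h := gcount_le_add_not (V := Fin n) IsCoUnipolar IsUnipolar
  rw [gcount_isCoUnipolar] at h
  have h2 := gcount_add_le (V := Fin n) (P := IsUnipolar) (Q := fun G => IsCoUnipolar G ∧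
    ¬ IsUnipolar G) (R := IsPerfect) (fun G hG => IsGenSplit.isPerfect (Or.inl hG))
    (fun G hG => IsGenSplit.isPerfect (Or.inr hG.1)) (fun G hG hG' => hG'.2 hG)
  rw [gcount_isUnipolar (Fintype.card_fin n)] at h2
  omega

theorem uN_le_of_isUnipolar {W : Type} (H : SimpleGraph W) (n : ℕ) :
    uN n ≤ gcount (fun G : SimpleGraph (Fin n) => IsPerfect G ∧ Nonempty (H ↪g G)) +
      gcount (fun G : SimpleGraph (Fin n) => IsUnipolar G ∧ ¬ Nonempty (H ↪g G)) := by
  have h := gcount_le_add_not (V := Fin n) IsUnipolar fun G => Nonempty (H ↪g G)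
  rw [gcount_isUnipolar (Fintype.card_fin n)] at h
  exact h.trans (Nat.add_le_add_right (gcount_mono fun G hG =>
    ⟨IsGenSplit.isPerfect (Or.inl hG.1), hG.2⟩) _)

theorem uN_le_of_isCoUnipolar {W : Type} (H : SimpleGraph W) (n : ℕ) :
    uN n ≤ gcount (fun G : SimpleGraph (Fin n) => IsPerfect G ∧ Nonempty (H ↪g G)) +
      gcount (fun G : SimpleGraph (Fin n) => IsCoUnipolar G ∧ ¬ Nonempty (H ↪g G)) := by
  have h := gcount_le_add_not (V := Fin n) IsCoUnipolar fun G => Nonempty (H ↪g G)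
  rw [gcount_isCoUnipolar] at h
  exact h.trans (Nat.add_le_add_right (gcount_mono fun G hG =>
    ⟨IsGenSplit.isPerfect (Or.inr hG.1), hG.2⟩) _)

theorem gcount_le_of_not_isCoUnipolar {W : Type} {H : SimpleGraph W} (hH : ¬ IsCoUnipolar H)
    (n : ℕ) : gcount (fun G : SimpleGraph (Fin n) => IsPerfect G ∧ Nonempty (H ↪g G)) ≤
      uN n + nsN n := by
  rw [← gcount_isUnipolar (Fintype.card_fin n)]
  refine le_trans (gcount_mono fun G hG => ?_) (gcount_or_le _ _)
  obtain ⟨hG, ⟨φ⟩⟩ := hG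
  by_cases hs : IsGenSplit G
  · exact Or.inl (hs.resolve_right fun h => hH (h.comap φ))
  · exact Or.inr ⟨hG.c5Free, hs⟩

theorem gcount_le_of_not_isUnipolar {W : Type} {H : SimpleGraph W} (hH : ¬ IsUnipolar H)
    (n : ℕ) : gcount (fun G : SimpleGraph (Fin n) => IsPerfect G ∧ Nonempty (H ↪g G)) ≤
      uN n + nsN n := by
  rw [← gcount_isCoUnipolar]
  refine le_trans (gcount_mono fun G hG => ?_) (gcount_or_le _ _)
  obtain ⟨hG, ⟨φ⟩⟩ := hG
  by_cases hs : IsGenSplit G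
  · exact Or.inl (hs.resolve_left fun h => hH (h.comap φ))
  · exact Or.inr ⟨hG.c5Free, hs⟩

theorem gcount_le_of_not_isGenSplit {W : Type} {H : SimpleGraph W} (hH : ¬ IsGenSplit H)
    (n : ℕ) : gcount (fun G : SimpleGraph (Fin n) => IsPerfect G ∧ Nonempty (H ↪g G)) ≤ nsN n :=
  gcount_mono fun _ ⟨hG, ⟨φ⟩⟩ => ⟨hG.c5Free, fun h => hH (h.comap φ)⟩

theorem gcount_isPerfect_le_of_avoid {W : Type} (H : SimpleGraph W) (n : ℕ) :
    gcount (V := Fin n) IsPerfect ≤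
      gcount (fun G : SimpleGraph (Fin n) => IsPerfect G ∧ Nonempty (H ↪g G)) +
      (gcount (fun G : SimpleGraph (Fin n) => IsUnipolar G ∧ ¬ Nonempty (H ↪g G)) +
      (gcount (fun G : SimpleGraph (Fin n) => IsCoUnipolar G ∧ ¬ Nonempty (H ↪g G)) + nsN n)) := by
  refine le_trans (gcount_mono fun G hG => ?_) ((gcount_or_le _ _).trans
    (Nat.add_le_add_left ((gcount_or_le _ _).trans (Nat.add_le_add_left (gcount_or_le _ _) _)) _))
  by_cases hH : Nonempty (H ↪g G)
  · exact Or.inl ⟨hG, hH⟩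
  by_cases hs : IsGenSplit G
  · exact Or.inr (hs.imp (fun h => ⟨h, hH⟩) fun h => Or.inl ⟨h, hH⟩)
  · exact Or.inr (Or.inr (Or.inr ⟨hG.c5Free, hs⟩))

/-- Trichotomy for the probability that a uniformly random perfect graph on `{1,…,n}`
contains a fixed graph `H` as an induced subgraph. -/
theorem induced_subgraph_trichotomy {W : Type} [Fintype W] (H : SimpleGraph W) :
    ∃ c : ℝ, 0 < c ∧ ∃ n₀ : ℕ, ∀ n : ℕ, n₀ ≤ n →
      (¬ IsGenSplit H → inducedProb H n ≤ Real.exp (-(c * n))) ∧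
      (IsGenSplit H → ¬ (IsUnipolar H ∧ IsCoUnipolar H) →
        |inducedProb H n - 1 / 2| ≤ Real.exp (-(c * n))) ∧
      (IsUnipolar H → IsCoUnipolar H →
        1 - Real.exp (-(c * n)) ≤ inducedProb H n) := by
  obtain ⟨c, hc, hns⟩ := nsN_le
  set d := min c 1 with hd
  have hd0 : 0 < d := lt_min hc one_pos
  have hU : ∀ᶠ n : ℕ in atTop, IsUnipolar H → (gcount (fun G : SimpleGraph (Fin n) =>
      IsUnipolar G ∧ ¬ Nonempty (H ↪g G)) : ℝ) ≤ 2 ^ (-(n : ℝ)) * uN n := by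
    by_cases h : IsUnipolar H
    · exact (unipolar_avoid_le H h).mono fun n hn _ => hn
    · exact Eventually.of_forall fun n h' => absurd h' h
  have hC : ∀ᶠ n : ℕ in atTop, IsCoUnipolar H → (gcount (fun G : SimpleGraph (Fin n) =>
      IsCoUnipolar G ∧ ¬ Nonempty (H ↪g G)) : ℝ) ≤ 2 ^ (-(n : ℝ)) * uN n := by
    by_cases h : IsCoUnipolar H
    · exact (coUnipolar_avoid_le H h).mono fun n hn _ => hn
    · exact Eventually.of_forall fun n h' => absurd h' h
  refine ⟨d / 2 * Real.log 2, mul_pos (by positivity) (Real.log_pos one_lt_two), ?_⟩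
  rw [← eventually_atTop]
  filter_upwards [hns, hU, hC, unipolar_coUnipolar_le,
    exp_linear_absorb 3 0 (half_pos hd0)] with n hns hU hC hUC h3
  have hn0 : (0 : ℝ) ≤ n := Nat.cast_nonneg n
  have hu : (0 : ℝ) < uN n := by exact_mod_cast uN_pos n
  set ε : ℝ := 2 ^ (-(d * n)) with hε
  have hexp : 3 * ε ≤ Real.exp (-(d / 2 * Real.log 2 * n)) := by
    rw [show -(d / 2 * Real.log 2 * n) = Real.log 2 * (-(d / 2 * n)) by ring,
      ← Real.rpow_def_of_pos two_pos]
    rw [pow_zero, mul_one] at h3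
    calc 3 * ε ≤ 2 ^ (d / 2 * (n : ℝ)) * ε := by gcongr
      _ = _ := by
        rw [hε, ← Real.rpow_add two_pos]
        congr 1
        ring
  have hε0 : 0 < ε := by positivity
  have hcε : (2 : ℝ) ^ (-(c * n)) ≤ ε :=
    Real.rpow_le_rpow_of_exponent_le one_le_two (by nlinarith [min_le_left c 1])
  have h1ε : (2 : ℝ) ^ (-(n : ℝ)) ≤ ε :=
    Real.rpow_le_rpow_of_exponent_le one_le_two (by nlinarith [min_le_right c 1])
  have hns := hns.trans (mul_le_mul_of_nonneg_right hcε hu.le)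
  have hUC := hUC.trans (mul_le_mul_of_nonneg_right h1ε hu.le)
  have hU := fun h => (hU h).trans (mul_le_mul_of_nonneg_right h1ε hu.le)
  have hC := fun h => (hC h).trans (mul_le_mul_of_nonneg_right h1ε hu.le)
  unfold inducedProb perfectCount
  rw [natCard_subtype_eq_gcount, natCard_subtype_eq_gcount]
  have p1 : (uN n : ℝ) ≤ _ := Nat.cast_le.2 (uN_le_gcount_isPerfect n)
  have p2 := (Nat.cast_le (α := ℝ)).2 (gcount_isPerfect_le n)
  have p3 := (Nat.cast_le (α := ℝ)).2 (two_mul_uN_le n)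
  have p4 := (Nat.cast_le (α := ℝ)).2 (uN_le_of_isUnipolar H n)
  have p5 := (Nat.cast_le (α := ℝ)).2 (uN_le_of_isCoUnipolar H n)
  have p6 := (Nat.cast_le (α := ℝ)).2 (gcount_isPerfect_le_of_avoid H n)
  simp only [Nat.cast_add] at p2 p3 p4 p5 p6
  set N : ℝ := (gcount (fun G : SimpleGraph (Fin n) => IsPerfect G ∧ Nonempty (H ↪g G)) : ℝ)
  set P : ℝ := (gcount (V := Fin n) IsPerfect : ℝ)
  have hP : 0 < P := hu.trans_le p1
  have hεP : ε * uN n ≤ ε * P := mul_le_mul_of_nonneg_left p1 hε0.le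
  have half_close : (uN n : ℝ) - ε * uN n ≤ N → N ≤ uN n + ε * uN n → |N / P - 1 / 2| ≤ 3 * ε := by
    intro h1 h2
    rw [show N / P - 1 / 2 = (N - P / 2) / P by field_simp, abs_div, abs_of_pos hP,
      div_le_iff₀ hP, abs_le]
    have := mul_pos hε0 hP
    constructor <;> linarith
  refine ⟨fun h => le_trans ?_ hexp, fun h h' => le_trans ?_ hexp, fun h h' => ?_⟩
  · have q : N ≤ nsN n := Nat.cast_le.2 (gcount_le_of_not_isGenSplit h n)
    rw [div_le_iff₀ hP]
    have := mul_pos hε0 hP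
    linarith
  · rcases h with h | h
    · have q := (Nat.cast_le (α := ℝ)).2 (gcount_le_of_not_isCoUnipolar (fun hc => h' ⟨h, hc⟩) n)
      rw [Nat.cast_add] at q
      exact half_close (by linarith [hU h]) (by linarith)
    · have q := (Nat.cast_le (α := ℝ)).2 (gcount_le_of_not_isUnipolar (fun hc => h' ⟨hc, h⟩) n)
      rw [Nat.cast_add] at q
      exact half_close (by linarith [hC h]) (by linarith)
  · have q : 1 - 3 * ε ≤ N / P := by
      rw [le_div_iff₀ hP]
      linarith [hU h, hC h']
    linarith
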